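/- For every κ > 0 and s ∈ (0,1], there exist ε₀ = ε₀(κ,s) ∈ (0,1/2] and δ₀ = δ₀(ε,κ,s) > 0 such that the following holds for all δ ∈ (0,δ₀] and ε ∈ (0,ε₀]: let Ω be a (δ,δ,s,δ^{−ε})-configuration with cube family P, and fix δ ≤ λ ≤ t ≤ 1 and Σ := √(λ/t). Then there exist a constant C ≤ K(1 + log(1/δ))^K, where K depends only on κ and s, and a (δ,δ,s,Cδ^{−ε})-configuration G ⊂ Ω with |G| ≥ (K(1 + log(1/δ))^K)^{−1}|Ω|, such that m^{δ^{−ε₀},δ^{−ε₀}}_{λ,λ,t}(ω | G) ≤ δ^{−κ} λ^s |P|_λ for all ω in the (λ,Σ)-skeleton G^λ_Σ, where |P|_λ denotes the number of dyadic λ-cubes intersecting the union of the cubes of P. -/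

import Mathlib

open Metric Set

noncomputable section

/-- The plane `ℝ²`. -/
abbrev Plane := EuclideanSpace ℝ (Fin 2)

/-- The parameter space `ℝ² × ℝ` of circles: a pair `(x, r)` of a centre and a radius. -/
abbrev Param := (EuclideanSpace ℝ (Fin 2)) × ℝ

/-- The point of `ℝ²` with coordinates `a`, `b`. -/
def mk2 (a b : ℝ) : Plane := (WithLp.equiv 2 (Fin 2 → ℝ)).symm ![a, b]

/-- The Euclidean distance on `ℝ² × ℝ`, viewed as `ℝ³`. -/
def pdist (p q : Param) : ℝ := Real.sqrt (dist p.1 q.1 ^ 2 + (p.2 - q.2) ^ 2)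

/-- The tangency parameter `Δ(p,q) = ||x - x'| - |r - r'||`. -/
def tang (p q : Param) : ℝ := abs (dist p.1 q.1 - |p.2 - q.2|)

/-- The domain `𝐃 = {(x,r) : |x| ≤ 1/4, r ∈ [1/2, 1]}`. -/
def domD : Set Param := {p | ‖p.1‖ ≤ 1 / 4 ∧ p.2 ∈ Set.Icc (1 / 2 : ℝ) 1}

/-- The circle `S(p)` with centre `p.1` and radius `p.2`. -/
def circ (p : Param) : Set Plane := Metric.sphere p.1 p.2

/-- The closed `δ`-annulus `S^δ(p)` around the circle `S(p)`. -/
def annulus (δ : ℝ) (p : Param) : Set Plane := {w | Metric.infDist w (circ p) ≤ δ}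

/-- The `(δ,σ)`-rectangle `R^δ_σ(p,v) = S^δ(p) ∩ B(v,σ)`. -/
def rect (δ σ : ℝ) (p : Param) (v : Plane) : Set Plane :=
  annulus δ p ∩ Metric.closedBall v σ

/-- Admissible data `(p, v)` for a rectangle: `p ∈ 𝐃` and `v ∈ S(p)`. -/
def IsRectData (r : Param × Plane) : Prop := r.1 ∈ domD ∧ r.2 ∈ circ r.1

/-- `C`-comparability of two rectangles (given by their data): there is a third
`(δ,σ)`-rectangle `R` with `R₁ ∪ R₂ ⊆ C·R`. -/
def Comp (δ σ C : ℝ) (r₁ r₂ : Param × Plane) : Prop :=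
  ∃ r : Param × Plane, IsRectData r ∧
    rect δ σ r₁.1 r₁.2 ∪ rect δ σ r₂.1 r₂.2 ⊆ rect (C * δ) (C * σ) r.1 r.2

/-- The index of the dyadic `δ`-cube of `ℝ²` containing a point. -/
def idx2 (δ : ℝ) (v : Plane) : ℤ × ℤ := (⌊v 0 / δ⌋, ⌊v 1 / δ⌋)

/-- The index of the dyadic `δ`-cube of `ℝ³ = ℝ² × ℝ` containing a point. -/
def idx3 (δ : ℝ) (p : Param) : (ℤ × ℤ) × ℤ := (idx2 δ p.1, ⌊p.2 / δ⌋)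

/-- `|E|_δ`: the number of dyadic `δ`-cubes intersecting `E ⊆ ℝ²`. -/
def count2 (δ : ℝ) (E : Set Plane) : ℕ := Nat.card (idx2 δ '' E)

/-- `|P|_δ`: the number of dyadic `δ`-cubes intersecting `P ⊆ ℝ³`. -/
def count3 (δ : ℝ) (P : Set Param) : ℕ := Nat.card (idx3 δ '' P)

/-- `|Ω|_δ`: the number of dyadic `δ`-cubes of `ℝ⁵ = ℝ³ × ℝ²` intersecting `Ω`. -/
def count5 (δ : ℝ) (Ω : Set (Param × Plane)) : ℕ :=
  Nat.card ((fun ω => (idx3 δ ω.1, idx2 δ ω.2)) '' Ω)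

/-- A `(δ,s,C)`-set in the plane. -/
def IsDSet2 (δ s C : ℝ) (E : Set Plane) : Prop :=
  Bornology.IsBounded E ∧ ∀ (x : Plane) (r : ℝ), δ ≤ r →
    (count2 δ (E ∩ Metric.closedBall x r) : ℝ) ≤ C * r ^ s * (count2 δ E : ℝ)

/-- A `(δ,s,C)`-set in `ℝ³ = ℝ² × ℝ`. -/
def IsDSet3 (δ s C : ℝ) (P : Set Param) : Prop :=
  Bornology.IsBounded P ∧ ∀ (x : Param) (r : ℝ), δ ≤ r →
    (count3 δ (P ∩ {q | pdist q x ≤ r}) : ℝ) ≤ C * r ^ s * (count3 δ P : ℝ)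

/-- `x ∈ 2^{-ℕ}`. -/
def IsDyadic (x : ℝ) : Prop := ∃ n : ℕ, x = (2 : ℝ) ^ (-(n : ℤ))

/-- The smallest dyadic rational `2^{-n} ≥ σ` (for `σ ∈ (0,1]`). -/
def dyadicCeil (σ : ℝ) : ℝ := (2 : ℝ) ^ (-⌊Real.logb 2 σ⁻¹⌋)

/-- Indices of dyadic cubes in `ℝ³ = ℝ² × ℝ`. -/
abbrev CubeIdx := (ℤ × ℤ) × ℤ

/-- The dyadic cube of side length `δ` with index `k`. -/
def cubeSet (δ : ℝ) (k : CubeIdx) : Set Param :=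
  {p | (k.1.1 : ℝ) * δ ≤ p.1 0 ∧ p.1 0 < ((k.1.1 : ℝ) + 1) * δ ∧
       (k.1.2 : ℝ) * δ ≤ p.1 1 ∧ p.1 1 < ((k.1.2 : ℝ) + 1) * δ ∧
       (k.2 : ℝ) * δ ≤ p.2 ∧ p.2 < ((k.2 : ℝ) + 1) * δ}

/-- The centre of the dyadic cube of side length `δ` with index `k`. -/
def cubeCtr (δ : ℝ) (k : CubeIdx) : Param :=
  (mk2 (((k.1.1 : ℝ) + 1 / 2) * δ) (((k.1.2 : ℝ) + 1 / 2) * δ), ((k.2 : ℝ) + 1 / 2) * δ)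

/-- The unit vector with angle `θ`. -/
def dir (θ : ℝ) : Plane := mk2 (Real.cos θ) (Real.sin θ)

/-- The `j`-th (half-open) arc of the partition `𝒮_σ(p)` of the circle `S(p)`
into arcs of length `2πrσ`. -/
def arcSet (p : Param) (σ : ℝ) (j : ℤ) : Set Plane :=
  {w | ∃ θ : ℝ, (j : ℝ) * (2 * Real.pi * σ) ≤ θ ∧ θ < ((j : ℝ) + 1) * (2 * Real.pi * σ) ∧
    w = p.1 + p.2 • dir θ}

/-- The centre of the `j`-th arc of `𝒮_σ(p)`. -/
def arcCenterAt (p : Param) (σ : ℝ) (j : ℤ) : Plane :=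
  p.1 + p.2 • dir (((j : ℝ) + 1 / 2) * (2 * Real.pi * σ))

/-- Valid indices for the arcs of `𝒮_σ(p)`. -/
def validArc (σ : ℝ) (j : ℤ) : Prop := 0 ≤ j ∧ (j : ℝ) < σ⁻¹

/-- The (one-sided) cone `V(p, I)` centred at the centre of `p` and spanned by `I`. -/
def cone (p : Param) (I : Set Plane) : Set Plane :=
  {x | ∃ e ∈ I, ∃ t : ℝ, 0 ≤ t ∧ x = p.1 + t • (e - p.1)}

/-- A pair: (index of a dyadic cube in `ℝ³`, index of an arc). -/
abbrev DPair := CubeIdx × ℤ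

/-- The relation `(p,v) ≺ (𝐩,𝐯)` between pairs at scales `(δ,σ)` and `(Δ,Σ)`. -/
def prec (δ σ Δ Sg : ℝ) (ω W : DPair) : Prop :=
  cubeSet δ ω.1 ⊆ cubeSet Δ W.1 ∧
  arcCenterAt (cubeCtr δ ω.1) σ ω.2 ∈ cone (cubeCtr Δ W.1) (arcSet (cubeCtr Δ W.1) Sg W.2)

/-- The `(Δ,Σ)`-skeleton `Ω^Δ_Σ` of a set of pairs at scales `(δ,σ)`. -/
def skeleton (δ σ Δ Sg : ℝ) (Ω : Set DPair) : Set DPair :=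
  {W | cubeSet Δ W.1 ⊆ domD ∧ validArc Sg W.2 ∧ ∃ ω ∈ Ω, prec δ σ Δ Sg ω W}

/-- The cube family `P` of a configuration. -/
def configP (Ω : Set DPair) : Set CubeIdx := Prod.fst '' Ω

/-- The arc family `E_σ(p)` of a configuration. -/
def configE (Ω : Set DPair) (k : CubeIdx) : Set ℤ := {j | (k, j) ∈ Ω}

/-- A (dyadic) `(δ,σ,s,C,M)`-configuration. -/
def IsConfigD (δ σ s C : ℝ) (M : ℕ) (Ω : Set DPair) : Prop :=
  (configP Ω).Nonempty ∧
  (∀ k ∈ configP Ω, cubeSet δ k ⊆ domD) ∧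
  IsDSet3 δ s C (⋃ k ∈ configP Ω, cubeSet δ k) ∧
  ∀ k ∈ configP Ω,
    (∀ j ∈ configE Ω k, validArc σ j) ∧
    IsDSet2 σ s C (⋃ j ∈ configE Ω k, arcSet (cubeCtr δ k) σ j) ∧
    Nat.card (configE Ω k) = M

/-- The partial multiplicity function `m^{ρ_λ,ρ_t,C}_{Δ,λ,t}(ω ∣ G)`, counting pairs in the
`(Δ, σa)`-skeleton of `G`; the geometric data of `ω` is given by the circle parameter `pω`
(the centre of the cube of `ω`) and the arc centre `vω`. -/
def pMult (baseδ baseσ Δ σa lam t ρl ρt C : ℝ) (G : Set DPair) (pω : Param) (vω : Plane) : ℕ :=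
  Nat.card {ω' : DPair | ω' ∈ skeleton baseδ baseσ Δ σa G ∧
    (lam ≤ ρl * Δ ∨ lam / ρl ≤ tang pω (cubeCtr Δ ω'.1)) ∧
    tang pω (cubeCtr Δ ω'.1) ≤ ρl * lam ∧
    t / ρt ≤ pdist pω (cubeCtr Δ ω'.1) ∧
    pdist pω (cubeCtr Δ ω'.1) ≤ ρt * t ∧
    (rect (C * Δ) (C * σa) pω vω ∩
      rect (C * Δ) (C * σa) (cubeCtr Δ ω'.1) (arcCenterAt (cubeCtr Δ ω'.1) σa ω'.2)).Nonempty}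

/-- A `δ`-separated set in `ℝ³ = ℝ² × ℝ`. -/
def sep3 (δ : ℝ) (A : Set Param) : Prop := ∀ p ∈ A, ∀ q ∈ A, p ≠ q → δ ≤ pdist p q

/-- A `(δ,ε)`-almost `t`-bipartite pair. -/
def AlmostBipartite (δ ε t : ℝ) (W B : Set Param) : Prop :=
  sep3 δ W ∧ sep3 δ B ∧ (∀ p ∈ W, ∀ q ∈ B, δ ^ ε * t ≤ pdist p q) ∧
    ∀ p ∈ W ∪ B, ∀ q ∈ W ∪ B, pdist p q ≤ δ ^ (-ε) * t

/-- A `t`-bipartite pair (relative to the scale `δ`). -/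
def Bipartite (δ t : ℝ) (W B : Set Param) : Prop :=
  sep3 δ W ∧ sep3 δ B ∧
  (∀ p ∈ W, ∀ q ∈ W, pdist p q ≤ t) ∧ (∀ p ∈ B, ∀ q ∈ B, pdist p q ≤ t) ∧
  (∀ p ∈ B, ∀ q ∈ W, t ≤ pdist p q) ∧
  ∀ p ∈ W ∪ B, ∀ q ∈ W ∪ B, pdist p q ≤ 100 * t

open Classical in
theorem pair_bound {α : Type*} (S : Finset α) (x y : α → ℤ) (near : ℤ → ℤ → Prop)
    (l : ℤ) (hl : 0 < l) (hrefl : ∀ i, near i i)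
    (hsame : ∀ a ∈ S, ∀ b ∈ S, ¬ near (x a) (y a) → ¬ near (x b) (y b) → x a < y a → x b < y b →
      x a < y b)
    (hsameR : ∀ a ∈ S, ∀ b ∈ S, ¬ near (x a) (y a) → ¬ near (x b) (y b) → y a < x a → y b < x b →
      y a < x b)
    (hrev : ∀ a ∈ S, ∀ b ∈ S, ¬ near (x a) (x b) → ¬ near (y a) (y b) →
      ((x a < y a ∧ x a < y b ∧ x b < y a ∧ x b < y b) ∨
       (y a < x a ∧ y a < x b ∧ y b < x a ∧ y b < x b)) → x a < x b → y b < y a)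
    (hsymm : ∀ i j, near i j → near j i) :
    ((S.filter (fun a => ¬ near (x a) (y a) ∧ l ≤ y a - x a ∧ y a - x a < 2 * l)).card : ℤ) ^ 2 ≤
      6 * ((∑ a ∈ S, ∑ b ∈ S, if near (x a) (y a) ∨ near (x b) (y b) ∨ near (x a) (x b) ∨
          near (y a) (y b) then (1 : ℤ) else 0) -
        ∑ a ∈ S, ∑ b ∈ S,
          (if x a / l = x b / l ∧ ¬ near (x a) (x b) then Int.sign (x a - x b) else 0) *
          (if y a / l = y b / l ∧ ¬ near (y a) (y b) then Int.sign (y a - y b) else 0)) := by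
  set NT := S.filter (fun a => ¬ near (x a) (y a)) with hNT
  set e : α → ℤ := fun a => if x a < y a then 1 else -1 with he
  set key : α → ℤ × ℤ := fun a => (x a / l, y a / l) with hkey
  set G := S.filter (fun a => ¬ near (x a) (y a) ∧ l ≤ y a - x a ∧ y a - x a < 2 * l) with hG
  have step1 : ∀ a ∈ S, ∀ b ∈ S,
      (if x a / l = x b / l ∧ ¬ near (x a) (x b) then Int.sign (x a - x b) else 0) *
          (if y a / l = y b / l ∧ ¬ near (y a) (y b) then Int.sign (y a - y b) else 0) ≤
      (if near (x a) (y a) ∨ near (x b) (y b) ∨ near (x a) (x b) ∨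
          near (y a) (y b) then (1 : ℤ) else 0) -
      (if ¬ near (x a) (y a) ∧ ¬ near (x b) (y b) ∧ key a = key b then e a * e b else 0) := by
    intro a ha b hb
    have hsg : ∀ z : ℤ, Int.sign z ≤ 1 ∧ -1 ≤ Int.sign z := by
      intro z
      rcases lt_trichotomy z 0 with h | h | h
      · rw [Int.sign_eq_neg_one_of_neg h]; norm_num
      · subst h; norm_num
      · rw [Int.sign_eq_one_of_pos h]; norm_num
    have hprod : ∀ u v : ℤ, Int.sign u * Int.sign v ≤ 1 := by
      intro u v
      have := hsg u; have := hsg v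
      nlinarith
    have heb : e a * e b ≤ 1 := by
      simp only [he]; split_ifs <;> norm_num
    by_cases t1 : near (x a) (y a)
    · simp only [t1, true_or, if_true, not_true, false_and, if_false]
      split_ifs <;> (have := hprod (x a - x b) (y a - y b); linarith)
    by_cases t2 : near (x b) (y b)
    · simp only [t2, true_or, or_true, if_true, not_true, false_and, and_false, if_false]
      split_ifs <;> (have := hprod (x a - x b) (y a - y b); linarith)
    by_cases k1 : x a / l = x b / l
    swap
    · have : key a ≠ key b := by
        intro h; apply k1; exact congrArg Prod.fst h
      simp only [k1, this, false_and, if_false, and_false, zero_mul]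
      split_ifs <;> norm_num
    by_cases k2 : y a / l = y b / l
    swap
    · have : key a ≠ key b := by
        intro h; apply k2; exact congrArg Prod.snd h
      simp only [k2, this, false_and, if_false, and_false, mul_zero]
      split_ifs <;> norm_num
    have kk : key a = key b := by simp [hkey, k1, k2]
    by_cases n1 : near (x a) (x b)
    · simp only [n1, t1, t2, kk, true_or, or_true, if_true, not_true, not_false_iff, and_true, and_false, if_false, zero_mul]
      linarith
    by_cases n2 : near (y a) (y b)
    · simp only [n2, t1, t2, kk, or_true, if_true, not_true, not_false_iff, and_true, and_false, if_false, mul_zero]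
      linarith
    simp only [n1, n2, t1, t2, kk, k1, k2, or_false, not_false_iff, and_true, if_true, if_false]
    have hxne : x a ≠ x b := fun h => n1 (h ▸ hrefl _)
    have hyne : y a ≠ y b := fun h => n2 (h ▸ hrefl _)
    have hane : x a ≠ y a := fun h => t1 (h ▸ hrefl _)
    have hbne : x b ≠ y b := fun h => t2 (h ▸ hrefl _)
    have n1' : ¬ near (x b) (x a) := fun h => n1 (hsymm _ _ h)
    have n2' : ¬ near (y b) (y a) := fun h => n2 (hsymm _ _ h)
    have key1 : ((x a < y a ∧ x a < y b ∧ x b < y a ∧ x b < y b) ∨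
       (y a < x a ∧ y a < x b ∧ y b < x a ∧ y b < x b)) →
        Int.sign (x a - x b) * Int.sign (y a - y b) = -1 := by
      intro hh
      rcases lt_or_gt_of_ne hxne with h | h
      · have h2 := hrev a ha b hb n1 n2 hh h
        rw [Int.sign_eq_neg_one_of_neg (by linarith), Int.sign_eq_one_of_pos (by linarith)]
        norm_num
      · have h2 := hrev b hb a ha n1' n2' (by tauto) h
        rw [Int.sign_eq_neg_one_of_neg (a := y a - y b) (by linarith), Int.sign_eq_one_of_pos (by linarith)]
        norm_num
    by_cases ca : x a < y a
    · by_cases cb : x b < y b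
      · rw [key1 (Or.inl ⟨ca, hsame a ha b hb t1 t2 ca cb, hsame b hb a ha t2 t1 cb ca, cb⟩)]
        simp [he, ca, cb]
      · have := hprod (x a - x b) (y a - y b)
        simp only [he, ca, cb, if_true, if_false]; linarith
    · by_cases cb : x b < y b
      · have := hprod (x a - x b) (y a - y b)
        simp only [he, ca, cb, if_true, if_false]; linarith
      · have ca' : y a < x a := by omega
        have cb' : y b < x b := by omega
        rw [key1 (Or.inr ⟨ca', hsameR a ha b hb t1 t2 ca' cb', hsameR b hb a ha t2 t1 cb' ca', cb'⟩)]
        simp [he, ca, cb]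
  have step2 := Finset.sum_le_sum (fun a ha => Finset.sum_le_sum (fun b hb => step1 a ha b hb))
  simp only [Finset.sum_sub_distrib] at step2
  have step3 : ∑ a ∈ S, ∑ b ∈ S, (if ¬ near (x a) (y a) ∧ ¬ near (x b) (y b) ∧ key a = key b then e a * e b else 0)
      = ∑ κ ∈ NT.image key, (∑ a ∈ NT.filter (fun a => key a = κ), e a) ^ 2 := by
    have h1 : ∑ a ∈ S, ∑ b ∈ S, (if ¬ near (x a) (y a) ∧ ¬ near (x b) (y b) ∧ key a = key b then e a * e b else 0)
      = ∑ a ∈ NT, ∑ b ∈ NT, (if key a = key b then e a * e b else 0) := by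
      rw [hNT, Finset.sum_filter]
      refine Finset.sum_congr rfl fun a _ => ?_
      rw [Finset.sum_filter]
      by_cases h : near (x a) (y a)
      · simp [h]
      · simp only [h, not_false_iff, true_and, if_true]
        refine Finset.sum_congr rfl fun b _ => ?_
        by_cases h' : near (x b) (y b) <;> simp [h']
    rw [h1]
    have h2 := Finset.sum_fiberwise_of_maps_to (s := NT) (g := key) (t := NT.image key)
      (fun a ha => Finset.mem_image_of_mem _ ha)
      (fun a => ∑ b ∈ NT, (if key a = key b then e a * e b else 0))
    rw [← h2]
    refine Finset.sum_congr rfl fun κ _ => ?_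
    rw [sq, Finset.sum_mul_sum]
    refine Finset.sum_congr rfl fun a ha => ?_
    rw [(Finset.mem_filter.1 ha).2, ← Finset.sum_filter]
    refine Finset.sum_congr ?_ fun b hb => rfl
    ext b; simp only [Finset.mem_filter, eq_comm]
  have hGNT : G ⊆ NT := by
    intro a ha
    simp only [hG, hNT, Finset.mem_filter] at ha ⊢
    exact ⟨ha.1, ha.2.1⟩
  have hcard : (G.image key).card ≤ 6 := by
    rcases G.eq_empty_or_nonempty with h0 | h0
    · simp [h0]
    obtain ⟨a0, ha0, hmin⟩ := Finset.exists_min_image G x h0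
    have : G.image key ⊆ ((Finset.Icc (0:ℤ) 2) ×ˢ (Finset.Icc (1:ℤ) 2)).image
        (fun u => (x a0 / l + u.1, x a0 / l + u.1 + u.2)) := by
      intro κ hκ
      obtain ⟨b, hb, rfl⟩ := Finset.mem_image.1 hκ
      have hm := hmin b hb
      simp only [hG, Finset.mem_filter] at ha0 hb
      have h3 := hsame b hb.1 a0 ha0.1 hb.2.1 ha0.2.1 (by linarith) (by linarith)
      have e1 := Int.mul_ediv_add_emod (x b) l
      have e2 := Int.mul_ediv_add_emod (y b) l
      have e3 := Int.mul_ediv_add_emod (x a0) l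
      have := Int.emod_nonneg (x b) hl.ne'
      have := Int.emod_nonneg (y b) hl.ne'
      have := Int.emod_nonneg (x a0) hl.ne'
      have := Int.emod_lt_of_pos (x b) hl
      have := Int.emod_lt_of_pos (y b) hl
      have := Int.emod_lt_of_pos (x a0) hl
      refine Finset.mem_image.2 ⟨(x b / l - x a0 / l, y b / l - x b / l), ?_, ?_⟩
      · simp only [Finset.mem_product, Finset.mem_Icc]
        refine ⟨⟨?_, ?_⟩, ?_, ?_⟩
        · have : x a0 / l ≤ x b / l := Int.ediv_le_ediv hl hm
          linarith
        · by_contra hc; push Not at hc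
          nlinarith
        · by_contra hc; push Not at hc
          nlinarith
        · by_contra hc; push Not at hc
          nlinarith
      · simp only [hkey]; ext <;> simp
    calc _ ≤ _ := Finset.card_le_card this
      _ ≤ _ := Finset.card_image_le
      _ = 6 := by rfl
  have step4 : (G.card : ℤ) ^ 2 ≤ 6 * ∑ κ ∈ G.image key, ((G.filter (fun a => key a = κ)).card : ℤ) ^ 2 := by
    have h1 : (G.card : ℤ) = ∑ κ ∈ G.image key, ((G.filter (fun a => key a = κ)).card : ℤ) := by
      rw [Finset.card_eq_sum_card_image key G]; push_cast; rfl
    rw [h1]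
    refine le_trans sq_sum_le_card_mul_sum_sq ?_
    have : (0:ℤ) ≤ ∑ κ ∈ G.image key, ((G.filter (fun a => key a = κ)).card : ℤ) ^ 2 :=
      Finset.sum_nonneg fun _ _ => by positivity
    have h6 : ((G.image key).card : ℤ) ≤ 6 := by exact_mod_cast hcard
    nlinarith
  have step5 : ∑ κ ∈ G.image key, ((G.filter (fun a => key a = κ)).card : ℤ) ^ 2 ≤
      ∑ κ ∈ NT.image key, (∑ a ∈ NT.filter (fun a => key a = κ), e a) ^ 2 := by
    refine le_trans ?_ (Finset.sum_le_sum_of_subset_of_nonneg (Finset.image_subset_image hGNT) (fun _ _ _ => sq_nonneg _))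
    refine Finset.sum_le_sum fun κ hκ => ?_
    obtain ⟨b, hb, rfl⟩ := Finset.mem_image.1 hκ
    simp only [hG, Finset.mem_filter] at hb
    have hlt : x b / l < y b / l := by
      have : x b / l + 1 = (x b + l) / l := by rw [Int.add_ediv_of_dvd_right (dvd_refl l), Int.ediv_self hl.ne']
      have : (x b + l) / l ≤ y b / l := Int.ediv_le_ediv hl (by linarith)
      omega
    have h1 : ∑ a ∈ NT.filter (fun a => key a = key b), e a = ((NT.filter (fun a => key a = key b)).card : ℤ) := by
      rw [Finset.card_eq_sum_ones]; push_cast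
      refine Finset.sum_congr rfl fun a ha => ?_
      have hk := (Finset.mem_filter.1 ha).2
      simp only [hkey, Prod.mk.injEq] at hk
      have : x a < y a := by
        by_contra hc; push Not at hc
        have := Int.ediv_le_ediv hl hc
        omega
      simp [he, this]
    rw [h1]
    have : (G.filter (fun a => key a = key b)).card ≤ (NT.filter (fun a => key a = key b)).card :=
      Finset.card_le_card (Finset.filter_subset_filter _ hGNT)
    gcongr
  rw [step3] at step2
  linarith

open Classical in
theorem core0_bad {α : Type*} (P : Finset α) (L : α → α → Prop)
    (x : α → α → ℤ) (near : ℤ → ℤ → Prop)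
    (l q : ℝ) (hl0 : 0 ≤ l) (hq0 : 0 ≤ q)
    (c1 : ∀ p ∈ P, ((P.filter (fun a => L p a)).card : ℝ) ≤ l)
    (c1' : ∀ a ∈ P, ((P.filter (fun p => L p a)).card : ℝ) ≤ l)
    (c2 : ∀ p ∈ P, ∀ a ∈ P, L p a →
      ((P.filter (fun b => L p b ∧ near (x p a) (x p b))).card : ℝ) ≤ q)
    (c3 : ∀ p ∈ P, ∀ a ∈ P, L p a →
      ((P.filter (fun p' => L p' a ∧ near (x p a) (x p' a))).card : ℝ) ≤ q) :
    (∑ p ∈ P, ∑ p' ∈ P, (((P.filter (fun a => L p a ∧ L p' a)).filter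
        (fun a => near (x p a) (x p' a))).card : ℝ)) ≤
      (∑ p ∈ P, ((P.filter (fun a => L p a)).card : ℝ)) * q ∧
    (∑ p ∈ P, ∑ p' ∈ P, ∑ a ∈ P.filter (fun a => L p a ∧ L p' a),
      ∑ b ∈ P.filter (fun a => L p a ∧ L p' a),
      (if near (x p a) (x p' a) ∨ near (x p b) (x p' b) ∨ near (x p a) (x p b) ∨
          near (x p' a) (x p' b) then (1 : ℝ) else 0)) ≤
      4 * ((∑ p ∈ P, ((P.filter (fun a => L p a)).card : ℝ)) * l * q) := by
  set Λ : ℝ := ∑ p ∈ P, ((P.filter (fun a => L p a)).card : ℝ) with hΛ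
  have ht : (∑ p ∈ P, ∑ p' ∈ P, (((P.filter (fun a => L p a ∧ L p' a)).filter
        (fun a => near (x p a) (x p' a))).card : ℝ)) ≤ Λ * q := by
    rw [hΛ, Finset.sum_mul]
    refine Finset.sum_le_sum fun p hp => ?_
    calc (∑ p' ∈ P, (((P.filter (fun a => L p a ∧ L p' a)).filter
        (fun a => near (x p a) (x p' a))).card : ℝ))
        = ∑ p' ∈ P, ∑ a ∈ P.filter (fun a => L p a), if L p' a ∧ near (x p a) (x p' a) then (1:ℝ) else 0 := by
          refine Finset.sum_congr rfl fun p' _ => ?_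
          rw [Finset.sum_boole]
          congr 2
          ext a; simp only [Finset.mem_filter]; tauto
      _ = ∑ a ∈ P.filter (fun a => L p a), ∑ p' ∈ P, if L p' a ∧ near (x p a) (x p' a) then (1:ℝ) else 0 :=
          Finset.sum_comm
      _ ≤ ∑ a ∈ P.filter (fun a => L p a), q := by
          refine Finset.sum_le_sum fun a ha => ?_
          rw [Finset.sum_boole]
          have := Finset.mem_filter.1 ha
          exact c3 p hp a this.1 this.2
      _ = _ := by rw [Finset.sum_const, nsmul_eq_mul]
  have hT : (∑ p ∈ P, ∑ p' ∈ P, ((P.filter (fun a => L p a ∧ L p' a)).card : ℝ)) ≤ Λ * l := by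
    rw [hΛ, Finset.sum_mul]
    refine Finset.sum_le_sum fun p hp => ?_
    calc (∑ p' ∈ P, ((P.filter (fun a => L p a ∧ L p' a)).card : ℝ))
        = ∑ p' ∈ P, ∑ a ∈ P.filter (fun a => L p a), if L p' a then (1:ℝ) else 0 := by
          refine Finset.sum_congr rfl fun p' _ => ?_
          rw [Finset.sum_boole, Finset.filter_filter]
      _ = ∑ a ∈ P.filter (fun a => L p a), ∑ p' ∈ P, if L p' a then (1:ℝ) else 0 :=
          Finset.sum_comm
      _ ≤ ∑ a ∈ P.filter (fun a => L p a), l := by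
          refine Finset.sum_le_sum fun a ha => ?_
          rw [Finset.sum_boole]
          exact c1' a (Finset.mem_filter.1 ha).1
      _ = _ := by rw [Finset.sum_const, nsmul_eq_mul]
  refine ⟨ht, ?_⟩
  have hcl : ∀ p ∈ P, ∀ p', ((P.filter (fun a => L p a ∧ L p' a)).card : ℝ) ≤ l := by
    intro p hp p'
    refine le_trans ?_ (c1 p hp)
    exact_mod_cast Finset.card_le_card (fun a ha => by
      simp only [Finset.mem_filter] at ha ⊢; tauto)
  have key : ∀ p ∈ P, ∀ p' ∈ P, (∑ a ∈ P.filter (fun a => L p a ∧ L p' a),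
      ∑ b ∈ P.filter (fun a => L p a ∧ L p' a),
      (if near (x p a) (x p' a) ∨ near (x p b) (x p' b) ∨ near (x p a) (x p b) ∨
          near (x p' a) (x p' b) then (1 : ℝ) else 0)) ≤
      2 * ((((P.filter (fun a => L p a ∧ L p' a)).filter
        (fun a => near (x p a) (x p' a))).card : ℝ) * l) +
      2 * (((P.filter (fun a => L p a ∧ L p' a)).card : ℝ) * q) := by
    intro p hp p' hp'
    set S := P.filter (fun a => L p a ∧ L p' a) with hS
    have hb : ∀ a ∈ S, ∀ b ∈ S, (if near (x p a) (x p' a) ∨ near (x p b) (x p' b) ∨ near (x p a) (x p b) ∨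
          near (x p' a) (x p' b) then (1 : ℝ) else 0) ≤
        (if near (x p a) (x p' a) then (1:ℝ) else 0) + (if near (x p b) (x p' b) then (1:ℝ) else 0)
        + (if near (x p a) (x p b) then (1:ℝ) else 0) + (if near (x p' a) (x p' b) then (1:ℝ) else 0) := by
      intro a _ b _
      by_cases h1 : near (x p a) (x p' a) <;> by_cases h2 : near (x p b) (x p' b) <;>
      by_cases h3 : near (x p a) (x p b) <;> by_cases h4 : near (x p' a) (x p' b) <;>
      simp [h1, h2, h3, h4] <;> norm_num
    refine le_trans (Finset.sum_le_sum fun a ha => Finset.sum_le_sum fun b hb' => hb a ha b hb') ?_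
    simp only [Finset.sum_add_distrib]
    have e1 : ∑ a ∈ S, ∑ b ∈ S, (if near (x p a) (x p' a) then (1:ℝ) else 0) ≤
        ((S.filter (fun a => near (x p a) (x p' a))).card : ℝ) * l := by
      simp only [Finset.sum_const, nsmul_eq_mul]
      rw [← Finset.mul_sum, Finset.sum_boole, mul_comm]
      exact mul_le_mul_of_nonneg_left (hcl p hp p') (by positivity)
    have e2 : ∑ a ∈ S, ∑ b ∈ S, (if near (x p b) (x p' b) then (1:ℝ) else 0) ≤
        ((S.filter (fun a => near (x p a) (x p' a))).card : ℝ) * l := by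
      rw [Finset.sum_comm]; exact e1
    have e3 : ∑ a ∈ S, ∑ b ∈ S, (if near (x p a) (x p b) then (1:ℝ) else 0) ≤ (S.card : ℝ) * q := by
      rw [← nsmul_eq_mul, ← Finset.sum_const]
      refine Finset.sum_le_sum fun a ha => ?_
      have ha' := Finset.mem_filter.1 ha
      rw [Finset.sum_boole]
      refine le_trans ?_ (c2 p hp a ha'.1 ha'.2.1)
      exact_mod_cast Finset.card_le_card (fun b hb => by
        simp only [hS, Finset.mem_filter] at hb ⊢; tauto)
    have e4 : ∑ a ∈ S, ∑ b ∈ S, (if near (x p' a) (x p' b) then (1:ℝ) else 0) ≤ (S.card : ℝ) * q := by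
      rw [← nsmul_eq_mul, ← Finset.sum_const]
      refine Finset.sum_le_sum fun a ha => ?_
      have ha' := Finset.mem_filter.1 ha
      rw [Finset.sum_boole]
      refine le_trans ?_ (c2 p' hp' a ha'.1 ha'.2.2)
      exact_mod_cast Finset.card_le_card (fun b hb => by
        simp only [hS, Finset.mem_filter] at hb ⊢; tauto)
    linarith
  refine le_trans (Finset.sum_le_sum fun p hp => Finset.sum_le_sum fun p' hp' => key p hp p' hp') ?_
  simp only [Finset.sum_add_distrib, ← Finset.mul_sum, ← Finset.sum_mul]
  have := mul_le_mul_of_nonneg_right ht hl0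
  have := mul_le_mul_of_nonneg_right hT hq0
  nlinarith

set_option maxHeartbeats 1000000 in
open Classical in
theorem core0 {α : Type*} (P : Finset α) (L : α → α → Prop)
    (x : α → α → ℤ) (near : ℤ → ℤ → Prop) (h : α → ℤ → ℝ) (B : ℝ) (J : ℤ) (m : ℕ) (hJ : J ≤ 2 ^ m)
    (hrefl : ∀ i, near i i) (hsymm : ∀ i j, near i j → near j i)
    (hx : ∀ p ∈ P, ∀ a ∈ P, L p a → 0 ≤ x p a ∧ x p a < J)
    (halt : ∀ p ∈ P, ∀ q ∈ P, ∀ i j k l : ℤ, 0 ≤ i → i < j → j < k → k < l → l < J →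
      ¬ (h q i < h p i ∧ h p j < h q j ∧ h q k < h p k ∧ h p l < h q l))
    (F1 : ∀ p ∈ P, ∀ a ∈ P, L p a → h a (x p a) ≤ h p (x p a) + B)
    (F2 : ∀ p ∈ P, ∀ a ∈ P, L p a → ∀ i, 0 ≤ i → i < J → ¬ near (x p a) i → h p i + B < h a i)
    (l q Nt : ℝ) (hl0 : 0 ≤ l) (hq0 : 0 ≤ q) (hNt : 0 ≤ Nt)
    (c1 : ∀ p ∈ P, ((P.filter (fun a => L p a)).card : ℝ) ≤ l)
    (c1' : ∀ a ∈ P, ((P.filter (fun p => L p a)).card : ℝ) ≤ l)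
    (c2 : ∀ p ∈ P, ∀ a ∈ P, L p a →
      ((P.filter (fun b => L p b ∧ near (x p a) (x p b))).card : ℝ) ≤ q)
    (c3 : ∀ p ∈ P, ∀ a ∈ P, L p a →
      ((P.filter (fun p' => L p' a ∧ near (x p a) (x p' a))).card : ℝ) ≤ q)
    (c4 : ∀ p ∈ P, ((P.filter (fun p' => ∃ a ∈ P, L p a ∧ L p' a)).card : ℝ) ≤ Nt)
    (Λ : ℝ) (hΛ : Λ = ∑ p ∈ P, ((P.filter (fun a => L p a)).card : ℝ)) :
    Λ ≤ 2 * P.card * q ∨ Λ ^ 3 ≤ 384 * m ^ 2 * P.card ^ 3 * Nt * l * q := by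
  obtain ⟨ht, hbad⟩ := core0_bad P L x near l q hl0 hq0 c1 c1' c2 c3
  rw [← hΛ] at ht hbad
  have hΛ0 : 0 ≤ Λ := by rw [hΛ]; positivity
  set com : α → α → Finset α := fun p p' => P.filter (fun a => L p a ∧ L p' a) with hcom
  set N : ℝ := (P.card : ℝ) with hN
  have hN0 : 0 ≤ N := by positivity
  set T : ℝ := ∑ p ∈ P, ∑ p' ∈ P, ((com p p').card : ℝ) with hT
  set τ : ℝ := ∑ p ∈ P, ∑ p' ∈ P, (((com p p').filter (fun a => near (x p a) (x p' a))).card : ℝ) with hτ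
  -- Cauchy-Schwarz
  have hCS : Λ ^ 2 ≤ N * T := by
    have e1 : Λ = ∑ a ∈ P, ∑ p ∈ P, (if L p a then (1:ℝ) else 0) := by
      rw [hΛ, Finset.sum_comm]
      refine Finset.sum_congr rfl fun p _ => ?_
      rw [Finset.sum_boole]
    have e2 : T = ∑ a ∈ P, (∑ p ∈ P, (if L p a then (1:ℝ) else 0)) ^ 2 := by
      calc T = ∑ p ∈ P, ∑ p' ∈ P, ∑ a ∈ P, (if L p a then (1:ℝ) else 0) * (if L p' a then (1:ℝ) else 0) := by
            refine Finset.sum_congr rfl fun p _ => Finset.sum_congr rfl fun p' _ => ?_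
            rw [hcom, ← Finset.sum_boole]
            refine Finset.sum_congr rfl fun a _ => ?_
            by_cases h1 : L p a <;> by_cases h2 : L p' a <;> simp [h1, h2]
        _ = ∑ p ∈ P, ∑ a ∈ P, ∑ p' ∈ P, (if L p a then (1:ℝ) else 0) * (if L p' a then (1:ℝ) else 0) :=
            Finset.sum_congr rfl fun p _ => Finset.sum_comm
        _ = ∑ a ∈ P, ∑ p ∈ P, ∑ p' ∈ P, (if L p a then (1:ℝ) else 0) * (if L p' a then (1:ℝ) else 0) :=
            Finset.sum_comm
        _ = _ := by
            refine Finset.sum_congr rfl fun a _ => ?_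
            rw [sq, Finset.sum_mul_sum]
    rw [e1, e2]
    exact sq_sum_le_card_mul_sum_sq
  set gap : ℕ → α → α → Finset α := fun k p p' => (com p p').filter (fun a => ¬ near (x p a) (x p' a) ∧
    (2:ℤ) ^ k ≤ x p' a - x p a ∧ x p' a - x p a < 2 * 2 ^ k) with hgap
  have hmain : ∀ k, (∑ p ∈ P, ∑ p' ∈ P, ((gap k p p').card : ℝ)) ^ 2 ≤ 24 * (N * Nt * Λ * l * q) := by
    intro k
    set s : α → α → α → ℤ := fun p a b => if L p a ∧ L p b then
      (if x p a / 2 ^ k = x p b / 2 ^ k ∧ ¬ near (x p a) (x p b) then Int.sign (x p a - x p b) else 0) else 0 with hs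
    have hpb : ∀ p ∈ P, ∀ p' ∈ P, ((gap k p p').card : ℝ) ^ 2 ≤ 6 * ((∑ a ∈ com p p', ∑ b ∈ com p p',
      (if near (x p a) (x p' a) ∨ near (x p b) (x p' b) ∨ near (x p a) (x p b) ∨
          near (x p' a) (x p' b) then (1 : ℝ) else 0)) - ∑ a ∈ P, ∑ b ∈ P, (s p a b : ℝ) * s p' a b) := by
      intro p hp p' hp'
      have hfp : ∀ a ∈ com p p', ¬ near (x p a) (x p' a) → h p' (x p a) < h p (x p a) := by
        intro a ha hn
        obtain ⟨haP, h1, h2⟩ := Finset.mem_filter.1 ha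
        have := F1 p hp a haP h1
        have := F2 p' hp' a haP h2 (x p a) (hx p hp a haP h1).1 (hx p hp a haP h1).2 (fun h => hn (hsymm _ _ h))
        linarith
      have hfp' : ∀ a ∈ com p p', ¬ near (x p a) (x p' a) → h p (x p' a) < h p' (x p' a) := by
        intro a ha hn
        obtain ⟨haP, h1, h2⟩ := Finset.mem_filter.1 ha
        have := F1 p' hp' a haP h2
        have := F2 p hp a haP h1 (x p' a) (hx p' hp' a haP h2).1 (hx p' hp' a haP h2).2 hn
        linarith
      have hr : ∀ a ∈ com p p', 0 ≤ x p a ∧ x p a < J ∧ 0 ≤ x p' a ∧ x p' a < J := by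
        intro a ha
        obtain ⟨haP, h1, h2⟩ := Finset.mem_filter.1 ha
        exact ⟨(hx p hp a haP h1).1, (hx p hp a haP h1).2, (hx p' hp' a haP h2).1, (hx p' hp' a haP h2).2⟩
      have hab : ∀ p ∈ P, ∀ a ∈ P, ∀ b ∈ P, L p a → L p b → ¬ near (x p a) (x p b) → h a (x p a) < h b (x p a) := by
        intro p hp a ha b hb h1 h2 hn
        have := F1 p hp a ha h1
        have := F2 p hp b hb h2 (x p a) (hx p hp a ha h1).1 (hx p hp a ha h1).2 (fun h => hn (hsymm _ _ h))
        linarith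
      have := pair_bound (com p p') (fun a => x p a) (fun a => x p' a) near (2 ^ k) (by positivity) hrefl
        (by
          intro a ha b hb na nb la lb
          by_contra hc
          push Not at hc
          have A1 := hfp a ha na
          have A2 := hfp' a ha na
          have B1 := hfp b hb nb
          have B2 := hfp' b hb nb
          rcases lt_or_eq_of_le hc with hc | hc
          · exact halt p hp p' hp' _ _ _ _ (hr b hb).1 lb hc la (hr a ha).2.2.2 ⟨B1, B2, A1, A2⟩
          · rw [hc] at B2; linarith)
        (by
          intro a ha b hb na nb la lb
          by_contra hc
          push Not at hc
          have A1 := hfp a ha na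
          have A2 := hfp' a ha na
          have B1 := hfp b hb nb
          have B2 := hfp' b hb nb
          rcases lt_or_eq_of_le hc with hc | hc
          · exact halt p' hp' p hp _ _ _ _ (hr b hb).2.2.1 lb hc la (hr a ha).2.1 ⟨B2, B1, A2, A1⟩
          · rw [hc] at B1; linarith)
        (by
          intro a ha b hb na nb hh hlt
          by_contra hc
          push Not at hc
          have hne : x p' a ≠ x p' b := fun h => nb (h ▸ hrefl _)
          have hc : x p' a < x p' b := lt_of_le_of_ne hc hne
          obtain ⟨haP, h1, h2⟩ := Finset.mem_filter.1 ha
          obtain ⟨hbP, h1', h2'⟩ := Finset.mem_filter.1 hb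
          have A1 := hab p hp a haP b hbP h1 h1' na
          have A2 := hab p hp b hbP a haP h1' h1 (fun h => na (hsymm _ _ h))
          have A3 := hab p' hp' a haP b hbP h2 h2' nb
          have A4 := hab p' hp' b hbP a haP h2' h2 (fun h => nb (hsymm _ _ h))
          rcases hh with hh | hh
          · exact halt b hbP a haP _ _ _ _ (hr a ha).1 hlt hh.2.2.1 hc (hr b hb).2.2.2 ⟨A1, A2, A3, A4⟩
          · exact halt b hbP a haP _ _ _ _ (hr a ha).2.2.1 hc hh.2.2.1 hlt (hr b hb).2.1 ⟨A3, A4, A1, A2⟩)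
        hsymm
      have e1 : ∑ a ∈ P, ∑ b ∈ P, (s p a b) * s p' a b = ∑ a ∈ com p p', ∑ b ∈ com p p',
          (if x p a / 2 ^ k = x p b / 2 ^ k ∧ ¬ near (x p a) (x p b) then Int.sign (x p a - x p b) else 0) *
          (if x p' a / 2 ^ k = x p' b / 2 ^ k ∧ ¬ near (x p' a) (x p' b) then Int.sign (x p' a - x p' b) else 0) := by
        rw [hcom]
        simp only [Finset.sum_filter]
        refine Finset.sum_congr rfl fun a _ => ?_
        by_cases ha : L p a ∧ L p' a
        · rw [if_pos ha]
          refine Finset.sum_congr rfl fun b _ => ?_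
          simp only [hs, ha.1, ha.2, true_and]
          by_cases hb1 : L p b <;> by_cases hb2 : L p' b <;> simp [hb1, hb2]
        · rw [if_neg ha]
          refine Finset.sum_eq_zero fun b _ => ?_
          simp only [hs]
          by_cases h1 : L p a
          · have h2 : ¬ L p' a := fun h => ha ⟨h1, h⟩
            simp [h2]
          · simp [h1]
      rw [← e1] at this
      have h3 := (Int.cast_le (R := ℝ)).2 this
      push_cast at h3
      simp only [hgap]
      exact h3
    have hpos : 0 ≤ ∑ p ∈ P, ∑ p' ∈ P, ∑ a ∈ P, ∑ b ∈ P, (s p a b : ℝ) * s p' a b := by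
      have : ∑ p ∈ P, ∑ p' ∈ P, ∑ a ∈ P, ∑ b ∈ P, (s p a b : ℝ) * s p' a b =
          ∑ a ∈ P, ∑ b ∈ P, (∑ p ∈ P, (s p a b : ℝ)) ^ 2 := by
        calc _ = ∑ p ∈ P, ∑ a ∈ P, ∑ p' ∈ P, ∑ b ∈ P, (s p a b : ℝ) * s p' a b :=
              Finset.sum_congr rfl fun p _ => Finset.sum_comm
          _ = ∑ a ∈ P, ∑ p ∈ P, ∑ p' ∈ P, ∑ b ∈ P, (s p a b : ℝ) * s p' a b := Finset.sum_comm
          _ = ∑ a ∈ P, ∑ b ∈ P, ∑ p ∈ P, ∑ p' ∈ P, (s p a b : ℝ) * s p' a b := by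
              refine Finset.sum_congr rfl fun a _ => ?_
              rw [Finset.sum_comm (s := P) (t := P) (f := fun b p => ∑ p' ∈ P, (s p a b : ℝ) * s p' a b)]
              exact Finset.sum_congr rfl fun p _ => Finset.sum_comm
          _ = _ := by
              refine Finset.sum_congr rfl fun a _ => Finset.sum_congr rfl fun b _ => ?_
              rw [sq, Finset.sum_mul_sum]
      rw [this]
      positivity
    have hsumsq : ∑ p ∈ P, ∑ p' ∈ P, ((gap k p p').card : ℝ) ^ 2 ≤ 24 * (Λ * l * q) := by
      have := Finset.sum_le_sum fun p hp => Finset.sum_le_sum fun p' hp' => hpb p hp p' hp'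
      simp only [← Finset.mul_sum, Finset.sum_sub_distrib] at this
      linarith
    -- Cauchy-Schwarz over close pairs
    set Q : Finset (α × α) := (P ×ˢ P).filter (fun u => ∃ a ∈ P, L u.1 a ∧ L u.2 a) with hQ
    have hQc : (Q.card : ℝ) ≤ N * Nt := by
      have : (Q.card : ℝ) = ∑ p ∈ P, ((P.filter (fun p' => ∃ a ∈ P, L p a ∧ L p' a)).card : ℝ) := by
        rw [hQ, ← Finset.sum_boole, Finset.sum_product]
        refine Finset.sum_congr rfl fun p _ => ?_
        rw [Finset.sum_boole]
      rw [this, hN, ← nsmul_eq_mul, ← Finset.sum_const]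
      exact Finset.sum_le_sum c4
    have hgz : ∀ u ∈ P ×ˢ P, u ∉ Q → ((gap k u.1 u.2).card : ℝ) = 0 := by
      intro u hu hnu
      have : gap k u.1 u.2 = ∅ := by
        rw [Finset.eq_empty_iff_forall_notMem]
        intro a ha
        simp only [hgap, hcom, Finset.mem_filter] at ha
        exact hnu (Finset.mem_filter.2 ⟨hu, a, ha.1.1, ha.1.2⟩)
      simp [this]
    have e3 : ∑ p ∈ P, ∑ p' ∈ P, ((gap k p p').card : ℝ) = ∑ u ∈ Q, ((gap k u.1 u.2).card : ℝ) := by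
      rw [← Finset.sum_product' P P (fun p p' => ((gap k p p').card : ℝ))]
      exact (Finset.sum_subset (Finset.filter_subset _ _) (fun u hu hnu => hgz u hu hnu)).symm
    have e4 : ∑ u ∈ Q, ((gap k u.1 u.2).card : ℝ) ^ 2 ≤ ∑ p ∈ P, ∑ p' ∈ P, ((gap k p p').card : ℝ) ^ 2 := by
      rw [← Finset.sum_product' P P (fun p p' => ((gap k p p').card : ℝ) ^ 2)]
      exact Finset.sum_le_sum_of_subset_of_nonneg (Finset.filter_subset _ _) (fun _ _ _ => by positivity)
    rw [e3]
    calc _ ≤ (Q.card : ℝ) * ∑ u ∈ Q, ((gap k u.1 u.2).card : ℝ) ^ 2 := sq_sum_le_card_mul_sum_sq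
      _ ≤ (N * Nt) * (24 * (Λ * l * q)) := by
          exact mul_le_mul hQc (e4.trans hsumsq) (Finset.sum_nonneg fun u _ => sq_nonneg _) (mul_nonneg hN0 hNt)
      _ = _ := by ring
  set TL : ℝ := ∑ p ∈ P, ∑ p' ∈ P, (((com p p').filter (fun a => ¬ near (x p a) (x p' a) ∧ x p a < x p' a)).card : ℝ) with hTL
  have hT1 : T ≤ τ + 2 * TL := by
    have e1 : TL = ∑ p ∈ P, ∑ p' ∈ P, (((com p p').filter (fun a => ¬ near (x p a) (x p' a) ∧ x p' a < x p a)).card : ℝ) := by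
      rw [hTL, Finset.sum_comm]
      refine Finset.sum_congr rfl fun p _ => Finset.sum_congr rfl fun p' _ => ?_
      congr 2
      ext a
      simp only [hcom, Finset.mem_filter]
      have : near (x p a) (x p' a) ↔ near (x p' a) (x p a) := ⟨hsymm _ _, hsymm _ _⟩
      tauto
    have e2 : T ≤ τ + TL + ∑ p ∈ P, ∑ p' ∈ P, (((com p p').filter (fun a => ¬ near (x p a) (x p' a) ∧ x p' a < x p a)).card : ℝ) := by
      rw [hT, hτ, hTL]
      simp only [← Finset.sum_add_distrib]
      refine Finset.sum_le_sum fun p _ => Finset.sum_le_sum fun p' _ => ?_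
      have : com p p' ⊆ ((com p p').filter (fun a => near (x p a) (x p' a)) ∪
        (com p p').filter (fun a => ¬ near (x p a) (x p' a) ∧ x p a < x p' a)) ∪
        (com p p').filter (fun a => ¬ near (x p a) (x p' a) ∧ x p' a < x p a) := by
        intro a ha
        simp only [Finset.mem_union, Finset.mem_filter]
        by_cases hn : near (x p a) (x p' a)
        · tauto
        · have hne : x p a ≠ x p' a := fun h => hn (h ▸ hrefl _)
          rcases lt_or_gt_of_ne hne with h | h <;> tauto
      have h1 := (Finset.card_le_card this).trans ((Finset.card_union_le _ _).trans
        (Nat.add_le_add_right (Finset.card_union_le _ _) _))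
      exact_mod_cast h1
    linarith
  have hTL1 : TL ≤ ∑ k ∈ Finset.range m, ∑ p ∈ P, ∑ p' ∈ P, ((gap k p p').card : ℝ) := by
    rw [Finset.sum_comm]
    refine Finset.sum_le_sum fun p hp => ?_
    rw [Finset.sum_comm]
    refine Finset.sum_le_sum fun p' hp' => ?_
    have : (com p p').filter (fun a => ¬ near (x p a) (x p' a) ∧ x p a < x p' a) ⊆
        (Finset.range m).biUnion (fun k => gap k p p') := by
      intro a ha
      obtain ⟨ha, hn, hlt⟩ := Finset.mem_filter.1 ha
      obtain ⟨haP, h1, h2⟩ := Finset.mem_filter.1 ha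
      have r1 := hx p hp a haP h1
      have r2 := hx p' hp' a haP h2
      obtain ⟨d, hd⟩ := Int.eq_ofNat_of_zero_le (a := x p' a - x p a) (by linarith)
      have hd0 : d ≠ 0 := by intro h0; subst h0; simp at hd; omega
      have hdm : d < 2 ^ m := by
        have : (d : ℤ) < 2 ^ m := by rw [← hd]; linarith
        exact_mod_cast this
      refine Finset.mem_biUnion.2 ⟨Nat.log 2 d, ?_, ?_⟩
      · rw [Finset.mem_range]
        exact Nat.log_lt_of_lt_pow hd0 hdm
      · have i1 := Nat.pow_log_le_self 2 hd0
        have i2 := Nat.lt_pow_succ_log_self (b := 2) (by norm_num) d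
        refine Finset.mem_filter.2 ⟨ha, hn, ?_, ?_⟩
        · rw [hd]; exact_mod_cast i1
        · rw [hd]; rw [pow_succ'] at i2; exact_mod_cast i2
    have h1 := (Finset.card_le_card this).trans Finset.card_biUnion_le
    exact_mod_cast h1
  set X : ℝ := Real.sqrt (24 * (N * Nt * Λ * l * q)) with hX
  have hTL2 : TL ≤ m * X := by
    refine hTL1.trans ?_
    have : ∀ k ∈ Finset.range m, ∑ p ∈ P, ∑ p' ∈ P, ((gap k p p').card : ℝ) ≤ X :=
      fun k _ => Real.le_sqrt_of_sq_le (hmain k)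
    have := Finset.sum_le_sum this
    simpa using this
  by_cases hcase : T ≤ 2 * τ
  · left
    have h1 : Λ * Λ ≤ (2 * N * q) * Λ := by nlinarith
    rcases hΛ0.eq_or_lt with h0 | h0
    · rw [← h0]; positivity
    · exact le_of_mul_le_mul_right h1 h0
  · right
    push Not at hcase
    have h1 : T ≤ 4 * (m * X) := by linarith
    have h2 : Λ ^ 2 ≤ 4 * N * m * X := by nlinarith
    have hX2 : X ^ 2 = 24 * (N * Nt * Λ * l * q) := Real.sq_sqrt (by positivity)
    have h3 : (Λ ^ 2) ^ 2 ≤ (4 * N * m * X) ^ 2 := by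
      exact pow_le_pow_left₀ (by positivity) h2 2
    have h4 : Λ ^ 3 * Λ ≤ (384 * m ^ 2 * N ^ 3 * Nt * l * q) * Λ := by
      calc Λ ^ 3 * Λ = (Λ ^ 2) ^ 2 := by ring
        _ ≤ _ := h3
        _ = 16 * N ^ 2 * m ^ 2 * X ^ 2 := by ring
        _ = _ := by rw [hX2]; ring
    rcases hΛ0.eq_or_lt with h0 | h0
    · rw [← h0]
      have : (0:ℝ) ^ 3 = 0 := by norm_num
      rw [this]; positivity
    · exact le_of_mul_le_mul_right h4 h0


theorem alt4 (A B C t1 t2 t3 t4 : ℝ) (h12 : t1 < t2) (h23 : t2 < t3) (h34 : t3 < t4)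
    (h41 : t4 < t1 + 2 * Real.pi) :
    ¬ (0 < A + B * Real.cos t1 + C * Real.sin t1 ∧ A + B * Real.cos t2 + C * Real.sin t2 < 0 ∧
      0 < A + B * Real.cos t3 + C * Real.sin t3 ∧ A + B * Real.cos t4 + C * Real.sin t4 < 0) := by
  rintro ⟨h1, h2, h3, h4⟩
  have key : ∀ a b : ℝ, a < b → b < a + 2 * Real.pi →
      0 < Real.sin (b / 2) * Real.cos (a / 2) - Real.cos (b / 2) * Real.sin (a / 2) := by
    intro a b hab hba
    rw [← Real.sin_sub]
    apply Real.sin_pos_of_pos_of_lt_pi <;> linarith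
  have f : ∀ θ : ℝ, A + B * Real.cos θ + C * Real.sin θ =
      A * (Real.cos (θ/2) ^ 2 + Real.sin (θ/2) ^ 2) + B * (Real.cos (θ/2) ^ 2 - Real.sin (θ/2) ^ 2)
        + C * (2 * Real.sin (θ/2) * Real.cos (θ/2)) := by
    intro θ
    have e1 : Real.cos θ = Real.cos (θ/2) ^ 2 - Real.sin (θ/2) ^ 2 := by
      rw [← Real.cos_two_mul']; congr 1; ring
    have e2 : Real.sin θ = 2 * Real.sin (θ/2) * Real.cos (θ/2) := by
      rw [← Real.sin_two_mul]; congr 1; ring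
    rw [Real.cos_sq_add_sin_sq, ← e1, ← e2]; ring
  have k21 := key t1 t2 h12 (by linarith)
  have k31 := key t1 t3 (by linarith) (by linarith)
  have k41 := key t1 t4 (by linarith) (by linarith)
  have k32 := key t2 t3 h23 (by linarith)
  have k42 := key t2 t4 (by linarith) (by linarith)
  have k43 := key t3 t4 h34 (by linarith)
  rw [f] at h1 h2 h3 h4
  generalize Real.cos (t1/2) = c1 at *
  generalize Real.sin (t1/2) = s1 at *
  generalize Real.cos (t2/2) = c2 at *
  generalize Real.sin (t2/2) = s2 at *
  generalize Real.cos (t3/2) = c3 at *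
  generalize Real.sin (t3/2) = s3 at *
  generalize Real.cos (t4/2) = c4 at *
  generalize Real.sin (t4/2) = s4 at *
  have id : (s3*c2-c3*s2)*(s4*c2-c4*s2)*(s4*c3-c4*s3) * (A * (c1^2+s1^2) + B * (c1^2-s1^2) + C * (2*s1*c1))
      + (s2*c1-c2*s1)*(s4*c1-c4*s1)*(s4*c2-c4*s2) * (A * (c3^2+s3^2) + B * (c3^2-s3^2) + C * (2*s3*c3))
      = (s3*c1-c3*s1)*(s4*c1-c4*s1)*(s4*c3-c4*s3) * (A * (c2^2+s2^2) + B * (c2^2-s2^2) + C * (2*s2*c2))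
      + (s2*c1-c2*s1)*(s3*c1-c3*s1)*(s3*c2-c3*s2) * (A * (c4^2+s4^2) + B * (c4^2-s4^2) + C * (2*s4*c4)) := by
    ring
  have q1 := mul_pos (mul_pos (mul_pos k32 k42) k43) h1
  have q3 := mul_pos (mul_pos (mul_pos k21 k41) k42) h3
  have q2 := mul_pos (mul_pos (mul_pos k31 k41) k43) (neg_pos.2 h2)
  have q4 := mul_pos (mul_pos (mul_pos k21 k31) k32) (neg_pos.2 h4)
  linarith

set_option maxHeartbeats 1000000 in
theorem geoA {E : Type*} [NormedAddCommGroup E] [InnerProductSpace ℝ E]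
    (x z e1 e0 : E) (r1 r2 ς ρ lam t σ d : ℝ) (hρ : 1 ≤ ρ) (hlam : 0 < lam) (ht : 0 < t) (ht1 : t ≤ 1)
    (hσ0 : 0 < σ) (hσ1 : lam ≤ t * σ ^ 2) (hls : lam ≤ σ)
    (hsm : 1000 * ρ ^ 2 * lam ≤ t) (hς : ς = 1 ∨ ς = -1) (hr : ς * (r2 - r1) = |r2 - r1|)
    (hr1 : 1 / 2 ≤ r1) (hr1' : r1 ≤ 1) (hr2 : 1/2 ≤ r2) (hr2' : r2 ≤ 1)
    (hd : ‖x‖ = d) (hd1 : d ≤ 1/2) (hd2 : t / (4 * ρ) ≤ d) (htang : |d - abs (r2 - r1)| ≤ ρ * lam)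
    (he0 : ‖e0‖ = 1) (hx0 : x = (-(ς * d)) • e0) (he1 : ‖e1‖ = 1)
    (hz1 : |‖z‖ - r1| ≤ ρ * lam) (hz2 : |‖z - x‖ - r2| ≤ ρ * lam)
    (hz : ‖z - r1 • e1‖ ≤ ρ * σ) : ‖e1 - e0‖ ≤ 14 * ρ * σ := by
  have hρ0 : 0 < ρ := by linarith
  have hd0 : 0 < d := lt_of_lt_of_le (by positivity) hd2
  have hρl : ρ * lam ≤ 1/1000 := by nlinarith
  have hρl0 : 0 < ρ * lam := by positivity
  obtain ⟨a1, a2⟩ := abs_le.1 hz1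
  set R := ‖z‖ with hR
  have hR0 : 1/4 ≤ R := by linarith
  set e : E := R⁻¹ • z with he
  have hen : ‖e‖ = 1 := by
    rw [he, norm_smul, Real.norm_eq_abs, abs_of_pos (by positivity)]
    exact inv_mul_cancel₀ (by linarith)
  have hze : z = R • e := by rw [he, smul_smul, mul_inv_cancel₀ (by linarith), one_smul]
  set g := ‖z - x‖ - R with hg
  obtain ⟨b1, b2⟩ := abs_le.1 hz2
  have hgr : |g - (r2 - r1)| ≤ 2 * (ρ * lam) := by rw [abs_le]; constructor <;> linarith
  -- inner product
  have hin : ‖e - e0‖ ^ 2 = 2 - 2 * inner ℝ e e0 := by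
    rw [norm_sub_sq_real, hen, he0]; ring
  set y := inner ℝ e e0 with hy
  have hsq : (R + g) ^ 2 = R ^ 2 + 2 * R * (ς * d) * y + d ^ 2 := by
    have : R + g = ‖z - x‖ := by rw [hg]; ring
    rw [this, norm_sub_sq_real, hd, ← hR]
    have : inner ℝ z x = -(R * (ς * d) * y) := by
      conv_lhs => rw [hze, hx0]
      rw [real_inner_smul_left, real_inner_smul_right]; ring
    rw [this]; ring
  have hς2 : ς * ς = 1 := by rcases hς with h | h <;> rw [h] <;> norm_num
  -- bound
  have hag : |d - abs g| ≤ 3 * (ρ * lam) := by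
    have h1 := abs_abs_sub_abs_le_abs_sub (r2 - r1) g
    rw [abs_sub_comm] at hgr
    calc |d - abs g| = |(d - |r2 - r1|) + (|r2 - r1| - |g|)| := by congr 1; ring
      _ ≤ _ := (abs_add_le _ _).trans (by linarith)
  have hgb : |g| ≤ 1 := by
    have := abs_le.1 hgr
    rw [abs_le]; constructor <;> linarith
  have hdg : |d ^ 2 - g ^ 2| ≤ 3 * (ρ * lam) * (3/2) := by
    have : d ^ 2 - g ^ 2 = (d - |g|) * (d + |g|) := by rw [← sq_abs g]; ring
    rw [this, abs_mul]
    apply mul_le_mul hag _ (abs_nonneg _) (by positivity)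
    rw [abs_of_nonneg (by positivity)]; linarith
  have hdy : d * (1 - y) ≤ 12 * (ρ * lam) := by
    -- (R+g)^2 - R^2 - d^2 = 2 R ς d y
    have h1 : 2 * R * (d * (1 - y)) = 2 * R * (d - ς * g) + ς * (d ^ 2 - g ^ 2) := by
      have : 2 * R * d * y = ς * (2 * R * g + g ^ 2 - d ^ 2) := by
        calc 2 * R * d * y = ς * (2 * R * (ς * d) * y) := by linear_combination (-2 * R * d * y) * hς2
          _ = _ := by rw [show 2 * R * (ς * d) * y = (R+g)^2 - R^2 - d^2 by linarith]; ring
      linarith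
    have habs : |ς| = 1 := by rcases hς with h | h <;> rw [h] <;> norm_num
    have h2 : d - ς * g ≤ 3 * (ρ * lam) := by
      have e1 : d - ς * g = (d - |r2 - r1|) - ς * (g - (r2 - r1)) := by rw [← hr]; ring
      have e2 : |ς * (g - (r2 - r1))| ≤ 2 * (ρ * lam) := by rw [abs_mul, habs, one_mul]; exact hgr
      have := (abs_le.1 e2).1
      have := (abs_le.1 htang).2
      linarith
    have h3 : ς * (d ^ 2 - g ^ 2) ≤ 3 * (ρ * lam) * (3/2) := by
      refine (le_abs_self _).trans ?_
      rw [abs_mul, habs, one_mul]; exact hdg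
    have h4 : 2 * R * (d * (1 - y)) ≤ 2 * R * (12 * (ρ * lam)) := by
      rw [h1]; nlinarith
    exact le_of_mul_le_mul_left h4 (by positivity)
  have hee : ‖e - e0‖ ≤ 10 * ρ * σ := by
    apply (pow_le_pow_iff_left₀ (norm_nonneg _) (by positivity) two_ne_zero).1
    rw [hin]
    have h1 : d * (2 - 2 * y) ≤ d * (10 * ρ * σ) ^ 2 := by
      have h2 : t * σ ^ 2 / (4 * ρ) ≤ d * σ ^ 2 := by
        rw [mul_div_right_comm]; exact mul_le_mul_of_nonneg_right hd2 (by positivity)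
      have h3 : lam / (4 * ρ) ≤ d * σ ^ 2 := le_trans (by gcongr) h2
      have h4 : lam ≤ d * σ ^ 2 * (4 * ρ) := by rwa [div_le_iff₀ (by positivity)] at h3
      have h5 : ρ * lam ≤ ρ * (d * σ ^ 2 * (4 * ρ)) := by gcongr
      have h6 : 0 ≤ d * σ ^ 2 * ρ ^ 2 := by positivity
      nlinarith
    exact le_of_mul_le_mul_left h1 hd0
  have he1e : ‖e1 - e‖ ≤ 4 * ρ * σ := by
    have h1 : r1 • (e1 - e) = (R - r1) • e - (z - r1 • e1) := by
      rw [hze] ; simp only [smul_sub, sub_smul]; abel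
    have h2 : r1 * ‖e1 - e‖ ≤ ρ * lam + ρ * σ := by
      calc r1 * ‖e1 - e‖ = ‖r1 • (e1 - e)‖ := by
            rw [norm_smul, Real.norm_eq_abs, abs_of_pos (by linarith)]
        _ ≤ ‖(R - r1) • e‖ + ‖z - r1 • e1‖ := by rw [h1]; exact norm_sub_le _ _
        _ ≤ _ := by
            rw [norm_smul, hen, mul_one, Real.norm_eq_abs]; linarith
    have h3 : ρ * lam ≤ ρ * σ := by gcongr
    have h4 : 1/2 * ‖e1 - e‖ ≤ r1 * ‖e1 - e‖ := mul_le_mul_of_nonneg_right hr1 (norm_nonneg _)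
    linarith
  calc ‖e1 - e0‖ = ‖(e1 - e) + (e - e0)‖ := by congr 1; abel
    _ ≤ _ := (norm_add_le _ _).trans (by linarith)

set_option maxHeartbeats 1000000 in
theorem geoB {E : Type*} [NormedAddCommGroup E] [InnerProductSpace ℝ E]
    (x1 x2 z e1 e2 : E) (r1 r2 ρ lam t σ ς : ℝ) (hρ : 1 ≤ ρ) (hlam : 0 < lam) (ht : 0 < t) (ht1 : t ≤ 1)
    (hσ0 : 0 < σ) (hσ1 : lam ≤ t * σ ^ 2) (hσ2 : t * σ ^ 2 ≤ 4 * lam) (hls : lam ≤ σ)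
    (hsm : 1000 * ρ ^ 2 * lam ≤ t) (hς : ς = if r1 < r2 then 1 else -1)
    (hx1 : ‖x1‖ ≤ 1/4) (hx2 : ‖x2‖ ≤ 1/4)
    (hr1 : 1 / 2 ≤ r1) (hr1' : r1 ≤ 1) (hr2 : 1/2 ≤ r2) (hr2' : r2 ≤ 1)
    (htang : |dist x1 x2 - abs (r1 - r2)| ≤ ρ * lam)
    (hp1 : t / ρ ≤ Real.sqrt (dist x1 x2 ^ 2 + (r1 - r2) ^ 2))
    (hp2 : Real.sqrt (dist x1 x2 ^ 2 + (r1 - r2) ^ 2) ≤ ρ * t)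
    (he1 : ‖e1‖ = 1) (he2 : ‖e2‖ = 1)
    (hz1 : |dist z x1 - r1| ≤ ρ * lam) (hz2 : |dist z x2 - r2| ≤ ρ * lam)
    (hz1' : dist z (x1 + r1 • e1) ≤ ρ * σ) (hz2' : dist z (x2 + r2 • e2) ≤ ρ * σ) :
    ς * ((inner ℝ x2 e1 + r2) - (inner ℝ x1 e1 + r1)) ≤ 393 * ρ ^ 3 * lam ∧
    (∀ e : E, ‖e‖ = 1 → 100 * ρ ^ 2 * σ < dist e1 e →
      393 * ρ ^ 3 * lam < ς * ((inner ℝ x2 e + r2) - (inner ℝ x1 e + r1))) ∧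
    dist e1 e2 ≤ 28 * ρ * σ := by
  have hρ0 : 0 < ρ := by linarith
  set d := dist x1 x2 with hd
  have hd0' : 0 ≤ d := dist_nonneg
  have hρl : ρ * lam ≤ t / ρ / 1000 := by
    rw [div_div, le_div_iff₀ (by positivity)]; nlinarith
  have hrr : |r1 - r2| = |r2 - r1| := abs_sub_comm _ _
  rw [hrr] at htang
  obtain ⟨c1, c2⟩ := abs_le.1 htang
  have hd2 : t / (4 * ρ) ≤ d := by
    have h1 : Real.sqrt (d ^ 2 + (r1 - r2) ^ 2) ≤ d + |r2 - r1| := by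
      rw [Real.sqrt_le_left (by positivity), ← hrr, ← sq_abs (r1 - r2)]
      nlinarith [abs_nonneg (r1 - r2)]
    have h2 : t / (4 * ρ) = t / ρ / 4 := by rw [div_div, mul_comm]
    rw [h2]
    have : 0 < t / ρ := by positivity
    linarith
  have hd0 : 0 < d := lt_of_lt_of_le (by positivity) hd2
  have hd3 : d ≤ ρ * t := by
    refine le_trans ?_ hp2
    apply Real.le_sqrt_of_sq_le; nlinarith [sq_nonneg (r1 - r2)]
  have hd1 : d ≤ 1/2 := by
    rw [hd, dist_eq_norm]; exact (norm_sub_le _ _).trans (by linarith)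
  have hrpos : 0 < |r2 - r1| := by
    have h2 : t / (4 * ρ) = t / ρ / 4 := by rw [div_div, mul_comm]
    rw [h2] at hd2
    have : 0 < t / ρ := by positivity
    linarith
  have hς' : ς = 1 ∨ ς = -1 := by rw [hς]; split_ifs <;> simp
  have hς2 : ς * ς = 1 := by rcases hς' with h | h <;> rw [h] <;> norm_num
  have hr : ς * (r2 - r1) = |r2 - r1| := by
    rw [hς]; split_ifs with h
    · rw [abs_of_pos (by linarith)]; ring
    · push Not at h; rw [abs_of_nonpos (by linarith)]; ring
  set e0 : E := (-(ς * d⁻¹)) • (x2 - x1) with he0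
  have hxn : ‖x2 - x1‖ = d := by rw [hd, dist_comm, dist_eq_norm]
  have he0n : ‖e0‖ = 1 := by
    rw [he0, norm_smul, hxn, Real.norm_eq_abs, abs_neg, abs_mul, abs_inv, abs_of_pos hd0]
    have habs : |ς| = 1 := by rcases hς' with h | h <;> rw [h] <;> norm_num
    rw [habs, one_mul, inv_mul_cancel₀ hd0.ne']
  have hx0 : x2 - x1 = (-(ς * d)) • e0 := by
    rw [he0, smul_smul]
    have : -(ς * d) * -(ς * d⁻¹) = 1 := by
      calc _ = (ς * ς) * (d * d⁻¹) := by ring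
        _ = 1 := by rw [hς2, mul_inv_cancel₀ hd0.ne', one_mul]
    rw [this, one_smul]
  have hE1 : ‖e1 - e0‖ ≤ 14 * ρ * σ := by
    refine geoA (x2 - x1) (z - x1) e1 e0 r1 r2 ς ρ lam t σ d hρ hlam ht ht1 hσ0 hσ1 hls hsm hς' hr
      hr1 hr1' hr2 hr2' hxn hd1 hd2 htang he0n hx0 he1 (by rwa [← dist_eq_norm]) ?_ ?_
    · rw [show z - x1 - (x2 - x1) = z - x2 by abel, ← dist_eq_norm]; exact hz2
    · rw [show z - x1 - r1 • e1 = z - (x1 + r1 • e1) by abel, ← dist_eq_norm]; exact hz1'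
  have hE2 : ‖e2 - e0‖ ≤ 14 * ρ * σ := by
    refine geoA (x1 - x2) (z - x2) e2 e0 r2 r1 (-ς) ρ lam t σ d hρ hlam ht ht1 hσ0 hσ1 hls hsm ?_ ?_
      hr2 hr2' hr1 hr1' (by rw [hd, dist_eq_norm]) hd1 hd2 (by rw [hrr]; exact htang) he0n ?_ he2 (by rwa [← dist_eq_norm]) ?_ ?_
    · rcases hς' with h | h <;> rw [h] <;> norm_num
    · rw [hrr, ← hr]; ring
    · rw [show x1 - x2 = -(x2 - x1) by abel, hx0, ← neg_smul]; congr 1; ring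
    · rw [show z - x2 - (x1 - x2) = z - x1 by abel, ← dist_eq_norm]; exact hz1
    · rw [show z - x2 - r2 • e2 = z - (x2 + r2 • e2) by abel, ← dist_eq_norm]; exact hz2'
  have hH : ∀ e : E, ‖e‖ = 1 → ς * ((inner ℝ x2 e + r2) - (inner ℝ x1 e + r1)) =
      (|r2 - r1| - d) + d / 2 * ‖e - e0‖ ^ 2 := by
    intro e he
    have h1 : ‖e - e0‖ ^ 2 = 2 - 2 * inner ℝ e0 e := by
      rw [norm_sub_sq_real, he, he0n, real_inner_comm]; ring
    have h2 : inner ℝ x2 e - inner ℝ x1 e = -(ς * d) * inner ℝ e0 e := by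
      rw [← inner_sub_left, hx0, real_inner_smul_left]
    rw [h1, ← hr]
    linear_combination ς * h2 - d * inner ℝ e0 e * hς2
  have hρ3 : ρ * lam ≤ ρ ^ 3 * lam := by
    have : ρ ^ 1 ≤ ρ ^ 3 := pow_le_pow_right₀ hρ (by norm_num)
    rw [pow_one] at this; gcongr
  refine ⟨?_, ?_, ?_⟩
  · rw [hH e1 he1]
    have h1 : ‖e1 - e0‖ ^ 2 ≤ (14 * ρ * σ) ^ 2 := pow_le_pow_left₀ (norm_nonneg _) hE1 2
    have h2 : d / 2 * ‖e1 - e0‖ ^ 2 ≤ (ρ * t) / 2 * (14 * ρ * σ) ^ 2 := by gcongr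
    have h3 : (ρ * t) / 2 * (14 * ρ * σ) ^ 2 = 98 * ρ ^ 3 * (t * σ ^ 2) := by ring
    have h4 : 98 * ρ ^ 3 * (t * σ ^ 2) ≤ 98 * ρ ^ 3 * (4 * lam) := by gcongr
    linarith
  · intro e he hfar
    rw [hH e he]
    have h1 : 86 * ρ ^ 2 * σ ≤ ‖e - e0‖ := by
      rw [dist_eq_norm] at hfar
      have h2 : ‖e1 - e‖ ≤ ‖e1 - e0‖ + ‖e - e0‖ := by
        rw [show e1 - e = (e1 - e0) - (e - e0) by abel]; exact norm_sub_le _ _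
      have h3 : 14 * ρ * σ ≤ 14 * ρ ^ 2 * σ := by
        have : ρ ≤ ρ ^ 2 := le_self_pow₀ hρ (by norm_num)
        gcongr
      linarith
    have h2 : t / (4 * ρ) / 2 * (86 * ρ ^ 2 * σ) ^ 2 ≤ d / 2 * ‖e - e0‖ ^ 2 := by gcongr
    have h3 : t / (4 * ρ) / 2 * (86 * ρ ^ 2 * σ) ^ 2 = (86 ^ 2 / 8) * ρ ^ 3 * (t * σ ^ 2) := by
      field_simp; ring
    have h4 : (86 ^ 2 / 8) * ρ ^ 3 * lam ≤ (86 ^ 2 / 8) * ρ ^ 3 * (t * σ ^ 2) := by gcongr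
    have h5 : 0 < ρ ^ 3 * lam := by positivity
    linarith
  · rw [dist_eq_norm, show e1 - e2 = (e1 - e0) - (e2 - e0) by abel]
    exact (norm_sub_le _ _).trans (by linarith)

open Classical in
set_option maxHeartbeats 1000000 in
theorem core1 {α : Type*} [DecidableEq α] (V W : Finset (α × ℤ)) (hWV : W ⊆ V) (R : α × ℤ → α × ℤ → Prop)
    (nd : ℤ → ℤ → ℝ) (h : α → ℤ → ℝ) (sg : α → α → ℝ) (cl : α → α → Prop)
    (B M1 M2 K D2 n n' Nt : ℝ) (J : ℤ) (m : ℕ) (hJ : J ≤ 2 ^ m)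
    (hM1 : 0 ≤ M1) (hM2 : 0 ≤ M2) (hD2 : 0 ≤ D2) (hn : 0 ≤ n) (hn' : 0 ≤ n') (hNt : 0 ≤ Nt) (hK : 0 ≤ K)
    (nd0 : ∀ i, nd i i = 0) (nds : ∀ i j, nd i j = nd j i) (ndt : ∀ i j k, nd i k ≤ nd i j + nd j k)
    (hcount : ∀ j, (((Finset.Ico 0 J).filter (fun i => nd j i ≤ M1 + M2)).card : ℝ) ≤ K)
    (hV : ∀ v ∈ V, 0 ≤ v.2 ∧ v.2 < J)
    (halt : ∀ p q : α, ∀ i j k l : ℤ, 0 ≤ i → i < j → j < k → k < l → l < J →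
      ¬ (h q i < h p i ∧ h p j < h q j ∧ h q k < h p k ∧ h p l < h q l))
    (hsg : ∀ p a, sg p a = 1 ∨ sg p a = -1)
    (Rs : ∀ v w, R v w → R w v)
    (F1 : ∀ v ∈ V, ∀ w ∈ V, R v w → sg v.1 w.1 * (h w.1 v.2 - h v.1 v.2) ≤ B)
    (F2 : ∀ v ∈ V, ∀ w ∈ V, R v w → ∀ i, 0 ≤ i → i < J → M1 < nd v.2 i →
      B < sg v.1 w.1 * (h w.1 i - h v.1 i))
    (F3 : ∀ v ∈ V, ∀ w ∈ V, R v w → nd v.2 w.2 ≤ M2)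
    (F4 : ∀ v ∈ V, ∀ w ∈ V, ∀ v' ∈ V, ∀ w' ∈ V, R v w → R v' w' → w.1 = w'.1 → cl v.1 v'.1)
    (c4 : ∀ p ∈ V.image Prod.fst, (((V.image Prod.fst).filter (fun p' => cl p p')).card : ℝ) ≤ Nt)
    (cD : ∀ p ∈ V.image Prod.fst, ((V.filter (fun v => v.1 = p)).card : ℝ) ≤ D2)
    (cn' : ∀ v ∈ V, ((V.filter (fun w => R v w)).card : ℝ) ≤ n')
    (cn : ∀ v ∈ W, n ≤ ((V.filter (fun w => R v w)).card : ℝ)) :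
    W.card * n ≤ 4 * K ^ 3 * (V.image Prod.fst).card * n' ∨
    (W.card * n) ^ 3 ≤ 3072 * K ^ 7 * m ^ 2 * (V.image Prod.fst).card ^ 3 * Nt * D2 * n' ^ 2 := by
  set P := V.image Prod.fst with hP
  have hPm : ∀ v ∈ V, v.1 ∈ P := fun v hv => Finset.mem_image_of_mem _ hv
  have cgen : ∀ (M : ℝ) (j : ℤ), M ≤ M1 + M2 → (((Finset.Ico 0 J).filter (fun i => nd j i ≤ M)).card : ℝ) ≤ K := by
    intro M j hM
    refine le_trans ?_ (hcount j)
    exact_mod_cast Finset.card_le_card (fun i hi => by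
      rw [Finset.mem_filter] at hi ⊢; exact ⟨hi.1, hi.2.trans hM⟩)
  -- choose sign
  set Tr : ℝ → Finset ((α × ℤ) × (α × ℤ)) := fun ς => (W ×ˢ V).filter (fun u => R u.1 u.2 ∧ sg u.1.1 u.2.1 = ς) with hTr
  have htot : W.card * n ≤ ((Tr 1).card : ℝ) + ((Tr (-1)).card : ℝ) := by
    have h1 : (W.card : ℝ) * n ≤ (((W ×ˢ V).filter (fun u => R u.1 u.2)).card : ℝ) := by
      rw [← Finset.sum_boole, Finset.sum_product, ← nsmul_eq_mul, ← Finset.sum_const]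
      refine Finset.sum_le_sum fun v hv => ?_
      rw [Finset.sum_boole]
      exact cn v hv
    refine h1.trans ?_
    have : (W ×ˢ V).filter (fun u => R u.1 u.2) ⊆ Tr 1 ∪ Tr (-1) := by
      intro u hu
      simp only [hTr, Finset.mem_union, Finset.mem_filter] at hu ⊢
      rcases hsg u.1.1 u.2.1 with h | h <;> tauto
    exact_mod_cast (Finset.card_le_card this).trans (Finset.card_union_le _ _)
  obtain ⟨ς, hς, hςT⟩ : ∃ ς : ℝ, (ς = 1 ∨ ς = -1) ∧ W.card * n ≤ 2 * ((Tr ς).card : ℝ) := by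
    rcases le_total ((Tr 1).card : ℝ) ((Tr (-1)).card : ℝ) with h | h
    · exact ⟨-1, Or.inr rfl, by linarith⟩
    · exact ⟨1, Or.inl rfl, by linarith⟩
  set L : α → α → Prop := fun p a => ∃ j j' : ℤ, (p, j) ∈ W ∧ (a, j') ∈ V ∧ R (p, j) (a, j') ∧ sg p a = ς with hL
  have hex : ∀ p a, ∃ u : ℤ × ℤ, L p a → ((p, u.1) ∈ W ∧ (a, u.2) ∈ V ∧ R (p, u.1) (a, u.2) ∧ sg p a = ς) := by
    intro p a
    by_cases hl : L p a
    · obtain ⟨j, j', hh⟩ := hl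
      exact ⟨(j, j'), fun _ => hh⟩
    · exact ⟨(0, 0), fun hh => absurd hh hl⟩
  choose u hu using hex
  set x : α → α → ℤ := fun p a => (u p a).1 with hx
  set y : α → α → ℤ := fun p a => (u p a).2 with hy
  have hLW : ∀ p a, L p a → (p, x p a) ∈ W := fun p a hl => (hu p a hl).1
  have hLV : ∀ p a, L p a → (p, x p a) ∈ V := fun p a hl => hWV (hu p a hl).1
  have hLV' : ∀ p a, L p a → (a, y p a) ∈ V := fun p a hl => (hu p a hl).2.1
  have hLR : ∀ p a, L p a → R (p, x p a) (a, y p a) := fun p a hl => (hu p a hl).2.2.1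
  have hLs : ∀ p a, L p a → sg p a = ς := fun p a hl => (hu p a hl).2.2.2
  -- generic fibre counting
  have c1 : ∀ p ∈ P, ((P.filter (fun a => L p a)).card : ℝ) ≤ D2 * n' := by
    intro p hp
    have hsub : P.filter (fun a => L p a) ⊆
        (V.filter (fun v => v.1 = p)).biUnion (fun v => (V.filter (fun w => R v w)).image Prod.fst) := by
      intro a ha
      have hl := (Finset.mem_filter.1 ha).2
      refine Finset.mem_biUnion.2 ⟨(p, x p a), Finset.mem_filter.2 ⟨hLV p a hl, rfl⟩, ?_⟩
      exact Finset.mem_image.2 ⟨(a, y p a), Finset.mem_filter.2 ⟨hLV' p a hl, hLR p a hl⟩, rfl⟩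
    have h1 : ((P.filter (fun a => L p a)).card : ℝ) ≤
        ∑ v ∈ V.filter (fun v => v.1 = p), (((V.filter (fun w => R v w)).image Prod.fst).card : ℝ) := by
      exact_mod_cast (Finset.card_le_card hsub).trans Finset.card_biUnion_le
    refine h1.trans ?_
    calc _ ≤ ∑ v ∈ V.filter (fun v => v.1 = p), n' := by
          refine Finset.sum_le_sum fun v hv => le_trans ?_ (cn' v (Finset.mem_filter.1 hv).1)
          exact_mod_cast Finset.card_image_le
      _ = ((V.filter (fun v => v.1 = p)).card : ℝ) * n' := by rw [Finset.sum_const, nsmul_eq_mul]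
      _ ≤ _ := mul_le_mul_of_nonneg_right (cD p hp) hn'
  have c1' : ∀ a ∈ P, ((P.filter (fun p => L p a)).card : ℝ) ≤ D2 * n' := by
    intro a ha
    have hsub : P.filter (fun p => L p a) ⊆
        (V.filter (fun v => v.1 = a)).biUnion (fun v => (V.filter (fun w => R v w)).image Prod.fst) := by
      intro p hp
      have hl := (Finset.mem_filter.1 hp).2
      refine Finset.mem_biUnion.2 ⟨(a, y p a), Finset.mem_filter.2 ⟨hLV' p a hl, rfl⟩, ?_⟩
      exact Finset.mem_image.2 ⟨(p, x p a), Finset.mem_filter.2 ⟨hLV p a hl, Rs _ _ (hLR p a hl)⟩, rfl⟩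
    have h1 : ((P.filter (fun p => L p a)).card : ℝ) ≤
        ∑ v ∈ V.filter (fun v => v.1 = a), (((V.filter (fun w => R v w)).image Prod.fst).card : ℝ) := by
      exact_mod_cast (Finset.card_le_card hsub).trans Finset.card_biUnion_le
    refine h1.trans ?_
    calc _ ≤ ∑ v ∈ V.filter (fun v => v.1 = a), n' := by
          refine Finset.sum_le_sum fun v hv => le_trans ?_ (cn' v (Finset.mem_filter.1 hv).1)
          exact_mod_cast Finset.card_image_le
      _ = ((V.filter (fun v => v.1 = a)).card : ℝ) * n' := by rw [Finset.sum_const, nsmul_eq_mul]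
      _ ≤ _ := mul_le_mul_of_nonneg_right (cD a ha) hn'
  -- a general local count
  have cloc : ∀ (p : α) (j0 : ℤ) (M : ℝ) (A : Finset α), M ≤ M1 + M2 →
      (∀ a ∈ A, ∃ j j' : ℤ, (p, j) ∈ V ∧ (a, j') ∈ V ∧ R (p, j) (a, j') ∧ nd j0 j ≤ M) → (A.card : ℝ) ≤ K * n' := by
    intro p j0 M A hM hA
    have hsub : A ⊆ (((Finset.Ico 0 J).filter (fun i => nd j0 i ≤ M)).filter (fun i => (p, i) ∈ V)).biUnion
        (fun j => (V.filter (fun w => R (p, j) w)).image Prod.fst) := by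
      intro a ha
      obtain ⟨j, j', h1, h2, h3, h4⟩ := hA a ha
      refine Finset.mem_biUnion.2 ⟨j, ?_, Finset.mem_image.2 ⟨(a, j'), Finset.mem_filter.2 ⟨h2, h3⟩, rfl⟩⟩
      have := hV _ h1
      simp only [Finset.mem_filter, Finset.mem_Ico]
      exact ⟨⟨this, h4⟩, h1⟩
    have h1 : (A.card : ℝ) ≤
        ∑ j ∈ ((Finset.Ico 0 J).filter (fun i => nd j0 i ≤ M)).filter (fun i => (p, i) ∈ V),
          (((V.filter (fun w => R (p, j) w)).image Prod.fst).card : ℝ) := by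
      exact_mod_cast (Finset.card_le_card hsub).trans Finset.card_biUnion_le
    refine h1.trans ?_
    calc _ ≤ ∑ j ∈ ((Finset.Ico 0 J).filter (fun i => nd j0 i ≤ M)).filter (fun i => (p, i) ∈ V), n' := by
          refine Finset.sum_le_sum fun v hv => le_trans ?_ (cn' _ (Finset.mem_filter.1 hv).2)
          exact_mod_cast Finset.card_image_le
      _ = ((((Finset.Ico 0 J).filter (fun i => nd j0 i ≤ M)).filter (fun i => (p, i) ∈ V)).card : ℝ) * n' := by
          rw [Finset.sum_const, nsmul_eq_mul]
      _ ≤ _ := by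
          refine mul_le_mul_of_nonneg_right (le_trans ?_ (cgen M j0 hM)) hn'
          exact_mod_cast Finset.card_filter_le _ _
  have c2 : ∀ p ∈ P, ∀ a ∈ P, L p a →
      ((P.filter (fun b => L p b ∧ nd (x p a) (x p b) ≤ M1)).card : ℝ) ≤ K * n' := by
    intro p hp a ha hl
    refine cloc p (x p a) M1 _ (by linarith) ?_
    intro b hb
    obtain ⟨_, hlb, hnb⟩ := Finset.mem_filter.1 hb
    exact ⟨x p b, y p b, hLV p b hlb, hLV' p b hlb, hLR p b hlb, hnb⟩
  have c3 : ∀ p ∈ P, ∀ a ∈ P, L p a →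
      ((P.filter (fun p' => L p' a ∧ nd (x p a) (x p' a) ≤ M1)).card : ℝ) ≤ K * n' := by
    intro p hp a ha hl
    refine cloc a (x p a) (M1 + M2) _ le_rfl ?_
    intro p' hp'
    obtain ⟨_, hlb, hnb⟩ := Finset.mem_filter.1 hp'
    refine ⟨y p' a, x p' a, hLV' p' a hlb, hLV p' a hlb, Rs _ _ (hLR p' a hlb), ?_⟩
    have := F3 _ (hLV p' a hlb) _ (hLV' p' a hlb) (hLR p' a hlb)
    have := ndt (x p a) (x p' a) (y p' a)
    simp only at *
    linarith
  have c4' : ∀ p ∈ P, ((P.filter (fun p' => ∃ a ∈ P, L p a ∧ L p' a)).card : ℝ) ≤ Nt := by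
    intro p hp
    refine le_trans ?_ (c4 p hp)
    exact_mod_cast Finset.card_le_card (fun p' hp' => by
      obtain ⟨h1, a, ha, h2, h3⟩ := Finset.mem_filter.1 hp'
      exact Finset.mem_filter.2 ⟨h1, F4 _ (hLV p a h2) _ (hLV' p a h2) _ (hLV p' a h3) _ (hLV' p' a h3)
        (hLR p a h2) (hLR p' a h3) rfl⟩)
  have hς2 : ς * ς = 1 := by rcases hς with h | h <;> rw [h] <;> norm_num
  have core := core0 P L x (fun i j => nd i j ≤ M1) (fun p i => ς * h p i) B J m hJ
    (fun i => by simp only [nd0]; exact hM1) (fun i j hij => by rw [nds]; exact hij)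
    (fun p _ a _ hl => hV _ (hLV p a hl))
    (by
      intro p _ q _ i j k l hi hij hjk hkl hl
      rintro ⟨g1, g2, g3, g4⟩
      rcases hς with h' | h' <;> subst h'
      · exact halt p q i j k l hi hij hjk hkl hl ⟨by linarith, by linarith, by linarith, by linarith⟩
      · exact halt q p i j k l hi hij hjk hkl hl ⟨by linarith, by linarith, by linarith, by linarith⟩)
    (by
      intro p _ a _ hl
      have := F1 _ (hLV p a hl) _ (hLV' p a hl) (hLR p a hl)
      simp only [hLs p a hl] at this
      linarith)
    (by
      intro p _ a _ hl i hi hiJ hn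
      push Not at hn
      have := F2 _ (hLV p a hl) _ (hLV' p a hl) (hLR p a hl) i hi hiJ hn
      simp only [hLs p a hl] at this
      linarith)
    (D2 * n') (K * n') Nt (by positivity) (by positivity) hNt c1 c1' c2 c3 c4' _ rfl
  set Λ : ℝ := ∑ p ∈ P, ((P.filter (fun a => L p a)).card : ℝ) with hΛ
  -- lower bound for Λ
  have hlow : ((Tr ς).card : ℝ) ≤ K ^ 2 * Λ := by
    set LP : Finset (α × α) := (P ×ˢ P).filter (fun u => L u.1 u.2) with hLP
    have hΛ' : Λ = (LP.card : ℝ) := by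
      rw [hLP, ← Finset.sum_boole, Finset.sum_product, hΛ]
      refine Finset.sum_congr rfl fun p _ => ?_
      rw [Finset.sum_boole]
    have hfib : ∀ c ∈ LP, ((((Tr ς).filter (fun u => (u.1.1, u.2.1) = c)).card : ℕ) : ℝ) ≤ K ^ 2 := by
      intro c hc
      obtain ⟨p, a⟩ := c
      have hl : L p a := (Finset.mem_filter.1 hc).2
      set S1 := (Finset.Ico 0 J).filter (fun i => nd (x p a) i ≤ M1) with hS1
      have hsub : (Tr ς).filter (fun u => (u.1.1, u.2.1) = (p, a)) ⊆
          S1.biUnion (fun j => ((Finset.Ico 0 J).filter (fun i => nd j i ≤ M2)).image (fun j' => ((p, j), (a, j')))) := by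
        rintro ⟨⟨p1, j⟩, ⟨a1, j'⟩⟩ hu
        simp only [hTr, Finset.mem_filter, Finset.mem_product, Prod.mk.injEq] at hu
        obtain ⟨⟨⟨hw, hv⟩, hR, hs⟩, rfl, rfl⟩ := hu
        have hw' := hV _ (hWV hw)
        have hv' := hV _ hv
        refine Finset.mem_biUnion.2 ⟨j, ?_, Finset.mem_image.2 ⟨j', ?_, rfl⟩⟩
        · simp only [hS1, Finset.mem_filter, Finset.mem_Ico]
          refine ⟨hw', ?_⟩
          by_contra hcon
          push Not at hcon
          have f2 := F2 _ (hLV p1 a1 hl) _ (hLV' p1 a1 hl) (hLR p1 a1 hl) j hw'.1 hw'.2 hcon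
          have f1 := F1 _ (hWV hw) _ hv hR
          simp only at f1 f2
          linarith
        · simp only [Finset.mem_filter, Finset.mem_Ico]
          exact ⟨hv', F3 _ (hWV hw) _ hv hR⟩
      have h1 : ((((Tr ς).filter (fun u => (u.1.1, u.2.1) = (p, a))).card : ℕ) : ℝ) ≤
          ∑ j ∈ S1, ((((Finset.Ico 0 J).filter (fun i => nd j i ≤ M2)).image (fun j' => ((p, j), (a, j')))).card : ℝ) := by
        exact_mod_cast (Finset.card_le_card hsub).trans Finset.card_biUnion_le
      refine h1.trans ?_
      calc _ ≤ ∑ j ∈ S1, K := by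
            refine Finset.sum_le_sum fun j _ => le_trans ?_ (cgen M2 j (by linarith))
            exact_mod_cast Finset.card_image_le
        _ = (S1.card : ℝ) * K := by rw [Finset.sum_const, nsmul_eq_mul]
        _ ≤ K * K := mul_le_mul_of_nonneg_right (cgen M1 _ (by linarith)) hK
        _ = _ := by ring
    have hmap : ∀ u ∈ Tr ς, (u.1.1, u.2.1) ∈ LP := by
      rintro ⟨⟨p, j⟩, ⟨a, j'⟩⟩ hu
      simp only [hTr, Finset.mem_filter, Finset.mem_product] at hu
      refine Finset.mem_filter.2 ⟨Finset.mem_product.2 ⟨hPm _ (hWV hu.1.1), hPm _ hu.1.2⟩, j, j', hu.1.1, hu.1.2, hu.2.1, hu.2.2⟩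
    have h2 := Finset.card_eq_sum_card_fiberwise (s := Tr ς) (t := LP) (f := fun u : (α × ℤ) × (α × ℤ) => (u.1.1, u.2.1)) (fun u hu => hmap u hu)
    rw [hΛ', h2]
    push_cast
    calc _ ≤ ∑ c ∈ LP, K ^ 2 := Finset.sum_le_sum hfib
      _ = _ := by rw [Finset.sum_const, nsmul_eq_mul]; ring
  have hfin : W.card * n ≤ 2 * K ^ 2 * Λ := by linarith
  rcases core with hc | hc
  · left
    calc W.card * n ≤ 2 * K ^ 2 * Λ := hfin
      _ ≤ 2 * K ^ 2 * (2 * P.card * (K * n')) := by gcongr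
      _ = _ := by ring
  · right
    calc (W.card * n) ^ 3 ≤ (2 * K ^ 2 * Λ) ^ 3 := by gcongr
      _ = 8 * K ^ 6 * Λ ^ 3 := by ring
      _ ≤ 8 * K ^ 6 * (384 * m ^ 2 * P.card ^ 3 * Nt * (D2 * n') * (K * n')) := by gcongr
      _ = _ := by ring


theorem mk2_zero (a b : ℝ) : (mk2 a b) 0 = a := rfl
theorem mk2_one (a b : ℝ) : (mk2 a b) 1 = b := rfl

theorem plane_norm_sq (x : Plane) : ‖x‖ ^ 2 = x 0 ^ 2 + x 1 ^ 2 := by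
  rw [EuclideanSpace.norm_sq_eq, Fin.sum_univ_two, Real.norm_eq_abs, Real.norm_eq_abs, sq_abs, sq_abs]

theorem norm_dir (θ : ℝ) : ‖dir θ‖ = 1 := by
  have h : ‖dir θ‖ ^ 2 = 1 := by
    rw [plane_norm_sq]; simp only [dir, mk2_zero, mk2_one]; exact Real.cos_sq_add_sin_sq θ
  have h0 := norm_nonneg (dir θ)
  nlinarith

theorem inner_dir (x : Plane) (θ : ℝ) : inner ℝ x (dir θ) = x 0 * Real.cos θ + x 1 * Real.sin θ := by
  rw [PiLp.inner_apply, Fin.sum_univ_two]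
  simp only [dir, mk2_zero, mk2_one, RCLike.inner_apply, conj_trivial]
  ring

theorem dist_dir (a b : ℝ) : dist (dir a) (dir b) = 2 * |Real.sin ((a - b) / 2)| := by
  have h : dist (dir a) (dir b) ^ 2 = (2 * |Real.sin ((a - b) / 2)|) ^ 2 := by
    rw [dist_eq_norm, plane_norm_sq, mul_pow, sq_abs]
    have e : Real.sin ((a - b) / 2) ^ 2 = (1 - Real.cos (a - b)) / 2 := by
      rw [Real.sin_sq, Real.cos_sq, show 2 * ((a - b) / 2) = a - b by ring]; ring
    rw [e, Real.cos_sub]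
    simp only [PiLp.sub_apply, dir, mk2_zero, mk2_one]
    nlinarith [Real.cos_sq_add_sin_sq a, Real.cos_sq_add_sin_sq b]
  exact (pow_left_inj₀ dist_nonneg (by positivity) two_ne_zero).1 h

theorem annulus_abs (δ : ℝ) (p : Param) (hp : 0 ≤ p.2) (z : Plane) (hz : z ∈ annulus δ p) :
    |dist z p.1 - p.2| ≤ δ := by
  refine le_trans ?_ hz
  have hne : (circ p).Nonempty := by
    refine ⟨p.1 + p.2 • dir 0, ?_⟩
    simp [circ, norm_smul, norm_dir, abs_of_nonneg hp]
  rw [Metric.le_infDist hne]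
  intro w hw
  have hw' : dist w p.1 = p.2 := hw
  rw [← hw', ← Real.dist_eq]
  exact dist_dist_dist_le_left z w p.1

theorem cubeCtr_mem (δ : ℝ) (hδ : 0 < δ) (k : CubeIdx) : cubeCtr δ k ∈ cubeSet δ k := by
  simp only [cubeSet, cubeCtr, Set.mem_ofPred_eq, mk2_zero, mk2_one]
  refine ⟨?_, ?_, ?_, ?_, ?_, ?_⟩ <;> nlinarith

theorem dyadicCeil_spec (x : ℝ) (hx : 0 < x) (hx1 : x ≤ 1) :
    x ≤ dyadicCeil x ∧ dyadicCeil x ≤ 2 * x ∧ ∃ m : ℕ, dyadicCeil x = ((2:ℝ) ^ m)⁻¹ := by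
  set f := ⌊Real.logb 2 x⁻¹⌋ with hf
  have hx' : 0 < x⁻¹ := by positivity
  have hf0 : 0 ≤ f := by
    rw [hf, Int.floor_nonneg]
    exact Real.logb_nonneg (by norm_num) (one_le_inv_iff₀.2 ⟨hx, hx1⟩)
  have h1 : (2:ℝ) ^ f ≤ x⁻¹ := by
    have := Int.floor_le (Real.logb 2 x⁻¹)
    rw [← hf, Real.le_logb_iff_rpow_le (by norm_num) hx', Real.rpow_intCast] at this
    exact this
  have h2 : x⁻¹ < (2:ℝ) ^ (f + 1) := by
    have := Int.lt_floor_add_one (Real.logb 2 x⁻¹)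
    rw [← hf, Real.logb_lt_iff_lt_rpow (by norm_num) hx'] at this
    rw [← Real.rpow_intCast]; push_cast; exact this
  have hD : dyadicCeil x = ((2:ℝ) ^ f)⁻¹ := by rw [dyadicCeil, ← hf, zpow_neg]
  have hp : (0:ℝ) < 2 ^ f := by positivity
  refine ⟨?_, ?_, f.toNat, ?_⟩
  · rw [hD]; exact (le_inv_comm₀ hx hp).2 h1
  · rw [hD]
    rw [zpow_add₀ (by norm_num), zpow_one] at h2
    rw [inv_le_comm₀ hp (by positivity)]
    rw [mul_inv]
    linarith
  · rw [hD, ← zpow_natCast, Int.toNat_of_nonneg hf0]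

/-- the midpoint angles -/
noncomputable def ang (σ : ℝ) (j : ℤ) : ℝ := ((j : ℝ) + 1 / 2) * (2 * Real.pi * σ)

theorem sin_pi_ge (y : ℝ) (h0 : 0 ≤ y) (h1 : y ≤ 1) : 2 * y ≤ Real.sin (Real.pi * y) ∨
    2 * (1 - y) ≤ Real.sin (Real.pi * y) := by
  have hpi := Real.pi_pos
  rcases le_total y (1/2) with h | h
  · left
    have := Real.mul_le_sin (x := Real.pi * y) (by positivity) (by nlinarith)
    calc 2 * y = 2 / Real.pi * (Real.pi * y) := by field_simp
      _ ≤ _ := this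
  · right
    have := Real.mul_le_sin (x := Real.pi * (1 - y)) (by nlinarith) (by nlinarith)
    rw [← Real.sin_pi_sub, show Real.pi - Real.pi * y = Real.pi * (1 - y) by ring]
    calc 2 * (1 - y) = 2 / Real.pi * (Real.pi * (1 - y)) := by field_simp
      _ ≤ _ := this

theorem near_cases (σ M : ℝ) (hσ0 : 0 < σ) (i j : ℤ)
    (hi : validArc σ i) (hj : validArc σ j) (hd : dist (dir (ang σ j)) (dir (ang σ i)) ≤ M * σ) :
    |(i:ℝ) - j| ≤ M / 4 ∨ |(i:ℝ) - (j + σ⁻¹)| ≤ M / 4 ∨ |(i:ℝ) - (j - σ⁻¹)| ≤ M / 4 := by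
  have hp : (0:ℝ) < σ⁻¹ := by positivity
  have hσm : σ * σ⁻¹ = 1 := mul_inv_cancel₀ hσ0.ne'
  have hi1 : (0:ℝ) ≤ i := by exact_mod_cast hi.1
  have hi2 : (i:ℝ) < σ⁻¹ := by exact_mod_cast hi.2
  have hj1 : (0:ℝ) ≤ j := by exact_mod_cast hj.1
  have hj2 : (j:ℝ) < σ⁻¹ := by exact_mod_cast hj.2
  rw [dist_dir] at hd
  have e : (ang σ j - ang σ i) / 2 = Real.pi * (((j:ℝ) - i) * σ) := by unfold ang; ring
  rw [e] at hd
  set y := |(j:ℝ) - i| * σ with hy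
  have hy0 : 0 ≤ y := by positivity
  have hy1 : y ≤ 1 := by
    have : |(j:ℝ) - i| ≤ σ⁻¹ := by rw [abs_le]; constructor <;> linarith
    rw [hy, ← hσm, mul_comm]; gcongr
  have hs : |Real.sin (Real.pi * (((j:ℝ) - i) * σ))| = |Real.sin (Real.pi * y)| := by
    rw [hy]
    rcases abs_cases ((j:ℝ) - i) with h | h
    · rw [h.1]
    · rw [h.1, show Real.pi * (-((j:ℝ) - i) * σ) = -(Real.pi * (((j:ℝ) - i) * σ)) by ring, Real.sin_neg, abs_neg]
  rw [hs] at hd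
  have hle := le_abs_self (Real.sin (Real.pi * y))
  rcases sin_pi_ge y hy0 hy1 with h | h
  · left
    have h1 : 4 * |(j:ℝ) - i| * σ ≤ M * σ := by rw [hy] at h hle; linarith
    have := le_of_mul_le_mul_right h1 hσ0
    rw [abs_sub_comm]; linarith
  · right
    have h1 : (4 * (σ⁻¹ - |(j:ℝ) - i|)) * σ ≤ M * σ := by
      have : (4 * (σ⁻¹ - |(j:ℝ) - i|)) * σ = 4 * (1 - y) := by rw [hy, ← hσm]; ring
      rw [this]; linarith
    have h2 := le_of_mul_le_mul_right h1 hσ0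
    rcases abs_cases ((j:ℝ) - i) with h' | h'
    · right
      rw [h'.1] at h2
      rw [abs_le]; constructor <;> linarith
    · left
      rw [h'.1] at h2
      rw [abs_le]; constructor <;> linarith

theorem icc_count (c M : ℝ) (hM : 0 ≤ M) : ((Finset.Icc ⌈c - M / 4⌉ ⌊c + M / 4⌋).card : ℝ) ≤ M / 2 + 1 := by
  rw [Int.card_Icc]
  have h1 := Int.le_ceil (c - M / 4)
  have h2 := Int.floor_le (c + M / 4)
  have h3 : ((⌊c + M / 4⌋ + 1 - ⌈c - M / 4⌉ : ℤ) : ℝ) ≤ M / 2 + 1 := by push_cast; linarith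
  rcases le_total 0 (⌊c + M / 4⌋ + 1 - ⌈c - M / 4⌉) with h | h
  · have : (((⌊c + M / 4⌋ + 1 - ⌈c - M / 4⌉).toNat : ℤ) : ℝ) = ((⌊c + M / 4⌋ + 1 - ⌈c - M / 4⌉ : ℤ) : ℝ) := by
      rw [Int.toNat_of_nonneg h]
    rw [Int.cast_natCast] at this
    rw [this]; exact h3
  · rw [Int.toNat_eq_zero.2 h]; push_cast; linarith

open Classical in
theorem near_count' (σ M : ℝ) (hσ0 : 0 < σ) (hM : 0 ≤ M) (j : ℤ) (hj : validArc σ j) (A : Finset ℤ)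
    (hA : ∀ i ∈ A, validArc σ i ∧ dist (dir (ang σ j)) (dir (ang σ i)) ≤ M * σ) :
    (A.card : ℝ) ≤ 2 * M + 3 := by
  have hsub : A ⊆
      (Finset.Icc ⌈(j:ℝ) - M / 4⌉ ⌊(j:ℝ) + M / 4⌋ ∪ Finset.Icc ⌈((j:ℝ) + σ⁻¹) - M / 4⌉ ⌊((j:ℝ) + σ⁻¹) + M / 4⌋) ∪
      Finset.Icc ⌈((j:ℝ) - σ⁻¹) - M / 4⌉ ⌊((j:ℝ) - σ⁻¹) + M / 4⌋ := by
    intro i hi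
    obtain ⟨hi, hd⟩ := hA i hi
    have := near_cases σ M hσ0 i j hi hj hd
    simp only [Finset.mem_union, Finset.mem_Icc, Int.ceil_le, Int.le_floor]
    rcases this with h | h | h <;> have h' := abs_le.1 h
    · left; left; constructor <;> linarith
    · left; right; constructor <;> linarith
    · right; constructor <;> linarith
  have h1 := (Finset.card_le_card hsub).trans ((Finset.card_union_le _ _).trans
        (Nat.add_le_add_right (Finset.card_union_le _ _) _))
  have h2 := icc_count (j:ℝ) M hM
  have h3 := icc_count ((j:ℝ) + σ⁻¹) M hM
  have h4 := icc_count ((j:ℝ) - σ⁻¹) M hM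
  have h5 := (Nat.cast_le (α := ℝ)).2 h1
  push_cast at h5
  linarith

theorem valid_iff (m : ℕ) (σ : ℝ) (hσ : σ = ((2:ℝ) ^ m)⁻¹) (j : ℤ) : validArc σ j ↔ 0 ≤ j ∧ j < 2 ^ m := by
  unfold validArc
  rw [hσ, inv_inv]
  have : ((j:ℝ) < 2 ^ m) ↔ j < 2 ^ m := by exact_mod_cast Iff.rfl
  rw [this]

open Classical in
theorem near_count (m : ℕ) (σ M : ℝ) (hσ : σ = ((2:ℝ) ^ m)⁻¹) (hM : 0 ≤ M) (j : ℤ) (hj : 0 ≤ j ∧ j < 2 ^ m) :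
    (((Finset.Ico (0:ℤ) (2 ^ m)).filter (fun i => dist (dir (ang σ j)) (dir (ang σ i)) ≤ M * σ)).card : ℝ)
      ≤ 2 * M + 3 := by
  refine near_count' σ M (by rw [hσ]; positivity) hM j ((valid_iff m σ hσ j).2 hj) _ ?_
  intro i hi
  obtain ⟨hi, hd⟩ := Finset.mem_filter.1 hi
  exact ⟨(valid_iff m σ hσ i).2 (Finset.mem_Ico.1 hi), hd⟩

/-- the relation counted by the multiplicity function -/
def RR (ρ lam t σ : ℝ) (v w : DPair) : Prop :=
  tang (cubeCtr lam v.1) (cubeCtr lam w.1) ≤ ρ * lam ∧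
  t / ρ ≤ pdist (cubeCtr lam v.1) (cubeCtr lam w.1) ∧
  pdist (cubeCtr lam v.1) (cubeCtr lam w.1) ≤ ρ * t ∧
  (rect (ρ * lam) (ρ * σ) (cubeCtr lam v.1) (arcCenterAt (cubeCtr lam v.1) σ v.2) ∩
    rect (ρ * lam) (ρ * σ) (cubeCtr lam w.1) (arcCenterAt (cubeCtr lam w.1) σ w.2)).Nonempty

theorem pdist_comm (p q : Param) : pdist p q = pdist q p := by
  unfold pdist; rw [dist_comm]; congr 2; ring

theorem tang_comm (p q : Param) : tang p q = tang q p := by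
  unfold tang; rw [dist_comm, abs_sub_comm p.2]

theorem RR_symm (ρ lam t σ : ℝ) (v w : DPair) (h : RR ρ lam t σ v w) : RR ρ lam t σ w v := by
  obtain ⟨h1, h2, h3, h4⟩ := h
  refine ⟨by rwa [tang_comm], by rwa [pdist_comm], by rwa [pdist_comm], by rwa [inter_comm]⟩

theorem dist_le_pdist (p q : Param) : dist p.1 q.1 ≤ pdist p q :=
  Real.le_sqrt_of_sq_le (by nlinarith [sq_nonneg (p.2 - q.2)])

theorem abs_le_pdist (p q : Param) : |p.2 - q.2| ≤ pdist p q :=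
  Real.le_sqrt_of_sq_le (by rw [sq_abs]; nlinarith [sq_nonneg (dist p.1 q.1)])

theorem pdist_le (p q : Param) : pdist p q ≤ dist p.1 q.1 + |p.2 - q.2| := by
  unfold pdist
  rw [Real.sqrt_le_left (by positivity), ← sq_abs (p.2 - q.2)]
  nlinarith [abs_nonneg (p.2 - q.2), dist_nonneg (x := p.1) (y := q.1)]

theorem pdist_tri (p q r : Param) (a b : ℝ) (h1 : pdist p q ≤ a) (h2 : pdist q r ≤ b) : pdist p r ≤ 2 * (a + b) := by
  have := pdist_le p r
  have := dist_triangle p.1 q.1 r.1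
  have := abs_sub_le p.2 q.2 r.2
  have := dist_le_pdist p q
  have := dist_le_pdist q r
  have := abs_le_pdist p q
  have := abs_le_pdist q r
  linarith

/-- the height function -/
noncomputable def hh (lam σ : ℝ) (k : CubeIdx) (i : ℤ) : ℝ :=
  inner ℝ (cubeCtr lam k).1 (dir (ang σ i)) + (cubeCtr lam k).2

theorem hh_alt (lam σ : ℝ) (m : ℕ) (hσ : σ = ((2:ℝ) ^ m)⁻¹) (p q : CubeIdx) (i j k l : ℤ) (hi : 0 ≤ i)
    (hij : i < j) (hjk : j < k) (hkl : k < l) (hl : l < 2 ^ m) :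
    ¬ (hh lam σ q i < hh lam σ p i ∧ hh lam σ p j < hh lam σ q j ∧ hh lam σ q k < hh lam σ p k ∧
      hh lam σ p l < hh lam σ q l) := by
  rintro ⟨h1, h2, h3, h4⟩
  have hp : (0:ℝ) < 2 ^ m := by positivity
  have hσ0 : 0 < σ := by rw [hσ]; positivity
  have hσm : σ * 2 ^ m = 1 := by rw [hσ]; exact inv_mul_cancel₀ hp.ne'
  have hpi := Real.pi_pos
  have mono : ∀ a b : ℤ, a < b → ang σ a < ang σ b := by
    intro a b hab
    unfold ang
    have : (a:ℝ) < b := by exact_mod_cast hab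
    apply mul_lt_mul_of_pos_right _ (by positivity); linarith
  have hli : ang σ l < ang σ i + 2 * Real.pi := by
    unfold ang
    have h0 : (0:ℝ) ≤ i := by exact_mod_cast hi
    have hl' : (l:ℝ) < 2 ^ m := by exact_mod_cast hl
    have : ((l:ℝ) - i) * (2 * Real.pi * σ) < 2 ^ m * (2 * Real.pi * σ) := by
      apply mul_lt_mul_of_pos_right _ (by positivity); linarith
    nlinarith
  set A := (cubeCtr lam p).2 - (cubeCtr lam q).2
  set B := (cubeCtr lam p).1 0 - (cubeCtr lam q).1 0
  set C := (cubeCtr lam p).1 1 - (cubeCtr lam q).1 1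
  have key : ∀ i, hh lam σ p i - hh lam σ q i = A + B * Real.cos (ang σ i) + C * Real.sin (ang σ i) := by
    intro i
    unfold hh
    rw [inner_dir, inner_dir]; ring
  refine alt4 A B C (ang σ i) (ang σ j) (ang σ k) (ang σ l) (mono _ _ hij) (mono _ _ hjk) (mono _ _ hkl) hli ?_
  simp only [← key]
  refine ⟨?_, ?_, ?_, ?_⟩ <;> linarith

theorem geoC (lam t σ ρ : ℝ) (hρ : 1 ≤ ρ) (hlam : 0 < lam) (ht : 0 < t) (ht1 : t ≤ 1)
    (hσ0 : 0 < σ) (hσ1 : lam ≤ t * σ ^ 2) (hσ2 : t * σ ^ 2 ≤ 4 * lam) (hls : lam ≤ σ)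
    (hsm : 1000 * ρ ^ 2 * lam ≤ t) (v w : DPair) (hv : cubeSet lam v.1 ⊆ domD) (hw : cubeSet lam w.1 ⊆ domD)
    (hR : RR ρ lam t σ v w) (ς : ℝ) (hς : ς = if (cubeCtr lam v.1).2 < (cubeCtr lam w.1).2 then 1 else -1) :
    ς * (hh lam σ w.1 v.2 - hh lam σ v.1 v.2) ≤ 393 * ρ ^ 3 * lam ∧
    (∀ i : ℤ, 100 * ρ ^ 2 * σ < dist (dir (ang σ v.2)) (dir (ang σ i)) →
      393 * ρ ^ 3 * lam < ς * (hh lam σ w.1 i - hh lam σ v.1 i)) ∧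
    dist (dir (ang σ v.2)) (dir (ang σ w.2)) ≤ 28 * ρ * σ := by
  obtain ⟨h1, h2, h3, z, ⟨hz1, hz1'⟩, hz2, hz2'⟩ := hR
  have cv := hv (cubeCtr_mem lam hlam v.1)
  have cw := hw (cubeCtr_mem lam hlam w.1)
  have := geoB (cubeCtr lam v.1).1 (cubeCtr lam w.1).1 z (dir (ang σ v.2)) (dir (ang σ w.2))
    (cubeCtr lam v.1).2 (cubeCtr lam w.1).2 ρ lam t σ ς hρ hlam ht ht1 hσ0 hσ1 hσ2 hls hsm hς
    cv.1 cw.1 cv.2.1 cv.2.2 cw.2.1 cw.2.2 h1 h2 h3 (norm_dir _) (norm_dir _)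
    (annulus_abs _ _ (by linarith [cv.2.1]) z hz1) (annulus_abs _ _ (by linarith [cw.2.1]) z hz2) hz1' hz2'
  exact ⟨this.1, fun i hi => this.2.1 _ (norm_dir _) hi, this.2.2⟩

open Classical in
theorem core2 (lam t σ ρ : ℝ) (hρ : 1 ≤ ρ) (hlam : 0 < lam) (ht : 0 < t) (ht1 : t ≤ 1)
    (m : ℕ) (hσ : σ = ((2:ℝ) ^ m)⁻¹) (hσ1 : lam ≤ t * σ ^ 2) (hσ2 : t * σ ^ 2 ≤ 4 * lam) (hls : lam ≤ σ)
    (hsm : 1000 * ρ ^ 2 * lam ≤ t) (V W : Finset DPair) (hWV : W ⊆ V)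
    (hV1 : ∀ v ∈ V, cubeSet lam v.1 ⊆ domD) (hV2 : ∀ v ∈ V, 0 ≤ v.2 ∧ v.2 < 2 ^ m)
    (D2 n n' Nt : ℝ) (hD2 : 0 ≤ D2) (hn : 0 ≤ n) (hn' : 0 ≤ n') (hNt : 0 ≤ Nt)
    (c4 : ∀ p ∈ V.image Prod.fst, (((V.image Prod.fst).filter
      (fun p' => pdist (cubeCtr lam p) (cubeCtr lam p') ≤ 4 * (ρ * t))).card : ℝ) ≤ Nt)
    (cD : ∀ p ∈ V.image Prod.fst, ((V.filter (fun v => v.1 = p)).card : ℝ) ≤ D2)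
    (cn' : ∀ v ∈ V, ((V.filter (fun w => RR ρ lam t σ v w)).card : ℝ) ≤ n')
    (cn : ∀ v ∈ W, n ≤ ((V.filter (fun w => RR ρ lam t σ v w)).card : ℝ)) :
    W.card * n ≤ 4 * (259 * ρ ^ 2) ^ 3 * (V.image Prod.fst).card * n' ∨
    (W.card * n) ^ 3 ≤ 3072 * (259 * ρ ^ 2) ^ 7 * m ^ 2 * (V.image Prod.fst).card ^ 3 * Nt * D2 * n' ^ 2 := by
  have hσ0 : 0 < σ := by rw [hσ]; positivity
  have hρ2 : ρ ≤ ρ ^ 2 := le_self_pow₀ hρ (by norm_num)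
  have hρ1 : 1 ≤ ρ ^ 2 := one_le_pow₀ hρ
  refine core1 V W hWV (RR ρ lam t σ)
    (fun i j => if (0 ≤ i ∧ i < 2 ^ m) ∧ (0 ≤ j ∧ j < 2 ^ m) then dist (dir (ang σ i)) (dir (ang σ j)) else
      if i = j then 0 else 1000 * ρ ^ 2 * (1 + σ))
    (hh lam σ) (fun p a => if (cubeCtr lam p).2 < (cubeCtr lam a).2 then 1 else -1)
    (fun p p' => pdist (cubeCtr lam p) (cubeCtr lam p') ≤ 4 * (ρ * t)) (393 * ρ ^ 3 * lam)
    (100 * ρ ^ 2 * σ) (28 * ρ * σ) (259 * ρ ^ 2) D2 n n' Nt (2 ^ m) m le_rfl (by positivity) (by positivity)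
    hD2 hn hn' hNt (by positivity) ?_ ?_ ?_ ?_ hV2
    (fun p q i j k l => hh_alt lam σ m hσ p q i j k l) ?_ (RR_symm ρ lam t σ) ?_ ?_ ?_ ?_ c4 cD cn' cn
  · intro i; simp
  · intro i j
    by_cases h1 : (0 ≤ i ∧ i < 2 ^ m) <;> by_cases h2 : (0 ≤ j ∧ j < 2 ^ m) <;> simp [h1, h2, dist_comm, eq_comm]
  · intro i j k
    have hX : 0 ≤ 1000 * ρ ^ 2 * (1 + σ) := by positivity
    have hb : ∀ a b, dist (dir a) (dir b) ≤ 2 := fun a b => by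
      rw [dist_dir]; have := Real.abs_sin_le_one ((a - b) / 2); linarith
    have hX2 : 2 ≤ 1000 * ρ ^ 2 * (1 + σ) := by nlinarith
    have hb' := hb (ang σ i) (ang σ k)
    have t1 := dist_triangle (dir (ang σ i)) (dir (ang σ j)) (dir (ang σ k))
    have d1 := dist_nonneg (x := dir (ang σ i)) (y := dir (ang σ j))
    have d2 := dist_nonneg (x := dir (ang σ j)) (y := dir (ang σ k))
    by_cases h1 : (0 ≤ i ∧ i < 2 ^ m) <;> by_cases h2 : (0 ≤ j ∧ j < 2 ^ m) <;> by_cases h3 : (0 ≤ k ∧ k < 2 ^ m) <;>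
      simp only [h1, h2, h3, and_true, and_false, if_true, if_false] <;> (try split_ifs) <;> first | linarith | (subst_vars; tauto)
  · intro j
    by_cases hj : 0 ≤ j ∧ j < 2 ^ m
    · refine le_trans ?_ (le_trans (near_count m σ (128 * ρ ^ 2) hσ (by positivity) j hj) (by linarith))
      exact_mod_cast Finset.card_le_card (fun i hi => by
        obtain ⟨h1, h2⟩ := Finset.mem_filter.1 hi
        refine Finset.mem_filter.2 ⟨h1, ?_⟩
        rw [if_pos ⟨hj, Finset.mem_Ico.1 h1⟩] at h2
        have : 28 * ρ * σ ≤ 28 * ρ ^ 2 * σ := by gcongr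
        linarith)
    · have : (Finset.Ico (0:ℤ) (2 ^ m)).filter (fun i => (if (0 ≤ j ∧ j < 2 ^ m) ∧ (0 ≤ i ∧ i < 2 ^ m) then dist (dir (ang σ j)) (dir (ang σ i)) else
          if j = i then 0 else 1000 * ρ ^ 2 * (1 + σ)) ≤ 100 * ρ ^ 2 * σ + 28 * ρ * σ) = ∅ := by
        rw [Finset.eq_empty_iff_forall_notMem]
        intro i hi
        obtain ⟨h1, h2⟩ := Finset.mem_filter.1 hi
        have h1' := Finset.mem_Ico.1 h1
        rw [if_neg (fun h => hj h.1), if_neg (fun h : j = i => hj (h ▸ h1'))] at h2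
        have : 28 * ρ * σ ≤ 28 * ρ ^ 2 * σ := by gcongr
        have : 0 < ρ ^ 2 * σ := by positivity
        linarith
      rw [this]; simp; positivity
  · intro p a; split_ifs <;> simp
  · intro v hv w hw hR
    exact (geoC lam t σ ρ hρ hlam ht ht1 hσ0 hσ1 hσ2 hls hsm v w (hV1 v hv) (hV1 w hw) hR _ rfl).1
  · intro v hv w hw hR i hi hiJ hd
    rw [if_pos ⟨hV2 v hv, hi, hiJ⟩] at hd
    exact (geoC lam t σ ρ hρ hlam ht ht1 hσ0 hσ1 hσ2 hls hsm v w (hV1 v hv) (hV1 w hw) hR _ rfl).2.1 i hd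
  · intro v hv w hw hR
    rw [if_pos ⟨hV2 v hv, hV2 w hw⟩]
    exact (geoC lam t σ ρ hρ hlam ht ht1 hσ0 hσ1 hσ2 hls hsm v w (hV1 v hv) (hV1 w hw) hR _ rfl).2.2
  · intro v hv w hw v' hv' w' hw' h1 h2 h3
    have a1 := h1.2.2.1
    have a2 := (RR_symm _ _ _ _ _ _ h2).2.2.1
    rw [← h3] at a2
    have := pdist_tri _ _ _ _ _ a1 a2
    linarith

open Classical in
/-- trivial bounds for the multiplicity -/
theorem triv_mult (lam t σ ρ : ℝ) (hρ : 1 ≤ ρ) (ht : 0 < t) (V : Finset DPair)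
    (S : DPair → Finset ℤ) (Ks : ℝ) (hS : ∀ v ∈ V, ((S v).card : ℝ) ≤ Ks) (Nt : ℝ)
    (hS' : ∀ v ∈ V, ∀ w ∈ V, RR ρ lam t σ v w → w.2 ∈ S v)
    (c4 : ∀ p ∈ V.image Prod.fst, (((V.image Prod.fst).filter
      (fun p' => pdist (cubeCtr lam p) (cubeCtr lam p') ≤ 4 * (ρ * t))).card : ℝ) ≤ Nt) :
    ∀ v ∈ V, ((V.filter (fun w => RR ρ lam t σ v w)).card : ℝ) ≤ Nt * Ks := by
  intro v hv
  have hsub : V.filter (fun w => RR ρ lam t σ v w) ⊆ ((V.image Prod.fst).filter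
      (fun p' => pdist (cubeCtr lam v.1) (cubeCtr lam p') ≤ 4 * (ρ * t))) ×ˢ S v := by
    intro w hw
    obtain ⟨hwV, hR⟩ := Finset.mem_filter.1 hw
    refine Finset.mem_product.2 ⟨Finset.mem_filter.2 ⟨Finset.mem_image_of_mem _ hwV, ?_⟩, hS' v hv w hwV hR⟩
    have := hR.2.2.1
    have : 0 < ρ * t := by positivity
    linarith
  have h1 := Finset.card_le_card hsub
  rw [Finset.card_product] at h1
  have h2 := (Nat.cast_le (α := ℝ)).2 h1
  push_cast at h2
  have h3 := c4 v.1 (Finset.mem_image_of_mem _ hv)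
  refine h2.trans (mul_le_mul h3 (hS v hv) (by positivity) (le_trans (by positivity) h3))


theorem floor_div_iff (δ a : ℝ) (hδ : 0 < δ) (k : ℤ) : ⌊a / δ⌋ = k ↔ (k:ℝ) * δ ≤ a ∧ a < ((k:ℝ) + 1) * δ := by
  rw [Int.floor_eq_iff, le_div_iff₀ hδ, div_lt_iff₀ hδ]

theorem mem_cube_iff (δ : ℝ) (hδ : 0 < δ) (k : CubeIdx) (x : Param) : x ∈ cubeSet δ k ↔ idx3 δ x = k := by
  obtain ⟨⟨a, b⟩, c⟩ := k
  simp only [cubeSet, idx3, idx2, Set.mem_ofPred_eq, Prod.mk.injEq, floor_div_iff δ _ hδ]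
  tauto

theorem idx3_ctr (δ : ℝ) (hδ : 0 < δ) (k : CubeIdx) : idx3 δ (cubeCtr δ k) = k :=
  (mem_cube_iff δ hδ k _).1 (cubeCtr_mem δ hδ k)

theorem idx3_union (δ : ℝ) (hδ : 0 < δ) (A : Set CubeIdx) : idx3 δ '' (⋃ k ∈ A, cubeSet δ k) = A := by
  ext k
  simp only [mem_image, mem_iUnion, exists_prop]
  constructor
  · rintro ⟨x, ⟨l, hl, hx⟩, rfl⟩
    rw [(mem_cube_iff δ hδ l x).1 hx]; exact hl
  · intro hk
    exact ⟨cubeCtr δ k, ⟨k, hk, cubeCtr_mem δ hδ k⟩, idx3_ctr δ hδ k⟩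

theorem abs_coord (x : Plane) : |x 0| ≤ ‖x‖ ∧ |x 1| ≤ ‖x‖ := by
  have h := plane_norm_sq x
  constructor <;> refine abs_le_of_sq_le_sq ?_ (norm_nonneg x) <;> nlinarith [sq_nonneg (x 0), sq_nonneg (x 1)]

theorem norm_le_coord (x : Plane) (a b : ℝ) (h0 : |x 0| ≤ a) (h1 : |x 1| ≤ b) : ‖x‖ ≤ a + b := by
  have h := plane_norm_sq x
  have ha := abs_nonneg (x 0)
  have hb := abs_nonneg (x 1)
  apply abs_le_of_sq_le_sq' _ (by linarith) |>.2
  rw [h, ← sq_abs (x 0), ← sq_abs (x 1)]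
  nlinarith

theorem dom_idx (δ : ℝ) (hδ : 0 < δ) (hδ1 : δ ≤ 1) (x : Param) (hx : x ∈ domD) :
    (idx3 δ x) ∈ (Finset.Icc (-⌈δ⁻¹⌉) ⌈δ⁻¹⌉ ×ˢ Finset.Icc (-⌈δ⁻¹⌉) ⌈δ⁻¹⌉) ×ˢ Finset.Icc (-⌈δ⁻¹⌉) ⌈δ⁻¹⌉ := by
  have key : ∀ a : ℝ, |a| ≤ 1 → ⌊a / δ⌋ ∈ Finset.Icc (-⌈δ⁻¹⌉) ⌈δ⁻¹⌉ := by
    intro a ha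
    have h := abs_le.1 ha
    have hp : (0:ℝ) < δ⁻¹ := by positivity
    have hc := Int.le_ceil δ⁻¹
    rw [Finset.mem_Icc, Int.le_floor, div_eq_mul_inv]
    constructor
    · push_cast; nlinarith
    · have h1 : (⌊a * δ⁻¹⌋ : ℝ) ≤ ⌈δ⁻¹⌉ := (Int.floor_le _).trans (by nlinarith)
      exact_mod_cast h1
  obtain ⟨h1, h2, h3⟩ := hx
  have := abs_coord x.1
  simp only [idx3, idx2, Finset.mem_product]
  exact ⟨⟨key _ (by linarith), key _ (by linarith)⟩, key _ (by rw [abs_le]; constructor <;> linarith)⟩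

theorem dom_finite (δ : ℝ) (hδ : 0 < δ) (hδ1 : δ ≤ 1) : (idx3 δ '' domD).Finite := by
  refine Set.Finite.subset (Finset.finite_toSet ((Finset.Icc (-⌈δ⁻¹⌉) ⌈δ⁻¹⌉ ×ˢ Finset.Icc (-⌈δ⁻¹⌉) ⌈δ⁻¹⌉) ×ˢ Finset.Icc (-⌈δ⁻¹⌉) ⌈δ⁻¹⌉)) ?_
  rintro _ ⟨x, hx, rfl⟩
  exact dom_idx δ hδ hδ1 x hx

theorem total_bound (δ : ℝ) (hδ : 0 < δ) (hδ1 : δ ≤ 1) : ∃ B : Finset DPair, (B.card : ℝ) ≤ 625 * δ⁻¹ ^ 4 ∧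
    ∀ ω : DPair, cubeSet δ ω.1 ⊆ domD → validArc δ ω.2 → ω ∈ B := by
  refine ⟨((Finset.Icc (-⌈δ⁻¹⌉) ⌈δ⁻¹⌉ ×ˢ Finset.Icc (-⌈δ⁻¹⌉) ⌈δ⁻¹⌉) ×ˢ Finset.Icc (-⌈δ⁻¹⌉) ⌈δ⁻¹⌉) ×ˢ Finset.Icc (-⌈δ⁻¹⌉) ⌈δ⁻¹⌉, ?_, ?_⟩
  · have h1 : 1 ≤ δ⁻¹ := one_le_inv_iff₀.2 ⟨hδ, hδ1⟩
    have h2 := Int.ceil_lt_add_one δ⁻¹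
    have h0 : 0 ≤ ⌈δ⁻¹⌉ := Int.ceil_nonneg (by linarith)
    have h3 : ((Finset.Icc (-⌈δ⁻¹⌉) ⌈δ⁻¹⌉).card : ℝ) ≤ 5 * δ⁻¹ := by
      rw [Int.card_Icc]
      have : (((⌈δ⁻¹⌉ + 1 - -⌈δ⁻¹⌉).toNat : ℤ) : ℝ) = 2 * ⌈δ⁻¹⌉ + 1 := by
        rw [Int.toNat_of_nonneg (by linarith)]; push_cast; ring
      rw [Int.cast_natCast] at this
      rw [this]; linarith
    simp only [Finset.card_product]
    push_cast
    have h4 : (0:ℝ) ≤ ((Finset.Icc (-⌈δ⁻¹⌉) ⌈δ⁻¹⌉).card : ℝ) := by positivity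
    calc _ = ((Finset.Icc (-⌈δ⁻¹⌉) ⌈δ⁻¹⌉).card : ℝ) ^ 4 := by ring
      _ ≤ (5 * δ⁻¹) ^ 4 := by gcongr
      _ = _ := by ring
  · intro ω h1 h2
    have := dom_idx δ hδ hδ1 _ (h1 (cubeCtr_mem δ hδ ω.1))
    rw [idx3_ctr δ hδ] at this
    refine Finset.mem_product.2 ⟨this, ?_⟩
    rw [Finset.mem_Icc]
    have hc := Int.le_ceil δ⁻¹
    have h3 : ω.2 < ⌈δ⁻¹⌉ := by exact_mod_cast h2.2.trans_le hc
    have := h2.1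
    constructor <;> linarith

/-- parents -/
def IsPar (δ lam σ : ℝ) (ω W : DPair) : Prop :=
  cubeSet lam W.1 ⊆ domD ∧ validArc σ W.2 ∧ prec δ δ lam σ ω W

theorem rad_pos (δ : ℝ) (hδ : 0 < δ) (k : CubeIdx) (h : cubeSet δ k ⊆ domD) : 1 / 2 < (cubeCtr δ k).2 := by
  have h1 : ((mk2 ((k.1.1:ℝ) * δ) ((k.1.2:ℝ) * δ), (k.2:ℝ) * δ) : Param) ∈ cubeSet δ k := by
    simp only [cubeSet, Set.mem_ofPred_eq, mk2_zero, mk2_one]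
    refine ⟨?_, ?_, ?_, ?_, ?_, ?_⟩ <;> nlinarith
  have h2 : 1 / 2 ≤ (k.2:ℝ) * δ := (h h1).2.1
  simp only [cubeCtr]
  linarith

theorem par_unique (δ lam σ : ℝ) (hδ : 0 < δ) (hlam : 0 < lam) (m : ℕ) (hσ : σ = ((2:ℝ) ^ m)⁻¹) (ω W W' : DPair)
    (hω : cubeSet δ ω.1 ⊆ domD) (h : IsPar δ lam σ ω W) (h' : IsPar δ lam σ ω W') : W = W' := by
  obtain ⟨p, i⟩ := ω
  obtain ⟨k, j⟩ := W
  obtain ⟨k', j'⟩ := W'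
  obtain ⟨hD, hv, hs, e, ⟨θ, hθ1, hθ2, rfl⟩, τ, hτ, hc⟩ := h
  obtain ⟨hD', hv', hs', e, ⟨θ', hθ1', hθ2', rfl⟩, τ', hτ', hc'⟩ := h'
  have hk : k = k' := by
    rw [← (mem_cube_iff lam hlam k _).1 (hs (cubeCtr_mem δ hδ p)), ← (mem_cube_iff lam hlam k' _).1 (hs' (cubeCtr_mem δ hδ p))]
  subst hk
  simp only at *
  rw [add_sub_cancel_left] at hc hc'
  set x := (cubeCtr lam k).1
  set r := (cubeCtr lam k).2
  have hr : 1 / 2 ≤ r := (hD (cubeCtr_mem lam hlam k)).2.1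
  have hx : ‖x‖ ≤ 1 / 4 := (hD (cubeCtr_mem lam hlam k)).1
  have hxp : ‖(cubeCtr δ p).1‖ ≤ 1 / 4 := (hω (cubeCtr_mem δ hδ p)).1
  have hrp := rad_pos δ hδ p hω
  have hne : x + τ • r • dir θ ≠ x := by
    intro hx'
    rw [hx'] at hc
    have : ‖(cubeCtr δ p).2 • dir (((i:ℝ) + 1 / 2) * (2 * Real.pi * δ))‖ = ‖x - (cubeCtr δ p).1‖ := by
      rw [← hc]; simp [arcCenterAt]
    rw [norm_smul, norm_dir, Real.norm_eq_abs, abs_of_pos (by linarith)] at this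
    have := norm_sub_le x (cubeCtr δ p).1
    linarith
  have heq : τ • r • dir θ = τ' • r • dir θ' := add_left_cancel (hc.symm.trans hc')
  have hn : ‖τ • r • dir θ‖ = ‖τ' • r • dir θ'‖ := by rw [heq]
  simp only [norm_smul, norm_dir, Real.norm_eq_abs, abs_of_nonneg hτ, abs_of_nonneg hτ', abs_of_nonneg (show 0 ≤ r by linarith), mul_one] at hn
  have hττ : τ = τ' := mul_right_cancel₀ (show r ≠ 0 by linarith) hn
  subst hττ
  have hτ0 : τ ≠ 0 := by rintro rfl; simp at hne
  have hdir : dir θ = dir θ' := smul_right_injective _ (show r ≠ 0 by linarith) (smul_right_injective _ hτ0 heq)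
  have hd : dist (dir θ) (dir θ') = 0 := by rw [hdir, dist_self]
  rw [dist_dir] at hd
  have hsin : Real.sin ((θ - θ') / 2) = 0 := by
    rcases mul_eq_zero.1 hd with h | h
    · norm_num at h
    · exact abs_eq_zero.1 h
  have hpi := Real.pi_pos
  have hσ0 : 0 < σ := by rw [hσ]; positivity
  have rng : ∀ (j : ℤ) (θ : ℝ), validArc σ j → (j:ℝ) * (2 * Real.pi * σ) ≤ θ → θ < ((j:ℝ) + 1) * (2 * Real.pi * σ) →
      0 ≤ θ ∧ θ < 2 * Real.pi := by
    intro j θ hj h1 h2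
    have hj' := (valid_iff m σ hσ j).1 hj
    have hj1 : (0:ℝ) ≤ j := by exact_mod_cast hj'.1
    have hj2 : (j:ℝ) + 1 ≤ 2 ^ m := by exact_mod_cast hj'.2
    constructor
    · exact le_trans (by positivity) h1
    · refine h2.trans_le ?_
      calc ((j:ℝ) + 1) * (2 * Real.pi * σ) ≤ 2 ^ m * (2 * Real.pi * σ) := by gcongr
        _ = 2 * Real.pi := by rw [hσ]; field_simp
  have r1 := rng j θ hv hθ1 hθ2
  have r2 := rng j' θ' hv' hθ1' hθ2'
  have := (Real.sin_eq_zero_iff_of_lt_of_lt (by linarith) (by linarith)).1 hsin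
  have hθθ : θ = θ' := by linarith
  subst hθθ
  have e1 := (floor_div_iff (2 * Real.pi * σ) θ (by positivity) j).2 ⟨hθ1, hθ2⟩
  have e2 := (floor_div_iff (2 * Real.pi * σ) θ (by positivity) j').2 ⟨hθ1', hθ2'⟩
  rw [← e1, ← e2]

theorem dist_dir_le (a b : ℝ) : dist (dir a) (dir b) ≤ |a - b| := by
  rw [dist_dir]
  have := Real.abs_sin_le_abs (x := (a - b) / 2)
  rw [abs_div, abs_two] at this
  linarith

theorem cube_ctr_dist (δ lam : ℝ) (hδ : 0 < δ) (p k : CubeIdx) (h : cubeSet δ p ⊆ cubeSet lam k) :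
    dist (cubeCtr δ p).1 (cubeCtr lam k).1 ≤ lam ∧ |(cubeCtr δ p).2 - (cubeCtr lam k).2| ≤ lam := by
  obtain ⟨h1, h2, h3, h4, h5, h6⟩ := h (cubeCtr_mem δ hδ p)
  constructor
  · rw [dist_eq_norm]
    refine (norm_le_coord _ (lam / 2) (lam / 2) ?_ ?_).trans (by linarith)
    · rw [PiLp.sub_apply, abs_le]
      have : (cubeCtr lam k).1 0 = ((k.1.1 : ℝ) + 1 / 2) * lam := rfl
      rw [this]; constructor <;> linarith
    · rw [PiLp.sub_apply, abs_le]
      have : (cubeCtr lam k).1 1 = ((k.1.2 : ℝ) + 1 / 2) * lam := rfl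
      rw [this]; constructor <;> linarith
  · rw [abs_le]
    have : (cubeCtr lam k).2 = ((k.2 : ℝ) + 1 / 2) * lam := rfl
    have hl : 0 < lam := by nlinarith
    rw [this]; constructor <;> linarith

theorem par_ball (δ lam σ : ℝ) (hδ : 0 < δ) (hlam : 0 < lam) (hls : lam ≤ σ) (ω W : DPair)
    (hω : cubeSet δ ω.1 ⊆ domD) (h : IsPar δ lam σ ω W) :
    dist (arcCenterAt (cubeCtr δ ω.1) δ ω.2) (arcCenterAt (cubeCtr lam W.1) σ W.2) ≤ 6 * σ := by
  obtain ⟨hD, hv, hs, e, ⟨θ, hθ1, hθ2, rfl⟩, τ, hτ, hc⟩ := h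
  rw [add_sub_cancel_left] at hc
  obtain ⟨hc1, hc2⟩ := cube_ctr_dist δ lam hδ _ _ hs
  have hr : 1 / 2 ≤ (cubeCtr lam W.1).2 := (hD (cubeCtr_mem lam hlam _)).2.1
  have hr1 : (cubeCtr lam W.1).2 ≤ 1 := (hD (cubeCtr_mem lam hlam _)).2.2
  have hrp : 1 / 2 ≤ (cubeCtr δ ω.1).2 := (hω (cubeCtr_mem δ hδ _)).2.1
  set x := (cubeCtr lam W.1).1
  set r := (cubeCtr lam W.1).2
  set x' := (cubeCtr δ ω.1).1
  set r' := (cubeCtr δ ω.1).2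
  set c := arcCenterAt (cubeCtr δ ω.1) δ ω.2
  have d1 : dist c x' = r' := by
    simp [c, arcCenterAt, x', r', norm_smul, norm_dir, abs_of_nonneg (show 0 ≤ (cubeCtr δ ω.1).2 by linarith)]
  have d2 : dist c x = τ * r := by
    rw [hc]; simp [norm_smul, norm_dir, abs_of_nonneg (show 0 ≤ r by linarith), abs_of_nonneg hτ]
  have d3 := dist_triangle c x' x
  have d4 := dist_triangle_right c x' x
  have hτr : |τ * r - r| ≤ 2 * lam := by
    have := abs_le.1 hc2
    rw [abs_le]
    constructor <;> linarith
  have hA : dist c (x + r • dir (ang σ W.2)) ≤ |τ * r - r| + r * dist (dir θ) (dir (ang σ W.2)) := by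
    rw [hc, dist_eq_norm, show x + τ • r • dir θ - (x + r • dir (ang σ W.2)) = (τ * r - r) • dir θ + r • (dir θ - dir (ang σ W.2)) by
      rw [smul_smul, sub_smul, smul_sub]; abel]
    refine (norm_add_le _ _).trans ?_
    rw [norm_smul, norm_smul, norm_dir, Real.norm_eq_abs, Real.norm_eq_abs, abs_of_nonneg (show 0 ≤ r by linarith), mul_one, dist_eq_norm]
  have hd := dist_dir_le θ (ang σ W.2)
  have hang : |θ - ang σ W.2| ≤ Real.pi * σ := by
    unfold ang
    rw [abs_le]; constructor <;> linarith
  have hpi := Real.pi_le_four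
  have hσ0 : 0 < σ := by linarith
  have : r * dist (dir θ) (dir (ang σ W.2)) ≤ 1 * dist (dir θ) (dir (ang σ W.2)) := by gcongr
  have : Real.pi * σ ≤ 4 * σ := by gcongr
  show dist c (x + r • dir (ang σ W.2)) ≤ 6 * σ
  linarith

/-- box of indices around an arc -/
noncomputable def bx (a : ℤ × ℤ) : Finset (ℤ × ℤ) := Finset.Icc (a.1 - 4) (a.1 + 4) ×ˢ Finset.Icc (a.2 - 4) (a.2 + 4)

theorem bx_card (a : ℤ × ℤ) : (bx a).card = 81 := by
  unfold bx
  rw [Finset.card_product, Int.card_Icc, Int.card_Icc]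
  rw [show a.1 + 4 + 1 - (a.1 - 4) = 9 by ring, show a.2 + 4 + 1 - (a.2 - 4) = 9 by ring]
  rfl

theorem arc_bx (δ : ℝ) (hδ : 0 < δ) (p : Param) (hp0 : 0 ≤ p.2) (hp : p.2 ≤ 1) (j : ℤ) (w : Plane) (hw : w ∈ arcSet p δ j) :
    idx2 δ w ∈ bx (idx2 δ (arcCenterAt p δ j)) := by
  obtain ⟨θ, h1, h2, rfl⟩ := hw
  have hang : |θ - ang δ j| ≤ Real.pi * δ := by
    unfold ang
    rw [abs_le]; constructor <;> linarith
  have hd : ‖(p.1 + p.2 • dir θ) - arcCenterAt p δ j‖ ≤ 4 * δ := by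
    have : (p.1 + p.2 • dir θ) - arcCenterAt p δ j = p.2 • (dir θ - dir (ang δ j)) := by
      unfold arcCenterAt ang; rw [smul_sub]; abel
    rw [this, norm_smul, ← dist_eq_norm, Real.norm_eq_abs, abs_of_nonneg hp0]
    have := dist_dir_le θ (ang δ j)
    have : p.2 * dist (dir θ) (dir (ang δ j)) ≤ 1 * dist (dir θ) (dir (ang δ j)) := by gcongr
    have : Real.pi * δ ≤ 4 * δ := by gcongr; exact Real.pi_le_four
    linarith
  generalize p.1 + p.2 • dir θ = w at *
  generalize arcCenterAt p δ j = c at *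
  have key : ∀ a b : ℝ, |a - b| ≤ 4 * δ → ⌊a / δ⌋ ∈ Finset.Icc (⌊b / δ⌋ - 4) (⌊b / δ⌋ + 4) := by
    intro a b hab
    have hab' := abs_le.1 hab
    have e1 : a / δ ≤ b / δ + 4 := by
      rw [div_le_iff₀ hδ, add_mul, div_mul_cancel₀ _ hδ.ne']; linarith
    have e2 : b / δ - 4 ≤ a / δ := by
      rw [le_div_iff₀ hδ, sub_mul, div_mul_cancel₀ _ hδ.ne']; linarith
    rw [Finset.mem_Icc]
    have f1 := Int.floor_le_floor e1
    have f2 := Int.floor_le_floor e2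
    have g1 : ⌊b / δ + 4⌋ = ⌊b / δ⌋ + 4 := by exact_mod_cast Int.floor_add_intCast (b / δ) 4
    have g2 : ⌊b / δ - 4⌋ = ⌊b / δ⌋ - 4 := by exact_mod_cast Int.floor_sub_intCast (b / δ) 4
    rw [g1] at f1; rw [g2] at f2
    exact ⟨f2, f1⟩
  have hco := abs_coord (w - c)
  simp only [idx2, bx, Finset.mem_product]
  exact ⟨key _ _ (hco.1.trans hd), key _ _ (hco.2.trans hd)⟩

open Classical in
theorem union_bx (δ : ℝ) (hδ : 0 < δ) (p : Param) (hp0 : 0 ≤ p.2) (hp : p.2 ≤ 1) (A : Finset ℤ) :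
    idx2 δ '' (⋃ j ∈ (A : Set ℤ), arcSet p δ j) ⊆ ((A.biUnion (fun j => bx (idx2 δ (arcCenterAt p δ j))) : Finset (ℤ × ℤ)) : Set (ℤ × ℤ)) := by
  rintro _ ⟨w, hw, rfl⟩
  simp only [mem_iUnion, exists_prop] at hw
  obtain ⟨j, hj, hw⟩ := hw
  exact Finset.mem_coe.2 (Finset.mem_biUnion.2 ⟨j, hj, arc_bx δ hδ p hp0 hp j w hw⟩)

theorem union_fin (δ : ℝ) (hδ : 0 < δ) (p : Param) (hp0 : 0 ≤ p.2) (hp : p.2 ≤ 1) (A : Finset ℤ) :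
    (idx2 δ '' (⋃ j ∈ (A : Set ℤ), arcSet p δ j)).Finite :=
  Set.Finite.subset (Finset.finite_toSet _) (union_bx δ hδ p hp0 hp A)

theorem count2_le (δ : ℝ) (hδ : 0 < δ) (p : Param) (hp0 : 0 ≤ p.2) (hp : p.2 ≤ 1) (A : Finset ℤ) :
    count2 δ (⋃ j ∈ (A : Set ℤ), arcSet p δ j) ≤ 81 * A.card := by
  classical
  have h := Nat.card_mono (Finset.finite_toSet _) (union_bx δ hδ p hp0 hp A)
  rw [Nat.card_coe_set_eq, Nat.card_coe_set_eq, Set.ncard_coe_finset] at h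
  rw [count2, Nat.card_coe_set_eq]
  refine h.trans (Finset.card_biUnion_le.trans ?_)
  simp [bx_card, mul_comm]

theorem ctr_mem_arc (δ : ℝ) (hδ : 0 < δ) (p : Param) (j : ℤ) : arcCenterAt p δ j ∈ arcSet p δ j := by
  have hpi := Real.pi_pos
  refine ⟨_, ?_, ?_, rfl⟩
  · have : 0 < 2 * Real.pi * δ := by positivity
    nlinarith
  · have : 0 < 2 * Real.pi * δ := by positivity
    nlinarith

theorem le_count2 (δ : ℝ) (hδ : 0 < δ) (p : Param) (hp0 : 1 / 2 ≤ p.2) (hp : p.2 ≤ 1) (A B : Finset ℤ) (hAB : B ⊆ A)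
    (hA : ∀ j ∈ A, validArc δ j) (X : Set Plane) (hX : ∀ j ∈ B, arcCenterAt p δ j ∈ X) :
    B.card ≤ 11 * count2 δ ((⋃ j ∈ (A : Set ℤ), arcSet p δ j) ∩ X) := by
  classical
  have hfin : (idx2 δ '' ((⋃ j ∈ (A : Set ℤ), arcSet p δ j) ∩ X)).Finite :=
    (union_fin δ hδ p (by linarith) hp A).subset (image_mono inter_subset_left)
  have h1 : B.card ≤ 11 * (B.image (fun j => idx2 δ (arcCenterAt p δ j))).card := by
    apply Finset.card_le_mul_card_image
    intro b hb
    rcases (B.filter (fun j => idx2 δ (arcCenterAt p δ j) = b)).eq_empty_or_nonempty with he | ⟨j, hj⟩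
    · rw [he]; simp
    · obtain ⟨hjB, hj⟩ := Finset.mem_filter.1 hj
      have := near_count' δ 4 hδ (by norm_num) j (hA j (hAB hjB)) (B.filter (fun j => idx2 δ (arcCenterAt p δ j) = b)) ?_
      · have h' : ((B.filter (fun j => idx2 δ (arcCenterAt p δ j) = b)).card : ℝ) ≤ 11 := by linarith
        exact_mod_cast h'
      · intro i hi
        obtain ⟨hiB, hi⟩ := Finset.mem_filter.1 hi
        refine ⟨hA i (hAB hiB), ?_⟩
        rw [← hi] at hj
        simp only [idx2, Prod.mk.injEq] at hj
        have key : ∀ a b : ℝ, ⌊a / δ⌋ = ⌊b / δ⌋ → |a - b| ≤ δ := by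
          intro a b hab
          have h1 := (floor_div_iff δ a hδ _).1 hab
          have h2 := (floor_div_iff δ b hδ _).1 rfl
          rw [abs_le]; constructor <;> linarith
        have hn := norm_le_coord (arcCenterAt p δ j - arcCenterAt p δ i) δ δ (key _ _ hj.1) (key _ _ hj.2)
        have : arcCenterAt p δ j - arcCenterAt p δ i = p.2 • (dir (ang δ j) - dir (ang δ i)) := by
          unfold arcCenterAt ang; rw [smul_sub]; abel
        rw [this, norm_smul, ← dist_eq_norm, Real.norm_eq_abs, abs_of_nonneg (by linarith)] at hn
        nlinarith [dist_nonneg (x := dir (ang δ j)) (y := dir (ang δ i))]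
  refine h1.trans (Nat.mul_le_mul_left _ ?_)
  rw [← Set.ncard_coe_finset, ← Nat.card_coe_set_eq]
  refine Nat.card_mono hfin ?_
  intro b hb
  obtain ⟨j, hj, rfl⟩ := Finset.mem_image.1 (Finset.mem_coe.1 hb)
  refine ⟨_, ⟨?_, hX j hj⟩, rfl⟩
  simp only [mem_iUnion, exists_prop]
  exact ⟨j, hAB hj, ctr_mem_arc δ hδ p j⟩


theorem pig {β : Type*} (F : Finset β) (f : β → ℕ) (L : ℕ) (hL : 0 < L) (hf : ∀ x ∈ F, 1 ≤ f x ∧ f x < 2 ^ L) :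
    ∃ a : ℕ, 1 ≤ a ∧ F.card ≤ L * (F.filter (fun x => a ≤ f x ∧ f x < 2 * a)).card := by
  obtain ⟨i, hi, hmax⟩ := Finset.exists_max_image (Finset.range L) (fun i => (F.filter (fun x => Nat.log 2 (f x) = i)).card)
    ⟨0, Finset.mem_range.2 hL⟩
  refine ⟨2 ^ i, Nat.one_le_two_pow, ?_⟩
  have h1 := Finset.card_eq_sum_card_fiberwise (s := F) (t := Finset.range L) (f := fun x => Nat.log 2 (f x)) (by
    intro x hx
    have := hf x hx
    exact Finset.mem_coe.2 (Finset.mem_range.2 (Nat.log_lt_of_lt_pow (by omega) this.2)))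
  rw [h1]
  refine (Finset.sum_le_card_nsmul _ _ _ hmax).trans ?_
  rw [Finset.card_range, smul_eq_mul]
  refine Nat.mul_le_mul_left _ (Finset.card_le_card ?_)
  intro x hx
  obtain ⟨hx1, hx2⟩ := Finset.mem_filter.1 hx
  refine Finset.mem_filter.2 ⟨hx1, ?_⟩
  have := hf x hx1
  rw [← hx2]
  refine ⟨Nat.pow_log_le_self 2 (by omega), ?_⟩
  have := Nat.lt_pow_succ_log_self (b := 2) (by norm_num) (f x)
  rw [pow_succ] at this; omega

theorem regularize {β α : Type*} [DecidableEq α] [DecidableEq β] (F : Finset β) (π : β → α × ℤ) (L : ℕ) (hL : 0 < L)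
    (hF : F.card < 2 ^ L) :
    ∃ F2 ⊆ F, ∃ μ D : ℕ, 1 ≤ μ ∧ 1 ≤ D ∧ F.card ≤ L ^ 2 * F2.card ∧
      (∀ ω ∈ F2, μ ≤ (F2.filter (fun ω' => π ω' = π ω)).card ∧ (F2.filter (fun ω' => π ω' = π ω)).card < 2 * μ) ∧
      (∀ ω ∈ F2, D ≤ ((F2.image π).filter (fun v => v.1 = (π ω).1)).card ∧
        ((F2.image π).filter (fun v => v.1 = (π ω).1)).card < 2 * D) := by
  have h1 := pig F (fun ω => (F.filter (fun ω' => π ω' = π ω)).card) L hL (by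
    intro x hx
    exact ⟨Finset.card_pos.2 ⟨x, Finset.mem_filter.2 ⟨hx, rfl⟩⟩, (Finset.card_filter_le _ _).trans_lt hF⟩)
  obtain ⟨μ, hμ, h1⟩ := h1
  set F1 := F.filter (fun x => μ ≤ (F.filter (fun ω' => π ω' = π x)).card ∧ (F.filter (fun ω' => π ω' = π x)).card < 2 * μ) with hF1
  have h2 := pig F1 (fun ω => ((F1.image π).filter (fun v => v.1 = (π ω).1)).card) L hL (by
    intro x hx
    refine ⟨Finset.card_pos.2 ⟨π x, Finset.mem_filter.2 ⟨Finset.mem_image_of_mem _ hx, rfl⟩⟩, ?_⟩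
    exact (Finset.card_filter_le _ _).trans_lt (Finset.card_image_le.trans_lt ((Finset.card_filter_le _ _).trans_lt hF)))
  obtain ⟨D, hD, h2⟩ := h2
  set F2 := F1.filter (fun ω => D ≤ ((F1.image π).filter (fun v => v.1 = (π ω).1)).card ∧ ((F1.image π).filter (fun v => v.1 = (π ω).1)).card < 2 * D) with hF2
  have s21 : F2 ⊆ F1 := Finset.filter_subset _ _
  have s10 : F1 ⊆ F := Finset.filter_subset _ _
  refine ⟨F2, s21.trans s10, μ, D, hμ, hD, ?_, ?_, ?_⟩
  · calc F.card ≤ L * F1.card := h1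
      _ ≤ L * (L * F2.card) := Nat.mul_le_mul_left _ h2
      _ = _ := by ring
  · intro ω hω
    have hω1 := Finset.mem_filter.1 (s21 hω)
    have hω2 := Finset.mem_filter.1 hω
    have : F2.filter (fun ω' => π ω' = π ω) = F.filter (fun ω' => π ω' = π ω) := by
      ext x
      simp only [Finset.mem_filter]
      refine ⟨fun h => ⟨s10 (s21 h.1), h.2⟩, fun h => ⟨?_, h.2⟩⟩
      refine Finset.mem_filter.2 ⟨Finset.mem_filter.2 ⟨h.1, ?_⟩, ?_⟩
      · rw [h.2]; exact hω1.2
      · rw [h.2]; exact hω2.2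
    rw [this]; exact hω1.2
  · intro ω hω
    have hω2 := Finset.mem_filter.1 hω
    have : (F2.image π).filter (fun v => v.1 = (π ω).1) = (F1.image π).filter (fun v => v.1 = (π ω).1) := by
      ext v
      simp only [Finset.mem_filter, Finset.mem_image]
      refine ⟨fun ⟨⟨x, hx, e⟩, h⟩ => ⟨⟨x, s21 hx, e⟩, h⟩, fun ⟨⟨x, hx, e⟩, h⟩ => ⟨⟨x, ?_, e⟩, h⟩⟩
      refine Finset.mem_filter.2 ⟨hx, ?_⟩
      rw [e, h]; exact hω2.2
    rw [this]; exact hω2.2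

theorem iter {β : Type*} [DecidableEq β] (F : Finset β) (m : Finset β → β → ℝ) (n : ℕ → ℝ) (J : ℕ)
    (hmono : ∀ S T : Finset β, S ⊆ T → ∀ ω, m S ω ≤ m T ω) (h0 : ∀ ω ∈ F, m F ω ≤ n 0)
    (hterm : ∀ j < J, ∀ S ⊆ F, F.card ≤ 2 ^ j * S.card → (∀ ω ∈ S, m S ω ≤ n j) →
      2 * (S.filter (fun ω => n (j + 1) < m S ω)).card ≤ S.card) :
    ∃ S ⊆ F, F.card ≤ 2 ^ J * S.card ∧ ∀ ω ∈ S, m S ω ≤ n J := by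
  suffices H : ∀ j ≤ J, ∃ S ⊆ F, F.card ≤ 2 ^ j * S.card ∧ ∀ ω ∈ S, m S ω ≤ n j from H J le_rfl
  intro j
  induction j with
  | zero => intro _; exact ⟨F, subset_rfl, by simp, h0⟩
  | succ j ih =>
    intro hj
    obtain ⟨S, hS, hc, hm⟩ := ih (by omega)
    have h := hterm j (by omega) S hS hc hm
    refine ⟨S.filter (fun ω => ¬ n (j + 1) < m S ω), (Finset.filter_subset _ _).trans hS, ?_, ?_⟩
    · have e := Finset.card_filter_add_card_filter_not (s := S) (fun ω => n (j + 1) < m S ω)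
      have : S.card ≤ 2 * (S.filter (fun ω => ¬ n (j + 1) < m S ω)).card := by omega
      calc F.card ≤ 2 ^ j * S.card := hc
        _ ≤ 2 ^ j * (2 * (S.filter (fun ω => ¬ n (j + 1) < m S ω)).card) := Nat.mul_le_mul_left _ this
        _ = _ := by ring
    · intro ω hω
      exact (hmono _ _ (Finset.filter_subset _ _) ω).trans (not_lt.1 (Finset.mem_filter.1 hω).2)

theorem extract {α : Type*} [DecidableEq α] (Om S : Finset (α × ℤ)) (hS : S ⊆ Om) (M Q : ℕ) (hQ : 1 ≤ Q) (hM : 1 ≤ M)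
    (hOm : ∀ p ∈ Om.image Prod.fst, (Om.filter (fun ω => ω.1 = p)).card = M) (hne : Om.Nonempty)
    (hc : Om.card ≤ Q * S.card) :
    ∃ G ⊆ S, ∃ M' : ℕ, 1 ≤ M' ∧ M ≤ 2 * Q * M' ∧ G.Nonempty ∧
      (∀ p ∈ G.image Prod.fst, (G.filter (fun ω => ω.1 = p)).card = M') ∧
      (Om.image Prod.fst).card ≤ 2 * Q * (G.image Prod.fst).card ∧ Om.card ≤ 4 * Q ^ 2 * G.card := by
  set M' := (M - 1) / (2 * Q) + 1 with hM'
  have k1 : M ≤ 2 * Q * M' := by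
    have := Nat.lt_mul_div_succ (M - 1) (show 0 < 2 * Q by omega)
    rw [hM']; omega
  have k2 : ∀ x < M', 2 * Q * x ≤ M := by
    intro x hx
    have : x ≤ (M - 1) / (2 * Q) := by omega
    have := Nat.mul_le_mul_left (2 * Q) this
    have := Nat.mul_div_le (M - 1) (2 * Q)
    omega
  set P := Om.image Prod.fst with hP
  set P' := P.filter (fun p => M' ≤ (S.filter (fun ω => ω.1 = p)).card) with hP'
  have hch : ∀ p, ∃ T ⊆ S.filter (fun ω => ω.1 = p), p ∈ P' → T.card = M' := by
    intro p
    by_cases hp : p ∈ P'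
    · obtain ⟨T, h1, h2⟩ := Finset.exists_subset_card_eq (Finset.mem_filter.1 hp).2
      exact ⟨T, h1, fun _ => h2⟩
    · exact ⟨∅, by simp, fun h => absurd h hp⟩
  choose T hT1 hT2 using hch
  have cO : Om.card = P.card * M := by
    rw [Finset.card_eq_sum_card_fiberwise (s := Om) (t := P) (f := Prod.fst) (fun x hx => Finset.mem_image_of_mem _ hx),
      Finset.sum_const_nat hOm]
  have cS : 2 * Q * S.card ≤ 2 * Q * M * P'.card + M * P.card := by
    have h1 : S.card = ∑ p ∈ P, (S.filter (fun ω => ω.1 = p)).card :=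
      Finset.card_eq_sum_card_fiberwise (fun x hx => Finset.mem_image_of_mem _ (hS hx))
    have h2 : ∀ p ∈ P, 2 * Q * (S.filter (fun ω => ω.1 = p)).card ≤ (if M' ≤ (S.filter (fun ω => ω.1 = p)).card then 2 * Q * M else 0) + M := by
      intro p hp
      split_ifs with h
      · have : (S.filter (fun ω => ω.1 = p)).card ≤ M := by
          rw [← hOm p hp]; exact Finset.card_le_card (Finset.filter_subset_filter _ hS)
        have := Nat.mul_le_mul_left (2 * Q) this
        omega
      · have := k2 _ (not_le.1 h); omega
    rw [h1, Finset.mul_sum]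
    refine (Finset.sum_le_sum h2).trans ?_
    rw [Finset.sum_add_distrib, ← Finset.sum_filter, Finset.sum_const, Finset.sum_const]
    simp only [smul_eq_mul]
    rw [← hP']
    apply le_of_eq; ring
  have k3 : P.card ≤ 2 * Q * P'.card := by
    have : P.card * M ≤ 2 * Q * P'.card * M := by nlinarith
    exact Nat.le_of_mul_le_mul_right this (by omega)
  have hfst : ∀ p, ∀ ω ∈ T p, ω.1 = p := fun p ω h => (Finset.mem_filter.1 (hT1 p h)).2
  set G := P'.biUnion T with hG
  have hGim : G.image Prod.fst = P' := by
    ext p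
    simp only [hG, Finset.mem_image, Finset.mem_biUnion]
    constructor
    · rintro ⟨ω, ⟨q, hq, hω⟩, rfl⟩
      rw [hfst q ω hω]; exact hq
    · intro hp
      obtain ⟨ω, hω⟩ := Finset.card_pos.1 (show 0 < (T p).card by rw [hT2 p hp]; exact Nat.succ_pos _)
      exact ⟨ω, ⟨p, hp, hω⟩, hfst p ω hω⟩
  have hGf : ∀ p ∈ P', G.filter (fun ω => ω.1 = p) = T p := by
    intro p hp
    ext ω
    simp only [hG, Finset.mem_filter, Finset.mem_biUnion]
    constructor
    · rintro ⟨⟨q, hq, hω⟩, rfl⟩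
      rwa [hfst q ω hω]
    · intro h; exact ⟨⟨p, hp, h⟩, hfst p ω h⟩
  have cG : G.card = P'.card * M' := by
    rw [Finset.card_eq_sum_card_fiberwise (s := G) (t := P') (f := Prod.fst) (fun x hx => by rw [← hGim]; exact Finset.mem_coe.2 (Finset.mem_image_of_mem _ hx))]
    exact Finset.sum_const_nat (fun p hp => by rw [hGf p hp, hT2 p hp])
  have hfin : Om.card ≤ 4 * Q ^ 2 * G.card := by
    rw [cO, cG]
    calc P.card * M ≤ (2 * Q * P'.card) * (2 * Q * M') := Nat.mul_le_mul k3 k1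
      _ = _ := by ring
  refine ⟨G, ?_, M', Nat.succ_pos _, k1, ?_, ?_, by rw [hGim]; exact k3, hfin⟩
  · intro ω hω
    obtain ⟨p, hp, h⟩ := Finset.mem_biUnion.1 hω
    exact (Finset.mem_filter.1 (hT1 p h)).1
  · rw [← Finset.card_pos]
    have := Finset.card_pos.2 hne
    by_contra h
    rw [show G.card = 0 by omega] at hfin; omega
  · intro p hp
    rw [hGim] at hp
    rw [hGf p hp, hT2 p hp]


section
variable {β α : Type*} [DecidableEq α] [DecidableEq β]

/-- the regularised structure -/
structure Reg (F2 : Finset β) (π : β → α × ℤ) (μ D : ℕ) : Prop where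
  hμ : 1 ≤ μ
  hD : 1 ≤ D
  m1 : ∀ ω ∈ F2, μ ≤ (F2.filter (fun ω' => π ω' = π ω)).card ∧ (F2.filter (fun ω' => π ω' = π ω)).card < 2 * μ
  d1 : ∀ ω ∈ F2, D ≤ ((F2.image π).filter (fun v => v.1 = (π ω).1)).card ∧
        ((F2.image π).filter (fun v => v.1 = (π ω).1)).card < 2 * D

theorem Reg.lower {F2 : Finset β} {π : β → α × ℤ} {μ D : ℕ} (h : Reg F2 π μ D) (X : Finset α)
    (hX : X ⊆ (F2.image π).image Prod.fst) :
    μ * (D * X.card) ≤ (F2.filter (fun ω => (π ω).1 ∈ X)).card := by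
  have h1 : D * X.card ≤ ((F2.image π).filter (fun v => v.1 ∈ X)).card := by
    refine Finset.mul_card_image_le_card_of_maps_to (f := Prod.fst) (fun v hv => (Finset.mem_filter.1 hv).2) D ?_
    intro p hp
    obtain ⟨v, hv, rfl⟩ := Finset.mem_image.1 (hX hp)
    obtain ⟨ω, hω, rfl⟩ := Finset.mem_image.1 hv
    refine (h.d1 ω hω).1.trans (Finset.card_le_card ?_)
    intro w hw
    obtain ⟨a, b⟩ := Finset.mem_filter.1 hw
    exact Finset.mem_filter.2 ⟨Finset.mem_filter.2 ⟨a, by rw [b]; exact hp⟩, b⟩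
  refine (Nat.mul_le_mul_left μ h1).trans ?_
  refine Finset.mul_card_image_le_card_of_maps_to (f := π) (fun ω hω => ?_) μ ?_
  · obtain ⟨a, b⟩ := Finset.mem_filter.1 hω
    exact Finset.mem_filter.2 ⟨Finset.mem_image_of_mem _ a, b⟩
  · intro v hv
    obtain ⟨a, b⟩ := Finset.mem_filter.1 hv
    obtain ⟨ω, hω, rfl⟩ := Finset.mem_image.1 a
    refine (h.m1 ω hω).1.trans (Finset.card_le_card ?_)
    intro w hw
    obtain ⟨c, d⟩ := Finset.mem_filter.1 hw
    exact Finset.mem_filter.2 ⟨Finset.mem_filter.2 ⟨c, by rw [d]; exact b⟩, d⟩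

theorem Reg.upper {F2 : Finset β} {π : β → α × ℤ} {μ D : ℕ} (h : Reg F2 π μ D) :
    F2.card ≤ 2 * μ * (2 * D * ((F2.image π).image Prod.fst).card) := by
  have h1 : (F2.image π).card ≤ 2 * D * ((F2.image π).image Prod.fst).card := by
    refine Finset.card_le_mul_card_image _ _ ?_
    intro p hp
    obtain ⟨v, hv, rfl⟩ := Finset.mem_image.1 hp
    obtain ⟨ω, hω, rfl⟩ := Finset.mem_image.1 hv
    exact (h.d1 ω hω).2.le
  refine le_trans ?_ (Nat.mul_le_mul_left _ h1)
  refine Finset.card_le_mul_card_image _ _ ?_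
  intro v hv
  obtain ⟨ω, hω, rfl⟩ := Finset.mem_image.1 hv
  exact (h.m1 ω hω).2.le

theorem Reg.bad {F2 : Finset β} {π : β → α × ℤ} {μ D : ℕ} (h : Reg F2 π μ D) (B : Finset β) (hB : B ⊆ F2) :
    B.card ≤ 2 * μ * (B.image π).card := by
  refine Finset.card_le_mul_card_image _ _ ?_
  intro v hv
  obtain ⟨ω, hω, rfl⟩ := Finset.mem_image.1 hv
  exact (Finset.card_le_card (Finset.filter_subset_filter _ hB)).trans (h.m1 ω (hB hω)).2.le

end

/-- standing hypotheses on the configuration, in finite terms -/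
structure Conf (δ lam t σ s Z : ℝ) (Om F2 : Finset DPair) (π : DPair → DPair) (L M : ℕ) : Prop where
  hδ : 0 < δ
  hs0 : 0 < s
  hs1 : s ≤ 1
  hδl : δ ≤ lam
  hlt : lam ≤ t
  ht1 : t ≤ 1
  hZ1 : 1 ≤ Z
  hσ0 : 0 < σ
  sub : F2 ⊆ Om
  ne : F2.Nonempty
  big : Om.card ≤ 2 * L ^ 2 * F2.card
  fM : Om.card = (Om.image Prod.fst).card * M
  fM2 : ∀ p ∈ Om.image Prod.fst, (Om.filter (fun ω => ω.1 = p)).card = M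
  hdom : ∀ ω ∈ Om, cubeSet δ ω.1 ⊆ domD
  par : ∀ ω ∈ F2, IsPar δ lam σ ω (π ω)
  P3 : ∀ (x : Param) (r : ℝ), δ ≤ r → ∀ A ⊆ Om.image Prod.fst, (∀ k ∈ A, pdist (cubeCtr δ k) x ≤ r) →
      (A.card : ℝ) ≤ Z * r ^ s * (Om.image Prod.fst).card
  fib : ∀ (p : CubeIdx) (W : DPair), p ∈ Om.image Prod.fst → ∀ A ⊆ Om.filter (fun ω => ω.1 = p),
      (∀ ω ∈ A, IsPar δ lam σ ω W) → (A.card : ℝ) ≤ 5346 * Z * σ ^ s * M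

theorem rpow_mul_le (c x s : ℝ) (hc : 1 ≤ c) (hx : 0 < x) (hs0 : 0 < s) (hs1 : s ≤ 1) : (c * x) ^ s ≤ c * x ^ s := by
  rw [Real.mul_rpow (by linarith) hx.le]
  gcongr
  calc c ^ s ≤ c ^ (1:ℝ) := Real.rpow_le_rpow_of_exponent_le hc hs1
    _ = c := Real.rpow_one c

theorem Conf.nt {δ lam t σ s Z : ℝ} {Om F2 : Finset DPair} {π : DPair → DPair} {L M μ D : ℕ}
    (h : Conf δ lam t σ s Z Om F2 π L M) (hr : Reg F2 π μ D) (p : CubeIdx) (X : Finset CubeIdx)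
    (hX : X ⊆ (F2.image π).image Prod.fst) (hX2 : ∀ p' ∈ X, pdist (cubeCtr lam p) (cubeCtr lam p') ≤ 4 * (Z * t)) :
    (X.card : ℝ) ≤ 96 * L ^ 2 * Z ^ 2 * t ^ s * ((F2.image π).image Prod.fst).card := by
  have hδ := h.hδ
  have hδl := h.hδl
  have hlt := h.hlt
  have hZ1 := h.hZ1
  have ht : 0 < t := by linarith
  set E := F2.filter (fun ω => (π ω).1 ∈ X) with hE
  have e1 := hr.lower X hX
  have e2 : E.card ≤ M * (E.image Prod.fst).card := by
    refine Finset.card_le_mul_card_image _ _ ?_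
    intro q hq
    obtain ⟨ω, hω, rfl⟩ := Finset.mem_image.1 hq
    have := h.fM2 ω.1 (Finset.mem_image_of_mem _ (h.sub (Finset.mem_filter.1 hω).1))
    rw [← this]
    exact Finset.card_le_card (Finset.filter_subset_filter _ ((Finset.filter_subset _ _).trans h.sub))
  have hZt : t ≤ Z * t := by nlinarith
  have e3 := h.P3 (cubeCtr lam p) (12 * Z * t) (by nlinarith) (E.image Prod.fst)
    (Finset.image_subset_image ((Finset.filter_subset _ _).trans h.sub)) (by
      intro k hk
      obtain ⟨ω, hω, rfl⟩ := Finset.mem_image.1 hk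
      obtain ⟨hω1, hω2⟩ := Finset.mem_filter.1 hω
      have c1 := cube_ctr_dist δ lam hδ ω.1 (π ω).1 (h.par ω hω1).2.2.1
      have c2 := pdist_le (cubeCtr δ ω.1) (cubeCtr lam (π ω).1)
      have c3 := hX2 _ hω2
      rw [pdist_comm] at c3
      have := pdist_tri _ _ _ (2 * lam) (4 * (Z * t)) (by linarith) c3
      nlinarith)
  have e4 := rpow_mul_le (12 * Z) t s (by linarith) ht h.hs0 h.hs1
  have e5 := hr.upper
  have e6 := h.big
  have e7 := h.fM
  set N := ((F2.image π).image Prod.fst).card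
  set P := (Om.image Prod.fst).card
  have hμD : (0:ℝ) < μ * D := by
    have h1 := hr.hμ
    have h2 := hr.hD
    positivity
  have hts : 0 < t ^ s := by positivity
  rify at e1 e2 e5 e6 e7
  have k1 : (μ * D : ℝ) * X.card ≤ 12 * Z ^ 2 * t ^ s * Om.card := by
    calc (μ * D : ℝ) * X.card = μ * (D * X.card) := by ring
      _ ≤ E.card := e1
      _ ≤ M * (E.image Prod.fst).card := e2
      _ ≤ M * (Z * (12 * Z * t) ^ s * P) := by gcongr
      _ ≤ M * (Z * (12 * Z * t ^ s) * P) := by gcongr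
      _ = 12 * Z ^ 2 * t ^ s * (P * M) := by ring
      _ = _ := by rw [← e7]
  have k2 : (Om.card : ℝ) ≤ 2 * L ^ 2 * (2 * μ * (2 * D * N)) := e6.trans (by gcongr)
  have k3 : (μ * D : ℝ) * X.card ≤ (μ * D : ℝ) * (96 * L ^ 2 * Z ^ 2 * t ^ s * N) := by
    calc _ ≤ _ := k1
      _ ≤ 12 * Z ^ 2 * t ^ s * (2 * L ^ 2 * (2 * μ * (2 * D * N))) := by gcongr
      _ = _ := by ring
  exact le_of_mul_le_mul_left k3 hμD

theorem Conf.dlow {δ lam t σ s Z : ℝ} {Om F2 : Finset DPair} {π : DPair → DPair} {L M μ D : ℕ}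
    (h : Conf δ lam t σ s Z Om F2 π L M) (hr : Reg F2 π μ D) :
    1 ≤ 21384 * L ^ 2 * Z * D * σ ^ s := by
  have hδ := h.hδ
  have hlam : 0 < lam := h.hδ.trans_le h.hδl
  have hZ1 := h.hZ1
  have hσ0 := h.hσ0
  have e1 : (F2.card : ℝ) ≤ (Om.image Prod.fst).card * (2 * D * (5346 * Z * σ ^ s * M)) := by
    rw [Finset.card_eq_sum_card_fiberwise (s := F2) (t := Om.image Prod.fst) (f := Prod.fst) (fun x hx => Finset.mem_image_of_mem _ (h.sub hx))]
    push_cast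
    rw [← nsmul_eq_mul]
    refine Finset.sum_le_card_nsmul _ _ _ ?_
    intro p hp
    set A := F2.filter (fun ω => ω.1 = p) with hA
    rcases A.eq_empty_or_nonempty with he | ⟨ω0, hω0⟩
    · rw [he]; simp; positivity
    obtain ⟨hω0F, hω0p⟩ := Finset.mem_filter.1 hω0
    have hcube : ∀ ω ∈ A, (π ω).1 = (π ω0).1 := by
      intro ω hω
      obtain ⟨hωF, hωp⟩ := Finset.mem_filter.1 hω
      have f1 := (mem_cube_iff lam hlam _ _).1 ((h.par ω hωF).2.2.1 (cubeCtr_mem δ hδ ω.1))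
      have f2 := (mem_cube_iff lam hlam _ _).1 ((h.par ω0 hω0F).2.2.1 (cubeCtr_mem δ hδ ω0.1))
      rw [← f1, ← f2, hωp, hω0p]
    rw [Finset.card_eq_sum_card_fiberwise (s := A) (t := (F2.image π).filter (fun v => v.1 = (π ω0).1)) (f := π)
      (fun ω hω => Finset.mem_coe.2 (Finset.mem_filter.2 ⟨Finset.mem_image_of_mem _ (Finset.mem_filter.1 hω).1, hcube ω hω⟩))]
    push_cast
    refine (Finset.sum_le_card_nsmul _ _ (5346 * Z * σ ^ s * M) ?_).trans ?_
    · intro v hv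
      refine h.fib p v hp _ ?_ ?_
      · intro ω hω
        obtain ⟨a, b⟩ := Finset.mem_filter.1 (Finset.mem_filter.1 hω).1
        exact Finset.mem_filter.2 ⟨h.sub a, b⟩
      · intro ω hω
        obtain ⟨a, b⟩ := Finset.mem_filter.1 hω
        rw [← b]; exact h.par ω (Finset.mem_filter.1 a).1
    · rw [nsmul_eq_mul]
      have := (hr.d1 ω0 hω0F).2.le
      rify at this
      gcongr
  have e6 := h.big
  have e7 := h.fM
  rify at e6 e7
  have hF : (0:ℝ) < F2.card := by exact_mod_cast Finset.card_pos.2 h.ne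
  have : F2.card * (1:ℝ) ≤ F2.card * (21384 * L ^ 2 * Z * D * σ ^ s) := by
    calc F2.card * (1:ℝ) = F2.card := by ring
      _ ≤ _ := e1
      _ = 10692 * Z * σ ^ s * D * (((Om.image Prod.fst).card : ℝ) * M) := by ring
      _ = 10692 * Z * σ ^ s * D * Om.card := by rw [← e7]
      _ ≤ 10692 * Z * σ ^ s * D * (2 * L ^ 2 * F2.card) := by gcongr
      _ = _ := by ring
  exact le_of_mul_le_mul_left this hF


theorem num2 (Z D N n n' W V T Sg Lm m : ℝ) (hZ : 6144 * 259 ^ 7 ≤ Z) (hD : 0 < D) (hN : 0 < N) (hn : 0 < n)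
    (hT : 0 < T) (hSg : 0 < Sg) (hW0 : 0 ≤ W) (hV0 : 0 ≤ V) (hm0 : 0 ≤ m) (hn0 : 0 ≤ n') (hLm : 0 < Lm)
    (hW : N * D ≤ Z * W) (hV : V ≤ N) (hn' : n' ≤ Z * n) (hm : m ≤ Z) (hc : 1 ≤ Z ^ 4 * D * Sg) (hd : T * Sg ^ 2 ≤ 4 * Lm)
    (h : (W * n) ^ 3 ≤ 3072 * (259 * Z ^ 2) ^ 7 * m ^ 2 * V ^ 3 * (Z ^ 5 * T * N) * (2 * D) * n' ^ 2) :
    n ≤ Z ^ 36 * Lm * N := by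
  have hZ0 : 0 < Z := lt_of_lt_of_le (by norm_num) hZ
  have k1 : (N ^ 3 * D * n ^ 2) * (D ^ 2 * n) ≤ (N ^ 3 * D * n ^ 2) * (Z ^ 27 * N * T) := by
    calc (N ^ 3 * D * n ^ 2) * (D ^ 2 * n) = ((N * D) * n) ^ 3 := by ring
      _ ≤ ((Z * W) * n) ^ 3 := by gcongr
      _ = Z ^ 3 * (W * n) ^ 3 := by ring
      _ ≤ Z ^ 3 * (3072 * (259 * Z ^ 2) ^ 7 * m ^ 2 * V ^ 3 * (Z ^ 5 * T * N) * (2 * D) * n' ^ 2) := by gcongr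
      _ ≤ Z ^ 3 * (3072 * (259 * Z ^ 2) ^ 7 * Z ^ 2 * N ^ 3 * (Z ^ 5 * T * N) * (2 * D) * (Z * n) ^ 2) := by gcongr
      _ = (6144 * 259 ^ 7) * (Z ^ 26 * N ^ 4 * T * D * n ^ 2) := by ring
      _ ≤ Z * (Z ^ 26 * N ^ 4 * T * D * n ^ 2) := by gcongr
      _ = _ := by ring
  have k2 : D ^ 2 * n ≤ Z ^ 27 * N * T := le_of_mul_le_mul_left k1 (by positivity)
  have k3 : 1 ≤ (Z ^ 4 * D * Sg) ^ 2 := one_le_pow₀ hc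
  have h4 : 4 ≤ Z := le_trans (by norm_num) hZ
  calc n = n * 1 := by ring
    _ ≤ n * (Z ^ 4 * D * Sg) ^ 2 := by gcongr
    _ = Z ^ 8 * Sg ^ 2 * (D ^ 2 * n) := by ring
    _ ≤ Z ^ 8 * Sg ^ 2 * (Z ^ 27 * N * T) := by gcongr
    _ = Z ^ 35 * N * (T * Sg ^ 2) := by ring
    _ ≤ Z ^ 35 * N * (4 * Lm) := by gcongr
    _ ≤ Z ^ 35 * N * (Z * Lm) := by gcongr
    _ = _ := by ring

theorem num1 (Z D N n n' W V T Sg Lm mm : ℝ) (hZ : 6144 * 259 ^ 7 ≤ Z) (hD : 0 < D) (hN : 0 < N) (hn : 0 < n)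
    (hT : 0 < T) (hSg : 0 < Sg) (hn0 : 0 ≤ n') (hLm : 0 < Lm)
    (hW : N * D ≤ Z * W) (hV : V ≤ N) (hn' : n' ≤ Z * n) (hc : 1 ≤ Z ^ 4 * D * Sg) (hd : T * Sg ^ 2 ≤ 4 * Lm)
    (h : W * n ≤ 4 * (259 * Z ^ 2) ^ 3 * V * n') (hmm : mm ≤ (Z ^ 5 * T * N) * (2 * (28 * Z) + 3)) (hmn : n ≤ mm) :
    n ≤ Z ^ 36 * Lm * N := by
  have hZ0 : 0 < Z := lt_of_lt_of_le (by norm_num) hZ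
  have h4 : 4 ≤ Z := le_trans (by norm_num) hZ
  have h59 : 59 ≤ Z := le_trans (by norm_num) hZ
  have k1 : (N * n) * D ≤ (N * n) * Z ^ 9 := by
    calc (N * n) * D = (N * D) * n := by ring
      _ ≤ (Z * W) * n := by gcongr
      _ = Z * (W * n) := by ring
      _ ≤ Z * (4 * (259 * Z ^ 2) ^ 3 * V * n') := by gcongr
      _ ≤ Z * (4 * (259 * Z ^ 2) ^ 3 * N * (Z * n)) := by gcongr
      _ = (4 * 259 ^ 3) * (Z ^ 8 * N * n) := by ring
      _ ≤ Z * (Z ^ 8 * N * n) := by gcongr; exact le_trans (by norm_num) hZ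
      _ = _ := by ring
  have k2 : D ≤ Z ^ 9 := le_of_mul_le_mul_left k1 (by positivity)
  have k3 : 1 ≤ (Z ^ 4 * D * Sg) ^ 2 := one_le_pow₀ hc
  have k4 : 2 * (28 * Z) + 3 ≤ Z ^ 2 := by nlinarith
  calc n ≤ (Z ^ 5 * T * N) * (2 * (28 * Z) + 3) := hmn.trans hmm
    _ ≤ (Z ^ 5 * T * N) * Z ^ 2 := by gcongr
    _ = (Z ^ 5 * T * N) * Z ^ 2 * 1 := by ring
    _ ≤ (Z ^ 5 * T * N) * Z ^ 2 * (Z ^ 4 * D * Sg) ^ 2 := by gcongr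
    _ = Z ^ 15 * N * D ^ 2 * (T * Sg ^ 2) := by ring
    _ ≤ Z ^ 15 * N * (Z ^ 9) ^ 2 * (4 * Lm) := by gcongr
    _ ≤ Z ^ 15 * N * (Z ^ 9) ^ 2 * (Z * Lm) := by gcongr
    _ = Z ^ 34 * (Lm * N) := by ring
    _ ≤ Z ^ 36 * (Lm * N) := by gcongr <;> linarith
    _ = _ := by ring

open Classical in
theorem stop_lemma (δ lam t σ s Z : ℝ) (Om F2 : Finset DPair) (π : DPair → DPair) (L M μ D : ℕ)
    (h : Conf δ lam t σ s Z Om F2 π L M) (hr : Reg F2 π μ D) (m : ℕ) (hσ : σ = ((2:ℝ) ^ m)⁻¹)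
    (hσ1 : lam ≤ t * σ ^ 2) (hσ2 : t * σ ^ 2 ≤ 4 * lam) (hls : lam ≤ σ) (hsm : 1000 * Z ^ 2 * lam ≤ t)
    (hZ : 6144 * 259 ^ 7 ≤ Z) (hLZ : L ≤ Z) (hmZ : m ≤ Z) (J : ℕ) (hJ : 4 * 2 ^ J ≤ Z) (n n' : ℝ) (hn : 0 < n) (hn'n : n' ≤ Z * n)
    (hn0 : 0 ≤ n')
    (hbig : Z ^ 36 * lam ^ s * ((F2.image π).image Prod.fst).card < n)
    (S : Finset DPair) (hS : S ⊆ F2) (hcard : F2.card ≤ 2 ^ J * S.card)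
    (hm' : ∀ ω ∈ S, (((S.image π).filter (fun w => RR Z lam t σ (π ω) w)).card : ℝ) ≤ n') :
    2 * (S.filter (fun ω => n < (((S.image π).filter (fun w => RR Z lam t σ (π ω) w)).card : ℝ))).card ≤ S.card := by
  by_contra hcon
  push Not at hcon
  set B := S.filter (fun ω => n < (((S.image π).filter (fun w => RR Z lam t σ (π ω) w)).card : ℝ)) with hB
  have hδ := h.hδ
  have hδl := h.hδl
  have hlt := h.hlt
  have hlam : 0 < lam := by linarith
  have ht : 0 < t := by linarith
  have hZ0 : 0 < Z := lt_of_lt_of_le (by norm_num) hZ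
  have hσ0 := h.hσ0
  have hBS : B ⊆ S := Finset.filter_subset _ _
  set N := ((F2.image π).image Prod.fst).card with hNdef
  have hN : 0 < N := Finset.card_pos.2 ((h.ne.image _).image _)
  have hWV : B.image π ⊆ S.image π := Finset.image_subset_image hBS
  have hVV : S.image π ⊆ F2.image π := Finset.image_subset_image hS
  have hVN : ((S.image π).image Prod.fst).card ≤ N := Finset.card_le_card (Finset.image_subset_image hVV)
  -- the lower bound on W
  have w1 := hr.lower _ subset_rfl
  have w2 := Finset.card_filter_le F2 (fun ω => (π ω).1 ∈ (F2.image π).image Prod.fst)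
  have w3 := hr.bad B (hBS.trans hS)
  have w4 : N * D ≤ 4 * 2 ^ J * (B.image π).card := by
    have : μ * (N * D) ≤ μ * (4 * 2 ^ J * (B.image π).card) := by
      calc μ * (N * D) = μ * (D * N) := by ring
        _ ≤ F2.card := w1.trans w2
        _ ≤ 2 ^ J * S.card := hcard
        _ ≤ 2 ^ J * (2 * B.card) := Nat.mul_le_mul_left _ hcon.le
        _ ≤ 2 ^ J * (2 * (2 * μ * (B.image π).card)) := by gcongr
        _ = _ := by ring
    exact Nat.le_of_mul_le_mul_left this hr.hμ
  have hW : (N * D : ℝ) ≤ Z * (B.image π).card := by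
    rify at w4
    exact w4.trans (by gcongr)
  have hc : 1 ≤ Z ^ 4 * D * σ ^ s := by
    refine (h.dlow hr).trans ?_
    have : 21384 * (L:ℝ) ^ 2 * Z ≤ Z * Z ^ 2 * Z := by
      gcongr
      exact le_trans (by norm_num) hZ
    calc 21384 * (L:ℝ) ^ 2 * Z * D * σ ^ s ≤ (Z * Z ^ 2 * Z) * D * σ ^ s := by gcongr
      _ = _ := by ring
  have hd : t ^ s * (σ ^ s) ^ 2 ≤ 4 * lam ^ s := by
    calc t ^ s * (σ ^ s) ^ 2 = (t * σ ^ 2) ^ s := by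
          rw [Real.mul_rpow ht.le (by positivity), ← Real.rpow_natCast, ← Real.rpow_natCast, ← Real.rpow_mul hσ0.le, ← Real.rpow_mul hσ0.le, mul_comm s]
      _ ≤ (4 * lam) ^ s := Real.rpow_le_rpow (by positivity) hσ2 h.hs0.le
      _ ≤ 4 * lam ^ s := rpow_mul_le 4 lam s (by norm_num) hlam h.hs0 h.hs1
  have c4 : ∀ p ∈ (S.image π).image Prod.fst, ((((S.image π).image Prod.fst).filter
      (fun p' => pdist (cubeCtr lam p) (cubeCtr lam p') ≤ 4 * (Z * t))).card : ℝ) ≤ Z ^ 5 * t ^ s * N := by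
    intro p hp
    refine (h.nt hr p _ ((Finset.filter_subset _ _).trans (Finset.image_subset_image hVV)) (fun p' hp' => (Finset.mem_filter.1 hp').2)).trans ?_
    have : 96 * (L:ℝ) ^ 2 * Z ^ 2 ≤ Z * Z ^ 2 * Z ^ 2 := by
      gcongr
      exact le_trans (by norm_num) hZ
    calc _ ≤ (Z * Z ^ 2 * Z ^ 2) * t ^ s * N := by gcongr
      _ = _ := by ring
  have hZ1 := h.hZ1
  have hV1 : ∀ v ∈ S.image π, cubeSet lam v.1 ⊆ domD := by
    intro v hv
    obtain ⟨ω, hω, rfl⟩ := Finset.mem_image.1 hv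
    exact (h.par ω (hS hω)).1
  have hV2 : ∀ v ∈ S.image π, 0 ≤ v.2 ∧ v.2 < 2 ^ m := by
    intro v hv
    obtain ⟨ω, hω, rfl⟩ := Finset.mem_image.1 hv
    exact (valid_iff m σ hσ _).1 (h.par ω (hS hω)).2.1
  have hcore := core2 lam t σ Z hZ1 hlam ht h.ht1 m hσ hσ1 hσ2 hls hsm (S.image π) (B.image π) hWV hV1 hV2
    (2 * D) n n' (Z ^ 5 * t ^ s * N) (by positivity) hn.le hn0 (by positivity) c4
    (by
      intro p hp
      obtain ⟨v, hv, rfl⟩ := Finset.mem_image.1 hp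
      obtain ⟨ω, hω, rfl⟩ := Finset.mem_image.1 hv
      have := (Finset.card_le_card (Finset.filter_subset_filter (fun v => v.1 = (π ω).1) hVV)).trans (hr.d1 ω (hS hω)).2.le
      rify at this; exact this)
    (by
      intro v hv
      obtain ⟨ω, hω, rfl⟩ := Finset.mem_image.1 hv
      exact hm' ω hω)
    (by
      intro v hv
      obtain ⟨ω, hω, rfl⟩ := Finset.mem_image.1 hv
      exact (Finset.mem_filter.1 hω).2.le)
  have hDpos : (0:ℝ) < D := by exact_mod_cast hr.hD
  have hNpos : (0:ℝ) < N := by exact_mod_cast hN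
  have hVN' : (((S.image π).image Prod.fst).card : ℝ) ≤ N := by exact_mod_cast hVN
  have hfin : n ≤ Z ^ 36 * lam ^ s * N := by
    rcases hcore with hcore | hcore
    · have hBpos : 0 < B.card := by omega
      obtain ⟨ω, hω⟩ := Finset.card_pos.1 hBpos
      have htr := triv_mult lam t σ Z hZ1 ht (S.image π)
        (fun v => (Finset.Ico (0:ℤ) (2 ^ m)).filter (fun i => dist (dir (ang σ v.2)) (dir (ang σ i)) ≤ (28 * Z) * σ))
        (2 * (28 * Z) + 3) (fun v hv => near_count m σ (28 * Z) hσ (by positivity) v.2 (hV2 v hv))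
        (Z ^ 5 * t ^ s * N) (by
          intro v hv w hw hR
          refine Finset.mem_filter.2 ⟨Finset.mem_Ico.2 (hV2 w hw), ?_⟩
          exact (geoC lam t σ Z hZ1 hlam ht h.ht1 hσ0 hσ1 hσ2 hls hsm v w (hV1 v hv) (hV1 w hw) hR _ rfl).2.2) c4 (π ω)
          (Finset.mem_image_of_mem _ (hBS hω))
      exact num1 Z D N n n' (B.image π).card ((S.image π).image Prod.fst).card (t ^ s) (σ ^ s) (lam ^ s) _
        hZ hDpos hNpos hn (by positivity) (by positivity) hn0 (by positivity) hW hVN' hn'n hc hd hcore htr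
        (Finset.mem_filter.1 hω).2.le
    · exact num2 Z D N n n' (B.image π).card ((S.image π).image Prod.fst).card (t ^ s) (σ ^ s) (lam ^ s) m
        hZ hDpos hNpos hn (by positivity) (by positivity) (by positivity) (by positivity) (by positivity) hn0 (by positivity) hW hVN' hn'n hmZ hc hd hcore
  linarith


open Classical in
theorem nonmain (δ lam t σ s Z : ℝ) (Om F2 : Finset DPair) (π : DPair → DPair) (L M μ D : ℕ)
    (h : Conf δ lam t σ s Z Om F2 π L M) (hr : Reg F2 π μ D) (m : ℕ) (hσ : σ = ((2:ℝ) ^ m)⁻¹)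
    (hσ1 : lam ≤ t * σ ^ 2) (hsm : t < 1000 * Z ^ 2 * lam)
    (hZ : 6144 * 259 ^ 7 ≤ Z) (hLZ : L ≤ Z) :
    ∀ ω ∈ F2, (((F2.image π).filter (fun w => RR Z lam t σ (π ω) w)).card : ℝ) ≤
      Z ^ 37 * lam ^ s * ((F2.image π).image Prod.fst).card := by
  have hδ := h.hδ
  have hδl := h.hδl
  have hlt := h.hlt
  have hlam : 0 < lam := by linarith
  have ht : 0 < t := by linarith
  have hZ0 : 0 < Z := lt_of_lt_of_le (by norm_num) hZ
  have hZ1 := h.hZ1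
  have hσ0 := h.hσ0
  set N := ((F2.image π).image Prod.fst).card with hNdef
  have c4 : ∀ p ∈ (F2.image π).image Prod.fst, ((((F2.image π).image Prod.fst).filter
      (fun p' => pdist (cubeCtr lam p) (cubeCtr lam p') ≤ 4 * (Z * t))).card : ℝ) ≤ Z ^ 5 * t ^ s * N := by
    intro p hp
    refine (h.nt hr p _ (Finset.filter_subset _ _) (fun p' hp' => (Finset.mem_filter.1 hp').2)).trans ?_
    have : 96 * (L:ℝ) ^ 2 * Z ^ 2 ≤ Z * Z ^ 2 * Z ^ 2 := by
      gcongr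
      exact le_trans (by norm_num) hZ
    calc _ ≤ (Z * Z ^ 2 * Z ^ 2) * t ^ s * N := by gcongr
      _ = _ := by ring
  have hZk : 1000 ≤ Z := le_trans (by norm_num) hZ
  have hσle : σ ≤ 1 := by
    rw [hσ]; exact inv_le_one_of_one_le₀ (one_le_pow₀ (by norm_num))
  have hinv : ((2:ℝ) ^ m) ≤ Z ^ 3 := by
    have e : (2:ℝ) ^ m = σ⁻¹ := by rw [hσ, inv_inv]
    rw [e, inv_le_comm₀ hσ0 (by positivity)]
    have h1 : t * 1 ≤ t * (1000 * Z ^ 2 * σ ^ 2) := by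
      calc t * 1 ≤ 1000 * Z ^ 2 * lam := by linarith
        _ ≤ 1000 * Z ^ 2 * (t * σ ^ 2) := by gcongr
        _ = _ := by ring
    have h2 := le_of_mul_le_mul_left h1 ht
    rw [inv_le_iff_one_le_mul₀' (by positivity)]
    calc 1 ≤ 1000 * Z ^ 2 * σ ^ 2 := h2
      _ ≤ Z * Z ^ 2 * (σ * 1) := by rw [sq σ]; gcongr
      _ = _ := by ring
  have hts : t ^ s ≤ Z ^ 3 * lam ^ s := by
    calc t ^ s ≤ (1000 * Z ^ 2 * lam) ^ s := Real.rpow_le_rpow ht.le hsm.le h.hs0.le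
      _ ≤ 1000 * Z ^ 2 * lam ^ s := rpow_mul_le _ _ _ (by nlinarith) hlam h.hs0 h.hs1
      _ ≤ Z * Z ^ 2 * lam ^ s := by gcongr
      _ = _ := by ring
  have htr := triv_mult lam t σ Z hZ1 ht (F2.image π) (fun _ => Finset.Ico (0:ℤ) (2 ^ m)) (2 ^ m)
    (by
      intro v _
      have e : ((2:ℤ)^m).toNat = 2^m := by
        have : ((2:ℤ)^m) = ((2^m : ℕ):ℤ) := by push_cast; rfl
        rw [this, Int.toNat_natCast]
      rw [Int.card_Ico, sub_zero, e]; push_cast; exact le_rfl) (Z ^ 5 * t ^ s * N) (by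
      intro v hv w hw _
      obtain ⟨ω, hω, rfl⟩ := Finset.mem_image.1 hw
      exact Finset.mem_Ico.2 ((valid_iff m σ hσ _).1 (h.par ω hω).2.1)) c4
  intro ω hω
  refine (htr (π ω) (Finset.mem_image_of_mem _ hω)).trans ?_
  calc Z ^ 5 * t ^ s * N * 2 ^ m ≤ Z ^ 5 * (Z ^ 3 * lam ^ s) * N * Z ^ 3 := by gcongr
    _ = Z ^ 11 * (lam ^ s * N) := by ring
    _ ≤ Z ^ 37 * (lam ^ s * N) := by gcongr <;> norm_num
    _ = _ := by ring

open Classical in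
theorem select (δ lam t σ s Z : ℝ) (Om F : Finset DPair) (π : DPair → DPair) (L M : ℕ) (hL : 0 < L)
    (hF : F ⊆ Om) (hOF : Om.card ≤ 2 * F.card) (hOne : Om.Nonempty) (hOL : Om.card < 2 ^ L)
    (h : ∀ F2 ⊆ F, F2.Nonempty → Om.card ≤ 2 * L ^ 2 * F2.card → Conf δ lam t σ s Z Om F2 π L M)
    (m : ℕ) (hσ : σ = ((2:ℝ) ^ m)⁻¹)
    (hσ1 : lam ≤ t * σ ^ 2) (hσ2 : t * σ ^ 2 ≤ 4 * lam) (hls : lam ≤ σ)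
    (hZ : 6144 * 259 ^ 7 ≤ Z) (hLZ : L ≤ Z) (hmZ : m ≤ Z) (J : ℕ) (hJ : 4 * 2 ^ J ≤ Z)
    (Tgt : ℝ) (hT : Z ^ 37 * lam ^ s * ((F.image π).image Prod.fst).card ≤ Tgt) (hTB : Om.card ≤ Z ^ J * Tgt) :
    ∃ S ⊆ F, Om.card ≤ 2 * L ^ 2 * 2 ^ J * S.card ∧
      ∀ ω ∈ S, (((S.image π).filter (fun w => RR Z lam t σ (π ω) w)).card : ℝ) ≤ Tgt := by
  obtain ⟨F2, hF2, μ, D, hμ, hD, hc, hm1, hd1⟩ := regularize F π L hL ((Finset.card_le_card hF).trans_lt hOL)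
  have hr : Reg F2 π μ D := ⟨hμ, hD, hm1, hd1⟩
  have hc2 : Om.card ≤ 2 * L ^ 2 * F2.card := by
    calc Om.card ≤ 2 * F.card := hOF
      _ ≤ 2 * (L ^ 2 * F2.card) := Nat.mul_le_mul_left _ hc
      _ = _ := by ring
  have hF2ne : F2.Nonempty := by
    rw [← Finset.card_pos]
    have := Finset.card_pos.2 hOne
    by_contra hh
    rw [show F2.card = 0 by omega] at hc2; omega
  have hC := h F2 hF2 hF2ne hc2
  have hlam : 0 < lam := hC.hδ.trans_le hC.hδl
  have hZ0 : 0 < Z := lt_of_lt_of_le (by norm_num) hZ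
  have hZ1 : 1 < Z := lt_of_lt_of_le (by norm_num) hZ
  have hNN : (((F2.image π).image Prod.fst).card : ℝ) ≤ ((F.image π).image Prod.fst).card := by
    exact_mod_cast Finset.card_le_card (Finset.image_subset_image (Finset.image_subset_image hF2))
  have hT2 : Z ^ 37 * lam ^ s * ((F2.image π).image Prod.fst).card ≤ Tgt := le_trans (by gcongr) hT
  have hNpos : (0:ℝ) < ((F2.image π).image Prod.fst).card := by
    exact_mod_cast Finset.card_pos.2 ((hF2ne.image _).image _)
  have hX : 0 < Z ^ 36 * lam ^ s * ((F2.image π).image Prod.fst).card := by positivity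
  have hT3 : Z ^ 36 * lam ^ s * ((F2.image π).image Prod.fst).card < Tgt := by
    refine lt_of_lt_of_le ?_ hT2
    rw [show Z ^ 37 * lam ^ s * ((F2.image π).image Prod.fst).card = Z * (Z ^ 36 * lam ^ s * ((F2.image π).image Prod.fst).card) by ring]
    nlinarith
  have hT0 : 0 < Tgt := hX.trans hT3
  by_cases hsm : 1000 * Z ^ 2 * lam ≤ t
  · obtain ⟨S, hS, hSc, hSm⟩ := iter F2 (fun S ω => (((S.image π).filter (fun w => RR Z lam t σ (π ω) w)).card : ℝ))
      (fun j => max Tgt (Om.card / Z ^ j)) J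
      (by
        intro S T hST ω
        exact_mod_cast Finset.card_le_card (Finset.filter_subset_filter _ (Finset.image_subset_image hST)))
      (by
        intro ω hω
        refine le_trans ?_ (le_max_right _ _)
        rw [pow_zero, div_one]
        exact_mod_cast (Finset.card_filter_le _ _).trans (Finset.card_image_le.trans (Finset.card_le_card (hF2.trans hF))))
      (by
        intro j hj S hS hSc hm
        refine stop_lemma δ lam t σ s Z Om F2 π L M μ D hC hr m hσ hσ1 hσ2 hls hsm hZ hLZ hmZ J hJ
          (max Tgt (Om.card / Z ^ (j + 1))) (max Tgt (Om.card / Z ^ j)) (lt_max_of_lt_left hT0) ?_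
          (le_max_of_le_left hT0.le) (lt_max_of_lt_left hT3) S hS ?_ hm
        · apply max_le
          · have := le_max_left Tgt (Om.card / Z ^ (j + 1))
            nlinarith
          · have := le_max_right Tgt (Om.card / Z ^ (j + 1))
            calc (Om.card : ℝ) / Z ^ j = Z * (Om.card / Z ^ (j + 1)) := by rw [pow_succ]; field_simp
              _ ≤ _ := by gcongr
        · exact hSc.trans (Nat.mul_le_mul_right _ (Nat.pow_le_pow_right (by norm_num) hj.le)))
    refine ⟨S, hS.trans hF2, ?_, ?_⟩
    · calc Om.card ≤ 2 * L ^ 2 * F2.card := hc2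
        _ ≤ 2 * L ^ 2 * (2 ^ J * S.card) := Nat.mul_le_mul_left _ hSc
        _ = _ := by ring
    · intro ω hω
      have e : max Tgt (Om.card / Z ^ J) = Tgt := by
        apply max_eq_left
        rw [div_le_iff₀ (by positivity)]; linarith
      have := hSm ω hω
      rw [e] at this
      exact this
  · push Not at hsm
    refine ⟨F2, hF2, ?_, ?_⟩
    · calc Om.card ≤ 2 * L ^ 2 * F2.card := hc2
        _ = 2 * L ^ 2 * 1 * F2.card := by ring
        _ ≤ _ := by gcongr; exact Nat.one_le_two_pow
    · intro ω hω
      exact (nonmain δ lam t σ s Z Om F2 π L M μ D hC hr m hσ hσ1 hsm hZ hLZ ω hω).trans hT2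


def fE (Om : Finset DPair) (k : CubeIdx) : Finset ℤ := (Om.filter (fun ω => ω.1 = k)).image Prod.snd

theorem mem_fE (Om : Finset DPair) (k : CubeIdx) (j : ℤ) : j ∈ fE Om k ↔ (k, j) ∈ Om := by
  simp only [fE, Finset.mem_image, Finset.mem_filter]
  constructor
  · rintro ⟨⟨a, b⟩, ⟨h1, h2⟩, h3⟩
    dsimp only at h2 h3
    rw [← h2, ← h3]; exact h1
  · intro h; exact ⟨_, ⟨h, rfl⟩, rfl⟩

theorem coe_fE (Om : Finset DPair) (k : CubeIdx) : configE (Om : Set DPair) k = (fE Om k : Set ℤ) := by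
  ext j
  rw [Finset.mem_coe, mem_fE]; rfl

theorem card_fE (Om : Finset DPair) (k : CubeIdx) : (fE Om k).card = (Om.filter (fun ω => ω.1 = k)).card := by
  apply Finset.card_image_of_injOn
  rintro ⟨a, b⟩ h ⟨c, d⟩ h' e
  have h1 := (Finset.mem_filter.1 (Finset.mem_coe.1 h)).2
  have h2 := (Finset.mem_filter.1 (Finset.mem_coe.1 h')).2
  dsimp only at h1 h2 e
  rw [h1, h2, e]

theorem coe_cP (Om : Finset DPair) : configP (Om : Set DPair) = ((Om.image Prod.fst : Finset CubeIdx) : Set CubeIdx) := by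
  rw [configP, Finset.coe_image]

theorem count3_fin (δ : ℝ) (hδ : 0 < δ) (A : Finset CubeIdx) :
    count3 δ (⋃ k ∈ (A : Set CubeIdx), cubeSet δ k) = A.card := by
  rw [count3, idx3_union δ hδ, Nat.card_coe_set_eq, Set.ncard_coe_finset]

/-- ball bound for cubes -/
theorem ball3 (δ s C : ℝ) (hδ : 0 < δ) (P : Finset CubeIdx)
    (h : IsDSet3 δ s C (⋃ k ∈ (P : Set CubeIdx), cubeSet δ k)) (x : Param) (r : ℝ) (hr : δ ≤ r)
    (A : Finset CubeIdx) (hA : A ⊆ P) (hx : ∀ k ∈ A, pdist (cubeCtr δ k) x ≤ r) :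
    (A.card : ℝ) ≤ C * r ^ s * P.card := by
  have h1 := h.2 x r hr
  rw [count3_fin δ hδ] at h1
  refine le_trans ?_ h1
  have hf : (idx3 δ '' ((⋃ k ∈ (P : Set CubeIdx), cubeSet δ k) ∩ {q | pdist q x ≤ r})).Finite := by
    refine Set.Finite.subset (Finset.finite_toSet P) ?_
    refine (image_mono inter_subset_left).trans ?_
    rw [idx3_union δ hδ]
  have h2 : (A : Set CubeIdx) ⊆ idx3 δ '' ((⋃ k ∈ (P : Set CubeIdx), cubeSet δ k) ∩ {q | pdist q x ≤ r}) := by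
    intro k hk
    refine ⟨cubeCtr δ k, ⟨mem_biUnion (hA hk) (cubeCtr_mem δ hδ k), hx k hk⟩, idx3_ctr δ hδ k⟩
  have h3 := Nat.card_mono hf h2
  rw [Nat.card_coe_set_eq, Set.ncard_coe_finset] at h3
  exact_mod_cast h3

theorem sub3 (δ s c C : ℝ) (hδ : 0 < δ) (hc : 0 ≤ c) (P P' : Finset CubeIdx) (hP : P' ⊆ P)
    (hcard : (P.card : ℝ) ≤ C * P'.card)
    (h : IsDSet3 δ s c (⋃ k ∈ (P : Set CubeIdx), cubeSet δ k)) :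
    IsDSet3 δ s (C * c) (⋃ k ∈ (P' : Set CubeIdx), cubeSet δ k) := by
  have hsub : (⋃ k ∈ (P' : Set CubeIdx), cubeSet δ k) ⊆ (⋃ k ∈ (P : Set CubeIdx), cubeSet δ k) :=
    biUnion_subset_biUnion_left (by exact_mod_cast hP)
  refine ⟨h.1.subset hsub, fun x r hr => ?_⟩
  have h1 := h.2 x r hr
  rw [count3_fin δ hδ] at h1 ⊢
  have hf : (idx3 δ '' ((⋃ k ∈ (P : Set CubeIdx), cubeSet δ k) ∩ {q | pdist q x ≤ r})).Finite := by
    refine Set.Finite.subset (Finset.finite_toSet P) ?_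
    refine (image_mono inter_subset_left).trans ?_
    rw [idx3_union δ hδ]
  have h2 : (count3 δ ((⋃ k ∈ (P' : Set CubeIdx), cubeSet δ k) ∩ {q | pdist q x ≤ r}) : ℝ) ≤
      count3 δ ((⋃ k ∈ (P : Set CubeIdx), cubeSet δ k) ∩ {q | pdist q x ≤ r}) := by
    exact_mod_cast Nat.card_mono hf (image_mono (inter_subset_inter_left _ hsub))
  have hr0 : 0 < r := hδ.trans_le hr
  calc _ ≤ _ := h2
    _ ≤ c * r ^ s * P.card := h1
    _ ≤ c * r ^ s * (C * P'.card) := by gcongr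
    _ = _ := by ring

theorem sub2 (δ s c C : ℝ) (hδ : 0 < δ) (hc : 0 ≤ c) (hC : 0 ≤ C) (p : Param) (hp0 : 1 / 2 ≤ p.2) (hp : p.2 ≤ 1)
    (A B : Finset ℤ) (hAB : B ⊆ A) (hA : ∀ j ∈ A, validArc δ j) (hcard : (A.card : ℝ) ≤ C * B.card)
    (h : IsDSet2 δ s c (⋃ k ∈ (A : Set ℤ), arcSet p δ k)) :
    IsDSet2 δ s (891 * C * c) (⋃ k ∈ (B : Set ℤ), arcSet p δ k) := by
  have hsub : (⋃ k ∈ (B : Set ℤ), arcSet p δ k) ⊆ (⋃ k ∈ (A : Set ℤ), arcSet p δ k) :=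
    biUnion_subset_biUnion_left (by exact_mod_cast hAB)
  refine ⟨h.1.subset hsub, fun x r hr => ?_⟩
  have h1 := h.2 x r hr
  have hf : (idx2 δ '' ((⋃ k ∈ (A : Set ℤ), arcSet p δ k) ∩ closedBall x r)).Finite :=
    (union_fin δ hδ p (by linarith) hp A).subset (image_mono inter_subset_left)
  have h2 : (count2 δ ((⋃ k ∈ (B : Set ℤ), arcSet p δ k) ∩ closedBall x r) : ℝ) ≤
      count2 δ ((⋃ k ∈ (A : Set ℤ), arcSet p δ k) ∩ closedBall x r) := by
    exact_mod_cast Nat.card_mono hf (image_mono (inter_subset_inter_left _ hsub))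
  have h3 : (count2 δ (⋃ k ∈ (A : Set ℤ), arcSet p δ k) : ℝ) ≤ 81 * A.card := by
    exact_mod_cast count2_le δ hδ p (by linarith) hp A
  have h4 : (B.card : ℝ) ≤ 11 * count2 δ (⋃ k ∈ (B : Set ℤ), arcSet p δ k) := by
    have := le_count2 δ hδ p hp0 hp B B (Finset.Subset.refl _) (fun j hj => hA j (hAB hj)) univ (fun _ _ => mem_univ _)
    rw [inter_univ] at this
    exact_mod_cast this
  have hr0 : 0 < r := hδ.trans_le hr
  calc _ ≤ _ := h2
    _ ≤ c * r ^ s * count2 δ (⋃ k ∈ (A : Set ℤ), arcSet p δ k) := h1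
    _ ≤ c * r ^ s * (81 * (C * (11 * count2 δ (⋃ k ∈ (B : Set ℤ), arcSet p δ k)))) := by
        gcongr
        refine h3.trans ?_
        gcongr
        refine hcard.trans ?_
        gcongr
    _ = _ := by ring

theorem IsDSet3.mono {δ s c c' : ℝ} {E : Set Param} (hδ : 0 < δ) (hcc : c ≤ c') (h : IsDSet3 δ s c E) : IsDSet3 δ s c' E := by
  refine ⟨h.1, fun x r hr => (h.2 x r hr).trans ?_⟩
  have hr0 : 0 < r := hδ.trans_le hr
  gcongr

theorem IsDSet2.mono {δ s c c' : ℝ} {E : Set Plane} (hδ : 0 < δ) (hcc : c ≤ c') (h : IsDSet2 δ s c E) : IsDSet2 δ s c' E := by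
  refine ⟨h.1, fun x r hr => (h.2 x r hr).trans ?_⟩
  have hr0 : 0 < r := hδ.trans_le hr
  gcongr

theorem fst_mem {Om : Finset DPair} {k : CubeIdx} (hk : k ∈ Om.image Prod.fst) : k ∈ configP (Om : Set DPair) := by
  rw [coe_cP]; exact hk

theorem sub_config (δ s c : ℝ) (hδ : 0 < δ) (hc : 0 ≤ c) (M M' Q : ℕ) (Om G : Finset DPair)
    (h : IsConfigD δ δ s c M (Om : Set DPair)) (hG : G ⊆ Om) (hne : G.Nonempty) (hMM : M ≤ 2 * Q * M')
    (hfib : ∀ p ∈ G.image Prod.fst, (G.filter (fun ω => ω.1 = p)).card = M')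
    (hP : (Om.image Prod.fst).card ≤ 2 * Q * (G.image Prod.fst).card) (C : ℝ) (hC : 1782 * Q ≤ C) :
    IsConfigD δ δ s (C * c) M' (G : Set DPair) := by
  obtain ⟨h1, h2, h3, h4⟩ := h
  have hQ0 : (0:ℝ) ≤ Q := by positivity
  have hPs : G.image Prod.fst ⊆ Om.image Prod.fst := Finset.image_subset_image hG
  refine ⟨?_, ?_, ?_, ?_⟩
  · rw [coe_cP]; exact_mod_cast hne.image _
  · intro k hk
    rw [coe_cP] at hk
    exact h2 k (fst_mem (hPs hk))
  · rw [coe_cP] at h3 ⊢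
    refine sub3 δ s c C hδ hc _ _ hPs ?_ h3
    calc ((Om.image Prod.fst).card : ℝ) ≤ 2 * Q * (G.image Prod.fst).card := by exact_mod_cast hP
      _ ≤ _ := by gcongr; linarith
  · intro k hk
    rw [coe_cP] at hk
    have hkO := fst_mem (hPs hk)
    obtain ⟨a1, a2, a3⟩ := h4 k hkO
    have hd := h2 k hkO (cubeCtr_mem δ hδ k)
    rw [coe_fE] at a1 a2 a3 ⊢
    rw [Nat.card_coe_set_eq, Set.ncard_coe_finset] at a3
    have hs : fE G k ⊆ fE Om k := fun j hj => (mem_fE _ _ _).2 (hG ((mem_fE _ _ _).1 hj))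
    have hcd : (fE G k).card = M' := by rw [card_fE]; exact hfib k hk
    refine ⟨fun j hj => a1 j (hs hj), ?_, ?_⟩
    · refine (sub2 δ s c (2 * Q) hδ hc (by positivity) _ hd.2.1 hd.2.2 (fE Om k) (fE G k) hs a1 ?_ a2).mono hδ ?_
      · rw [a3, hcd]; exact_mod_cast hMM
      · gcongr; linarith
    · rw [Nat.card_coe_set_eq, Set.ncard_coe_finset, hcd]


theorem mk_conf (δ lam t σ s c Z : ℝ) (Om F2 : Finset DPair) (π : DPair → DPair) (L M : ℕ)
    (hδ : 0 < δ) (hs0 : 0 < s) (hs1 : s ≤ 1) (hδl : δ ≤ lam) (hlt : lam ≤ t) (ht1 : t ≤ 1) (hc : 0 ≤ c) (hcZ : c ≤ Z)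
    (hZ1 : 1 ≤ Z) (hσ0 : 0 < σ) (hls : lam ≤ σ)
    (hconf : IsConfigD δ δ s c M (Om : Set DPair)) (hF : F2 ⊆ Om) (hne : F2.Nonempty)
    (hbig : Om.card ≤ 2 * L ^ 2 * F2.card) (hpar : ∀ ω ∈ F2, IsPar δ lam σ ω (π ω)) :
    Conf δ lam t σ s Z Om F2 π L M := by
  obtain ⟨h1, h2, h3, h4⟩ := hconf
  have fM2 : ∀ p ∈ Om.image Prod.fst, (Om.filter (fun ω => ω.1 = p)).card = M := by
    intro p hp
    obtain ⟨_, _, a3⟩ := h4 p (fst_mem hp)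
    rw [coe_fE, Nat.card_coe_set_eq, Set.ncard_coe_finset, card_fE] at a3
    exact a3
  refine ⟨hδ, hs0, hs1, hδl, hlt, ht1, hZ1, hσ0, hF, hne, hbig, ?_, fM2, ?_, hpar, ?_, ?_⟩
  · rw [Finset.card_eq_sum_card_image Prod.fst Om, Finset.sum_congr rfl fM2, Finset.sum_const, smul_eq_mul]
  · intro ω hω
    exact h2 _ (fst_mem (Finset.mem_image_of_mem _ hω))
  · intro x r hr A hA hx
    rw [coe_cP] at h3
    have hr0 : 0 < r := hδ.trans_le hr
    refine (ball3 δ s c hδ _ h3 x r hr A hA hx).trans ?_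
    gcongr
  · intro p W hp A hA hW
    obtain ⟨a1, a2, a3⟩ := h4 p (fst_mem hp)
    have hd := h2 p (fst_mem hp)
    have hdc := hd (cubeCtr_mem δ hδ p)
    rw [coe_fE] at a1 a2 a3
    rw [Nat.card_coe_set_eq, Set.ncard_coe_finset] at a3
    have hlam : 0 < lam := hδ.trans_le hδl
    have hB : A.card = (A.image Prod.snd).card := by
      symm
      apply Finset.card_image_of_injOn
      rintro ⟨a, b⟩ h ⟨c, d⟩ h' e
      have h1 := (Finset.mem_filter.1 (hA (Finset.mem_coe.1 h))).2
      have h2 := (Finset.mem_filter.1 (hA (Finset.mem_coe.1 h'))).2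
      dsimp only at h1 h2 e
      rw [h1, h2, e]
    have hBs : A.image Prod.snd ⊆ fE Om p := Finset.image_subset_image hA
    have k1 := le_count2 δ hδ (cubeCtr δ p) hdc.2.1 hdc.2.2 (fE Om p) (A.image Prod.snd) hBs a1
      (closedBall (arcCenterAt (cubeCtr lam W.1) σ W.2) (6 * σ)) (by
        intro j hj
        obtain ⟨ω, hω, rfl⟩ := Finset.mem_image.1 hj
        have e := (Finset.mem_filter.1 (hA hω)).2
        have := par_ball δ lam σ hδ hlam hls ω W (by rw [e]; exact hd) (hW ω hω)
        rw [e] at this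
        exact this)
    have k2 := a2.2 (arcCenterAt (cubeCtr lam W.1) σ W.2) (6 * σ) (by linarith)
    have k3 := count2_le δ hδ (cubeCtr δ p) (by linarith [hdc.2.1]) hdc.2.2 (fE Om p)
    rw [a3] at k3
    have k1' : (A.card : ℝ) ≤ 11 * count2 δ ((⋃ j ∈ (fE Om p : Set ℤ), arcSet (cubeCtr δ p) δ j) ∩
        closedBall (arcCenterAt (cubeCtr lam W.1) σ W.2) (6 * σ)) := by
      rw [hB]; exact_mod_cast k1
    have k3' : (count2 δ (⋃ j ∈ (fE Om p : Set ℤ), arcSet (cubeCtr δ p) δ j) : ℝ) ≤ 81 * M := by exact_mod_cast k3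
    have k4 := rpow_mul_le 6 σ s (by norm_num) hσ0 hs0 hs1
    calc (A.card : ℝ) ≤ _ := k1'
      _ ≤ 11 * (c * (6 * σ) ^ s * count2 δ (⋃ j ∈ (fE Om p : Set ℤ), arcSet (cubeCtr δ p) δ j)) := by gcongr
      _ ≤ 11 * (Z * (6 * σ ^ s) * (81 * M)) := by gcongr
      _ = _ := by ring

theorem core (δ lam t σ s c Z : ℝ) (Om : Finset DPair) (L M : ℕ)
    (hδ : 0 < δ) (hs0 : 0 < s) (hs1 : s ≤ 1) (hδl : δ ≤ lam) (hlt : lam ≤ t) (ht1 : t ≤ 1) (hc : 0 ≤ c) (hcZ : c ≤ Z)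
    (hconf : IsConfigD δ δ s c M (Om : Set DPair)) (hL : 0 < L) (hOL : Om.card < 2 ^ L)
    (m : ℕ) (hσ : σ = ((2:ℝ) ^ m)⁻¹) (hσ1 : lam ≤ t * σ ^ 2) (hσ2 : t * σ ^ 2 ≤ 4 * lam) (hls : lam ≤ σ)
    (hZ : 6144 * 259 ^ 7 ≤ Z) (hLZ : L ≤ Z) (hmZ : m ≤ Z) (J : ℕ) (hJ : 4 * 2 ^ J ≤ Z) (Tgt : ℝ)
    (hT : Z ^ 37 * lam ^ s * count3 lam (⋃ k ∈ configP (Om : Set DPair), cubeSet δ k) ≤ Tgt)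
    (hTB : Om.card ≤ Z ^ J * Tgt) :
    ∃ S ⊆ Om, Om.card ≤ 2 * L ^ 2 * 2 ^ J * S.card ∧
      ∀ G ⊆ S, ∀ ω ∈ skeleton δ δ lam σ (G : Set DPair),
        (pMult δ δ lam σ lam t Z Z Z (G : Set DPair) (cubeCtr lam ω.1)
          (arcCenterAt (cubeCtr lam ω.1) σ ω.2) : ℝ) ≤ Tgt := by
  classical
  have hdom : ∀ ω ∈ Om, cubeSet δ ω.1 ⊆ domD := fun ω hω => hconf.2.1 _ (fst_mem (Finset.mem_image_of_mem _ hω))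
  have hlam : 0 < lam := hδ.trans_le hδl
  have hZ1 : 1 ≤ Z := le_trans (by norm_num) hZ
  have hσ0 : 0 < σ := hlam.trans_le hls
  have hOne : Om.Nonempty := by
    obtain ⟨k, ω, hω, _⟩ := hconf.1
    exact ⟨ω, hω⟩
  set F := Om.filter (fun ω => ∃ W, IsPar δ lam σ ω W) with hF
  set O := Om.filter (fun ω => ¬ ∃ W, IsPar δ lam σ ω W) with hO
  have hsum : F.card + O.card = Om.card := Finset.card_filter_add_card_filter_not _
  by_cases hcase : Om.card ≤ 2 * F.card
  · set π : DPair → DPair := fun ω => if h : ∃ W, IsPar δ lam σ ω W then h.choose else ω with hπ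
    have hpar : ∀ ω ∈ F, IsPar δ lam σ ω (π ω) := by
      intro ω hω
      have h := (Finset.mem_filter.1 hω).2
      simp only [hπ, dif_pos h]
      exact h.choose_spec
    have hFO : F ⊆ Om := Finset.filter_subset _ _
    have hN : (((F.image π).image Prod.fst).card : ℝ) ≤ count3 lam (⋃ k ∈ configP (Om : Set DPair), cubeSet δ k) := by
      have hf : (idx3 lam '' (⋃ k ∈ configP (Om : Set DPair), cubeSet δ k)).Finite := by
        refine (dom_finite lam hlam (hlt.trans ht1)).subset (image_mono ?_)
        exact iUnion₂_subset hconf.2.1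
      have h2 : (((F.image π).image Prod.fst : Finset CubeIdx) : Set CubeIdx) ⊆
          idx3 lam '' (⋃ k ∈ configP (Om : Set DPair), cubeSet δ k) := by
        intro k hk
        obtain ⟨W, hW, rfl⟩ := Finset.mem_image.1 (Finset.mem_coe.1 hk)
        obtain ⟨ω, hω, rfl⟩ := Finset.mem_image.1 hW
        have hm := cubeCtr_mem δ hδ ω.1
        refine ⟨cubeCtr δ ω.1, mem_biUnion (fst_mem (Finset.mem_image_of_mem _ (hFO hω))) hm, ?_⟩
        exact (mem_cube_iff lam hlam _ _).1 ((hpar ω hω).2.2.1 hm)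
      have h3 := Nat.card_mono hf h2
      rw [Nat.card_coe_set_eq, Set.ncard_coe_finset] at h3
      exact_mod_cast h3
    obtain ⟨S, hS, hSc, hSm⟩ := select δ lam t σ s Z Om F π L M hL hFO hcase hOne hOL
      (fun F2 hF2 hne hbig => mk_conf δ lam t σ s c Z Om F2 π L M hδ hs0 hs1 hδl hlt ht1 hc hcZ hZ1 hσ0 hls hconf
        (hF2.trans hFO) hne hbig (fun ω hω => hpar ω (hF2 hω))) m hσ hσ1 hσ2 hls hZ hLZ hmZ J hJ Tgt
      (le_trans (by gcongr) hT) hTB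
    refine ⟨S, hS.trans hFO, hSc, fun G hG W hW => ?_⟩
    have hkey : ∀ W ∈ skeleton δ δ lam σ (G : Set DPair), ∃ ω ∈ S, W = π ω := by
      rintro W ⟨w1, w2, ω, hω, w3⟩
      have hωS := hG hω
      exact ⟨ω, hωS, par_unique δ lam σ hδ hlam m hσ ω W (π ω) (hdom ω (hFO (hS hωS))) ⟨w1, w2, w3⟩ (hpar ω (hS hωS))⟩
    obtain ⟨ω, hω, rfl⟩ := hkey W hW
    refine le_trans ?_ (hSm ω hω)
    have hsub : {ω' : DPair | ω' ∈ skeleton δ δ lam σ (G : Set DPair) ∧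
        (lam ≤ Z * lam ∨ lam / Z ≤ tang (cubeCtr lam (π ω).1) (cubeCtr lam ω'.1)) ∧
        tang (cubeCtr lam (π ω).1) (cubeCtr lam ω'.1) ≤ Z * lam ∧
        t / Z ≤ pdist (cubeCtr lam (π ω).1) (cubeCtr lam ω'.1) ∧
        pdist (cubeCtr lam (π ω).1) (cubeCtr lam ω'.1) ≤ Z * t ∧
        (rect (Z * lam) (Z * σ) (cubeCtr lam (π ω).1) (arcCenterAt (cubeCtr lam (π ω).1) σ (π ω).2) ∩
          rect (Z * lam) (Z * σ) (cubeCtr lam ω'.1) (arcCenterAt (cubeCtr lam ω'.1) σ ω'.2)).Nonempty} ⊆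
        (((S.image π).filter (fun w => RR Z lam t σ (π ω) w) : Finset DPair) : Set DPair) := by
      rintro W' ⟨b1, _, b2⟩
      obtain ⟨ω', hω', rfl⟩ := hkey W' b1
      exact Finset.mem_coe.2 (Finset.mem_filter.2 ⟨Finset.mem_image_of_mem _ hω', b2⟩)
    have h3 := Nat.card_mono (Finset.finite_toSet _) hsub
    have e : Nat.card ((((S.image π).filter (fun w => RR Z lam t σ (π ω) w) : Finset DPair) : Set DPair)) =
        ((S.image π).filter (fun w => RR Z lam t σ (π ω) w)).card := by
      rw [Nat.card_coe_set_eq, Set.ncard_coe_finset]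
    rw [e] at h3
    unfold pMult
    exact_mod_cast h3
  · refine ⟨O, Finset.filter_subset _ _, ?_, ?_⟩
    · have h1 : 1 ≤ L ^ 2 * 2 ^ J := Nat.mul_pos (pow_pos hL 2) (by positivity)
      calc Om.card ≤ 2 * 1 * O.card := by omega
        _ ≤ 2 * (L ^ 2 * 2 ^ J) * O.card := Nat.mul_le_mul_right _ (Nat.mul_le_mul_left _ h1)
        _ = _ := by ring
    · rintro G hG W ⟨w1, w2, ω, hω, w3⟩
      exact absurd ⟨W, w1, w2, w3⟩ (Finset.mem_filter.1 (hG hω)).2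


theorem log_small (e A : ℝ) (he : 0 < e) (hA : 0 < A) : ∃ δ₀ > (0:ℝ), δ₀ ≤ 1 / 625 ∧ ∀ δ : ℝ, 0 < δ → δ ≤ δ₀ →
    A * (1 + Real.log δ⁻¹) ≤ δ ^ (-e) := by
  set B := A * (1 + 2 / e) with hB
  have hB0 : 0 < B := by positivity
  refine ⟨min (1 / 625) ((B ^ (2 / e))⁻¹), lt_min (by norm_num) (by positivity), min_le_left _ _, fun δ hδ h => ?_⟩
  have h1 : δ ≤ 1 / 625 := h.trans (min_le_left _ _)
  have h2 : δ ≤ (B ^ (2 / e))⁻¹ := h.trans (min_le_right _ _)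
  have hx : 1 ≤ δ⁻¹ := one_le_inv_iff₀.2 ⟨hδ, by linarith⟩
  have h3 : B ^ (2 / e) ≤ δ⁻¹ := (le_inv_comm₀ (by positivity) hδ).2 h2
  have h4 : B ≤ δ⁻¹ ^ (e / 2) := by
    calc B = (B ^ (2 / e)) ^ (e / 2) := by
          rw [← Real.rpow_mul hB0.le, show 2 / e * (e / 2) = 1 by field_simp, Real.rpow_one]
      _ ≤ _ := Real.rpow_le_rpow (by positivity) h3 (by positivity)
  have h5 := Real.log_le_rpow_div (x := δ⁻¹) (by linarith) (ε := e / 2) (by positivity)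
  have h6 : 1 ≤ δ⁻¹ ^ (e / 2) := Real.one_le_rpow hx (by positivity)
  calc A * (1 + Real.log δ⁻¹) ≤ A * (δ⁻¹ ^ (e / 2) + δ⁻¹ ^ (e / 2) / (e / 2)) := by gcongr
    _ = B * δ⁻¹ ^ (e / 2) := by rw [hB]; field_simp
    _ ≤ δ⁻¹ ^ (e / 2) * δ⁻¹ ^ (e / 2) := by gcongr
    _ = δ ^ (-e) := by
      rw [← Real.rpow_add (by positivity), add_halves, Real.rpow_neg hδ.le, Real.inv_rpow hδ.le]

set_option maxHeartbeats 1600000 in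
theorem final (κ : ℝ) (hκ : 0 < κ) (s : ℝ) (hs0 : 0 < s) (hs1 : s ≤ 1) :
    ∃ ε₀ ∈ Set.Ioc (0 : ℝ) (1 / 2), ∃ K > (0 : ℝ), ∃ δ₀ > (0 : ℝ),
      ∀ δ : ℝ, 0 < δ → δ ≤ δ₀ → ∀ ε : ℝ, 0 < ε → ε ≤ ε₀ →
      ∀ (Ω : Set DPair) (M : ℕ), IsConfigD δ δ s (δ ^ (-ε)) M Ω →
      ∀ lam t : ℝ, δ ≤ lam → lam ≤ t → t ≤ 1 →
      ∃ C : ℝ, C ≤ K * (1 + Real.log δ⁻¹) ^ K ∧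
      ∃ G ⊆ Ω, (∃ M' : ℕ, IsConfigD δ δ s (C * δ ^ (-ε)) M' G) ∧
        (Nat.card Ω : ℝ) ≤ K * (1 + Real.log δ⁻¹) ^ K * (Nat.card G : ℝ) ∧
        ∀ ω ∈ skeleton δ δ lam (dyadicCeil (Real.sqrt (lam / t))) G,
          (pMult δ δ lam (dyadicCeil (Real.sqrt (lam / t))) lam t
              (δ ^ (-ε₀)) (δ ^ (-ε₀)) (δ ^ (-ε₀)) G
              (cubeCtr lam ω.1)
              (arcCenterAt (cubeCtr lam ω.1) (dyadicCeil (Real.sqrt (lam / t))) ω.2) : ℝ) ≤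
            δ ^ (-κ) * lam ^ s * (count3 lam (⋃ k ∈ configP Ω, cubeSet δ k) : ℝ) := by
  set e := min (κ / 100) (1 / 2) with he
  have he0 : 0 < e := lt_min (by positivity) (by norm_num)
  have heκ : e ≤ κ / 100 := min_le_left _ _
  set J := ⌈6 / e⌉₊ with hJ
  have hJe : 6 ≤ e * J := by
    have := Nat.le_ceil (6 / e)
    rw [← hJ, div_le_iff₀ he0] at this
    linarith
  set K : ℝ := 10 ^ 6 * 4 ^ J with hK
  have hK4 : 4 ≤ K := by
    have : (1:ℝ) ≤ 4 ^ J := one_le_pow₀ (by norm_num)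
    rw [hK]; linarith
  obtain ⟨δ₀, hδ₀, hδ₀', hlog⟩ := log_small e (6144 * 259 ^ 7 + 4 * 2 ^ J + 10) he0 (by positivity)
  refine ⟨e, ⟨he0, min_le_right _ _⟩, K, by linarith, δ₀, hδ₀, ?_⟩
  intro δ hδ hδδ ε hε hεe Ω M hconf lam t hδl hlt ht1
  have hδs : δ ≤ 1 / 625 := hδδ.trans hδ₀'
  have hδ1 : δ ≤ 1 := by linarith
  have hl := hlog δ hδ hδδ
  set x := δ⁻¹ with hx
  have hx625 : 625 ≤ x := (le_inv_comm₀ (by norm_num) hδ).2 (by linarith)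
  have hx1 : 1 ≤ x := by linarith
  have hxδ : x * δ = 1 := inv_mul_cancel₀ hδ.ne'
  set ℓ := 1 + Real.log x with hℓ
  have hlog0 : 0 ≤ Real.log x := Real.log_nonneg hx1
  have hℓ1 : 1 ≤ ℓ := by linarith
  set Z := δ ^ (-e) with hZ
  have hJ0 : (0:ℝ) < 2 ^ J := by positivity
  have hZA : 6144 * 259 ^ 7 ≤ Z := by nlinarith
  have hZJ : 4 * 2 ^ J ≤ Z := by nlinarith
  have hZL : 10 * ℓ ≤ Z := by nlinarith
  -- finiteness
  obtain ⟨B, hBc, hB⟩ := total_bound δ hδ hδ1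
  have hΩB : Ω ⊆ (B : Set DPair) := by
    intro ω hω
    have hk : ω.1 ∈ configP Ω := ⟨ω, hω, rfl⟩
    exact hB ω (hconf.2.1 _ hk) ((hconf.2.2.2 _ hk).1 _ hω)
  have hfin : Ω.Finite := (Finset.finite_toSet B).subset hΩB
  obtain ⟨Om, rfl⟩ := hfin.exists_finset_coe
  have hOmB : (Om.card : ℝ) ≤ x ^ 5 := by
    have h1 : (Om.card : ℝ) ≤ B.card := by exact_mod_cast Finset.card_le_card (by exact_mod_cast hΩB)
    calc (Om.card : ℝ) ≤ 625 * x ^ 4 := h1.trans hBc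
      _ ≤ x * x ^ 4 := by gcongr
      _ = _ := by ring
  -- L
  set L := ⌊5 * Real.logb 2 x⌋₊ + 1 with hL
  have hlb0 : 0 ≤ Real.logb 2 x := Real.logb_nonneg (by norm_num) hx1
  have hLl : (L:ℝ) ≤ 10 * ℓ := by
    have h1 := Nat.floor_le (show 0 ≤ 5 * Real.logb 2 x by positivity)
    have h2 : Real.logb 2 x ≤ 2 * Real.log x := by
      rw [Real.logb, div_le_iff₀ (Real.log_pos (by norm_num))]
      nlinarith [Real.log_two_gt_d9]
    rw [hL]; push_cast; linarith
  have hxL : x ^ 5 < 2 ^ L := by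
    have h1 := Nat.lt_floor_add_one (5 * Real.logb 2 x)
    calc x ^ 5 = ((2:ℝ) ^ Real.logb 2 x) ^ 5 := by
          rw [Real.rpow_logb (by norm_num) (by norm_num) (by linarith)]
      _ = (2:ℝ) ^ (5 * Real.logb 2 x) := by
          rw [mul_comm, Real.rpow_mul (by norm_num)]; norm_cast
      _ < (2:ℝ) ^ (L:ℝ) := Real.rpow_lt_rpow_of_exponent_lt (by norm_num) (by rw [hL]; push_cast; exact h1)
      _ = 2 ^ L := Real.rpow_natCast _ _
  have hOL : Om.card < 2 ^ L := by exact_mod_cast hOmB.trans_lt hxL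
  -- σ
  have hlam : 0 < lam := hδ.trans_le hδl
  have ht : 0 < t := hlam.trans_le hlt
  have hq1 : lam / t ≤ 1 := (div_le_one ht).2 hlt
  have hsq0 : 0 < Real.sqrt (lam / t) := Real.sqrt_pos.2 (by positivity)
  have hsq1 : Real.sqrt (lam / t) ≤ 1 := Real.sqrt_le_one.2 hq1
  have hsq : Real.sqrt (lam / t) ^ 2 = lam / t := Real.sq_sqrt (by positivity)
  obtain ⟨d1, d2, m, d3⟩ := dyadicCeil_spec _ hsq0 hsq1
  set σ := dyadicCeil (Real.sqrt (lam / t)) with hσ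
  have hσ0 : 0 < σ := hsq0.trans_le d1
  have htl : t * (lam / t) = lam := by field_simp
  have hσ1 : lam ≤ t * σ ^ 2 := by
    calc lam = t * Real.sqrt (lam / t) ^ 2 := by rw [hsq, htl]
      _ ≤ _ := by gcongr
  have hσ2 : t * σ ^ 2 ≤ 4 * lam := by
    calc t * σ ^ 2 ≤ t * (2 * Real.sqrt (lam / t)) ^ 2 := by gcongr
      _ = 4 * (t * Real.sqrt (lam / t) ^ 2) := by ring
      _ = _ := by rw [hsq, htl]
  have hls : lam ≤ σ := by
    refine le_trans ?_ d1
    have h1 : lam ≤ lam / t := (le_div_iff₀ ht).2 (mul_le_of_le_one_right hlam.le ht1)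
    have h2 : lam ^ 2 ≤ lam := by
      rw [sq]; exact mul_le_of_le_one_right hlam.le (hlt.trans ht1)
    exact Real.le_sqrt_of_sq_le (h2.trans h1)
  have hmL : m ≤ L := by
    have h1 : (2:ℝ) ^ m ≤ x := by
      have : (2:ℝ) ^ m = σ⁻¹ := by rw [d3, inv_inv]
      rw [this, hx]
      exact inv_anti₀ hδ (hδl.trans hls)
    have h2 : (2:ℝ) ^ m < 2 ^ L := by
      refine lt_of_le_of_lt (h1.trans ?_) hxL
      calc x = x ^ 1 := (pow_one x).symm
        _ ≤ x ^ 5 := pow_le_pow_right₀ hx1 (by norm_num)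
    exact ((pow_lt_pow_iff_right₀ (by norm_num : (1:ℝ) < 2)).1 h2).le
  have hmL' : (m:ℝ) ≤ L := by exact_mod_cast hmL
  -- target
  set N := count3 lam (⋃ k ∈ configP (Om : Set DPair), cubeSet δ k) with hN
  have hN1 : (1:ℝ) ≤ N := by
    have hf : (idx3 lam '' (⋃ k ∈ configP (Om : Set DPair), cubeSet δ k)).Finite := by
      refine (dom_finite lam hlam (hlt.trans ht1)).subset (image_mono ?_)
      exact iUnion₂_subset hconf.2.1
    obtain ⟨k, hk⟩ := hconf.1
    have : 0 < N := by
      rw [hN, count3, Nat.card_coe_set_eq, Set.ncard_pos hf]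
      exact ⟨_, cubeCtr δ k, mem_biUnion hk (cubeCtr_mem δ hδ k), rfl⟩
    exact_mod_cast this
  have hκ37 : Z ^ 37 ≤ δ ^ (-κ) := by
    rw [hZ, ← Real.rpow_natCast, ← Real.rpow_mul hδ.le]
    exact Real.rpow_le_rpow_of_exponent_ge hδ hδ1 (by push_cast; linarith)
  have hZ1 : 1 ≤ Z := by nlinarith
  have hκ1 : 1 ≤ δ ^ (-κ) := (one_le_pow₀ hZ1).trans hκ37
  have hlams : δ ≤ lam ^ s := by
    calc δ ≤ lam := hδl
      _ = lam ^ (1:ℝ) := (Real.rpow_one _).symm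
      _ ≤ lam ^ s := Real.rpow_le_rpow_of_exponent_ge hlam (hlt.trans ht1) hs1
  have hZJ6 : x ^ 6 ≤ Z ^ J := by
    have : x ^ 6 = δ ^ (-(6:ℝ)) := by
      rw [Real.rpow_neg hδ.le, hx, inv_pow]; norm_cast
    rw [this, hZ, ← Real.rpow_natCast, ← Real.rpow_mul hδ.le]
    exact Real.rpow_le_rpow_of_exponent_ge hδ hδ1 (by linarith)
  have hTB : (Om.card : ℝ) ≤ Z ^ J * (δ ^ (-κ) * lam ^ s * N) := by
    calc (Om.card : ℝ) ≤ x ^ 5 := hOmB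
      _ = x ^ 6 * (1 * δ * 1) := by linear_combination (-x ^ 5) * hxδ
      _ ≤ _ := by gcongr
  have hcZ : δ ^ (-ε) ≤ Z := Real.rpow_le_rpow_of_exponent_ge hδ hδ1 (by linarith)
  obtain ⟨S, hS, hSc, hSm⟩ := core δ lam t σ s (δ ^ (-ε)) Z Om L M hδ hs0 hs1 hδl hlt ht1 (by positivity) hcZ hconf
    (by omega) hOL m d3 hσ1 hσ2 hls hZA (hLl.trans hZL) (hmL'.trans (hLl.trans hZL)) J hZJ
    (δ ^ (-κ) * lam ^ s * N) (by gcongr) hTB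
  have hfibM : ∀ p ∈ Om.image Prod.fst, (Om.filter (fun ω => ω.1 = p)).card = M := by
    intro p hp
    obtain ⟨_, _, a3⟩ := hconf.2.2.2 p (fst_mem hp)
    rw [coe_fE, Nat.card_coe_set_eq, Set.ncard_coe_finset, card_fE] at a3
    exact a3
  obtain ⟨k0, ω0, hω0, _⟩ := hconf.1
  have hM1 : 1 ≤ M := by
    rw [← hfibM ω0.1 (Finset.mem_image_of_mem _ hω0)]
    exact Finset.card_pos.2 ⟨ω0, Finset.mem_filter.2 ⟨hω0, rfl⟩⟩
  have hQ1 : 1 ≤ 2 * L ^ 2 * 2 ^ J := Nat.mul_pos (Nat.mul_pos (by norm_num) (pow_pos (by omega) 2)) (by positivity)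
  obtain ⟨G, hGS, M', hM', hMM, hGne, hGf, hGP, hGc⟩ := extract Om S hS M (2 * L ^ 2 * 2 ^ J) hQ1 hM1 hfibM ⟨ω0, hω0⟩ hSc
  have hℓK : ℓ ^ 4 ≤ ℓ ^ K := by
    rw [← Real.rpow_natCast]
    exact Real.rpow_le_rpow_of_exponent_le hℓ1 (by push_cast; exact hK4)
  have hJ24 : (2:ℝ) ^ J ≤ 4 ^ J := pow_le_pow_left₀ (by norm_num) (by norm_num) J
  have hC1 : (1782 * ((2 * L ^ 2 * 2 ^ J : ℕ) : ℝ)) ≤ K * ℓ ^ K := by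
    push_cast
    calc 1782 * (2 * (L:ℝ) ^ 2 * 2 ^ J) ≤ 1782 * (2 * (10 * ℓ) ^ 2 * 4 ^ J) := by gcongr
      _ = 356400 * 4 ^ J * ℓ ^ 2 := by ring
      _ ≤ K * ℓ ^ 4 := by
        rw [hK]; gcongr <;> norm_num
      _ ≤ _ := by gcongr
  have hC2 : (4 * ((2 * L ^ 2 * 2 ^ J : ℕ) : ℝ) ^ 2) ≤ K * ℓ ^ K := by
    push_cast
    calc 4 * (2 * (L:ℝ) ^ 2 * 2 ^ J) ^ 2 ≤ 4 * (2 * (10 * ℓ) ^ 2 * 2 ^ J) ^ 2 := by gcongr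
      _ = 160000 * (2 ^ J) ^ 2 * ℓ ^ 4 := by ring
      _ = 160000 * 4 ^ J * ℓ ^ 4 := by rw [← pow_mul, mul_comm J 2, pow_mul]; norm_num
      _ ≤ K * ℓ ^ 4 := by
        rw [hK]; gcongr; norm_num
      _ ≤ _ := by gcongr
  refine ⟨K * ℓ ^ K, le_rfl, (G : Set DPair), by exact_mod_cast hGS.trans hS, ⟨M', ?_⟩, ?_, ?_⟩
  · exact sub_config δ s _ hδ (by positivity) M M' _ Om G hconf (hGS.trans hS) hGne hMM hGf hGP _ hC1
  · rw [Nat.card_coe_set_eq, Nat.card_coe_set_eq, Set.ncard_coe_finset, Set.ncard_coe_finset]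
    calc (Om.card : ℝ) ≤ 4 * ((2 * L ^ 2 * 2 ^ J : ℕ) : ℝ) ^ 2 * G.card := by exact_mod_cast hGc
      _ ≤ _ := by gcongr
  · intro ω hω
    exact hSm G hGS ω hω

/-- bounding the partial multiplicity functions `m_{λ,λ,t}` with maximal
tangency on a positive proportion refinement of a `(δ,δ,s,δ^{-ε})`-configuration. -/
theorem high_tangency_multiplicity_bound :
    ∀ κ : ℝ, 0 < κ → ∀ s : ℝ, 0 < s → s ≤ 1 →
    ∃ ε₀ ∈ Set.Ioc (0 : ℝ) (1 / 2), ∃ K > (0 : ℝ), ∃ δ₀ > (0 : ℝ),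
      ∀ δ : ℝ, 0 < δ → δ ≤ δ₀ → ∀ ε : ℝ, 0 < ε → ε ≤ ε₀ →
      ∀ (Ω : Set DPair) (M : ℕ), IsConfigD δ δ s (δ ^ (-ε)) M Ω →
      ∀ lam t : ℝ, δ ≤ lam → lam ≤ t → t ≤ 1 →
      ∃ C : ℝ, C ≤ K * (1 + Real.log δ⁻¹) ^ K ∧
      ∃ G ⊆ Ω, (∃ M' : ℕ, IsConfigD δ δ s (C * δ ^ (-ε)) M' G) ∧
        (Nat.card Ω : ℝ) ≤ K * (1 + Real.log δ⁻¹) ^ K * (Nat.card G : ℝ) ∧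
        ∀ ω ∈ skeleton δ δ lam (dyadicCeil (Real.sqrt (lam / t))) G,
          (pMult δ δ lam (dyadicCeil (Real.sqrt (lam / t))) lam t
              (δ ^ (-ε₀)) (δ ^ (-ε₀)) (δ ^ (-ε₀)) G
              (cubeCtr lam ω.1)
              (arcCenterAt (cubeCtr lam ω.1) (dyadicCeil (Real.sqrt (lam / t))) ω.2) : ℝ) ≤
            δ ^ (-κ) * lam ^ s * (count3 lam (⋃ k ∈ configP Ω, cubeSet δ k) : ℝ) := by
  intro κ hκ s hs0 hs1
  exact final κ hκ s hs0 hs1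

end
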